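/- Let d ≥ 2, let U ⊂ ℝ^d be open and bounded, r > 0, and suppose the r-cubic set (U)^r is connected. Then there exists an absolute constant C > 0 such that for all y ∈ H¹((U)^r; ℝ^d) there exists R ∈ SO(d) with ∫_{(U)^r} |∇y - R|² dx ≤ C (#𝒬_r(U))² ∫_{(U)^r} dist²(∇y, SO(d)) dx. -/

import Mathlib

open Set MeasureTheory

/-- The half-open cube of sidelength `r` centered at `r·z`, `z ∈ ℤ^d`. -/
def smallCube (d : ℕ) (r : ℝ) (z : Fin d → ℤ) : Set (EuclideanSpace ℝ (Fin d)) :=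
  {x | ∀ i, r * (z i : ℝ) - r/2 ≤ x i ∧ x i < r * (z i : ℝ) + r/2}

/-- The `r`-cubic set `(U)^r`. -/
def cubicSet (d : ℕ) (r : ℝ) (U : Set (EuclideanSpace ℝ (Fin d))) :
    Set (EuclideanSpace ℝ (Fin d)) :=
  interior (⋃ z ∈ {z : Fin d → ℤ | (smallCube d r z ∩ U).Nonempty}, closure (smallCube d r z))

/-- The number `#𝒬_r(U)` of tessellation cubes meeting `U`. -/
noncomputable def numCubes (d : ℕ) (r : ℝ) (U : Set (EuclideanSpace ℝ (Fin d))) : ℕ :=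
  Nat.card {z : Fin d → ℤ // (smallCube d r z ∩ U).Nonempty}

/-- `SO(d)` realized as a set of continuous linear maps on `ℝ^d`: linear isometries of
determinant one. -/
def SOcl (d : ℕ) : Set (EuclideanSpace ℝ (Fin d) →L[ℝ] EuclideanSpace ℝ (Fin d)) :=
  {A | (∀ x, ‖A x‖ = ‖x‖) ∧
    LinearMap.det (A : EuclideanSpace ℝ (Fin d) →ₗ[ℝ] EuclideanSpace ℝ (Fin d)) = 1}

/-- `SO(d)` as a set of real arrays, indexed by row and column. -/
def SOm (d : ℕ) : Set (Fin d → Fin d → ℝ) :=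
  {A | (Matrix.of A).transpose * Matrix.of A = 1 ∧ (Matrix.of A).det = 1}

/-- The `(i, j)` cofactor of an array. -/
def cof {d : ℕ} (A : Fin d → Fin d → ℝ) (i j : Fin d) : ℝ := (Matrix.of A).adjugate j i

lemma abs_entry_le_norm {d : ℕ} (A : Fin d → Fin d → ℝ) (i j : Fin d) : |A i j| ≤ ‖A‖ :=
  (norm_le_pi_norm (A i) j).trans (norm_le_pi_norm A i)

lemma one_mem_SOm (d : ℕ) : (fun i j => (1 : Matrix (Fin d) (Fin d) ℝ) i j) ∈ SOm d := by
  have h : Matrix.of (fun i j => (1 : Matrix (Fin d) (Fin d) ℝ) i j) = 1 := rfl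
  simp [SOm, h]

lemma SOm_nonempty (d : ℕ) : (SOm d).Nonempty := ⟨_, one_mem_SOm d⟩

lemma sum_mul_of_mem_SOm {d : ℕ} {A : Fin d → Fin d → ℝ} (hA : A ∈ SOm d) (i j : Fin d) :
    ∑ k, A k i * A k j = if i = j then 1 else 0 := by
  have := congrFun (congrFun hA.1 i) j
  simpa [Matrix.mul_apply, Matrix.one_apply] using this

lemma sum_mul_of_mem_SOm' {d : ℕ} {A : Fin d → Fin d → ℝ} (hA : A ∈ SOm d) (i j : Fin d) :
    ∑ k, A i k * A j k = if i = j then 1 else 0 := by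
  have h : Matrix.of A * (Matrix.of A).transpose = 1 := mul_eq_one_comm.1 hA.1
  have := congrFun (congrFun h i) j
  simpa [Matrix.mul_apply, Matrix.one_apply] using this

lemma norm_le_one_of_mem_SOm {d : ℕ} {A : Fin d → Fin d → ℝ} (hA : A ∈ SOm d) : ‖A‖ ≤ 1 := by
  refine (pi_norm_le_iff_of_nonneg zero_le_one).2 fun i =>
    (pi_norm_le_iff_of_nonneg zero_le_one).2 fun j => ?_
  have h := sum_mul_of_mem_SOm hA j j
  rw [if_pos rfl] at h
  have h2 : A i j * A i j ≤ ∑ k, A k j * A k j :=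
    Finset.single_le_sum (f := fun k => A k j * A k j) (fun k _ => mul_self_nonneg _)
      (Finset.mem_univ i)
  rw [Real.norm_eq_abs]
  exact abs_le_one_iff_mul_self_le_one.2 (h2.trans h.le)

lemma isClosed_SOm (d : ℕ) : IsClosed (SOm d) := by
  have h1 : Continuous fun A : Fin d → Fin d → ℝ => (Matrix.of A : Matrix (Fin d) (Fin d) ℝ) :=
    continuous_id
  exact (isClosed_eq (h1.matrix_transpose.matrix_mul h1) continuous_const).inter
    (isClosed_eq h1.matrix_det continuous_const)

lemma isCompact_SOm (d : ℕ) : IsCompact (SOm d) :=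
  (isCompact_closedBall 0 1).of_isClosed_subset (isClosed_SOm d)
    fun A hA => by simpa using norm_le_one_of_mem_SOm hA

lemma exists_infDist_SOm {d : ℕ} (A : Fin d → Fin d → ℝ) :
    ∃ R ∈ SOm d, Metric.infDist A (SOm d) = ‖A - R‖ := by
  obtain ⟨R, hR, h⟩ := (isCompact_SOm d).exists_infDist_eq_dist (SOm_nonempty d) A
  exact ⟨R, hR, by rw [h, dist_eq_norm]⟩

lemma infDist_SOm_le {d : ℕ} (A : Fin d → Fin d → ℝ) : Metric.infDist A (SOm d) ≤ ‖A‖ + 1 := by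
  obtain ⟨R, hR⟩ := SOm_nonempty d
  refine (Metric.infDist_le_dist_of_mem hR).trans ?_
  rw [dist_eq_norm]
  linarith [norm_sub_le A R, norm_le_one_of_mem_SOm hR]

/-- A smooth function vanishing on `SO(d)` is locally controlled by the distance to `SO(d)`. -/
lemma exists_abs_le_infDist_SOm {d : ℕ} {G : (Fin d → Fin d → ℝ) → ℝ} (hG : ContDiff ℝ 1 G)
    (h0 : ∀ R ∈ SOm d, G R = 0) (L : ℝ) :
    ∃ C : ℝ, 0 ≤ C ∧ ∀ A, ‖A‖ ≤ L → |G A| ≤ C * Metric.infDist A (SOm d) := by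
  have hc : IsCompact (Metric.closedBall (0 : Fin d → Fin d → ℝ) (max L 1)) :=
    isCompact_closedBall _ _
  obtain ⟨K, hK⟩ : ∃ K, LipschitzOnWith K G (Metric.closedBall 0 (max L 1)) :=
    hG.contDiffOn.exists_lipschitzOnWith (by norm_num) (convex_closedBall _ _) hc
  refine ⟨K, K.2, fun A hA => ?_⟩
  obtain ⟨R, hR, h⟩ := exists_infDist_SOm A
  have := hK.dist_le_mul A (by simp [hA]) R
    (by simp [norm_le_one_of_mem_SOm hR])
  rw [h0 R hR, Real.dist_eq, sub_zero, dist_eq_norm] at this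
  rwa [h]

lemma contDiff_entry {d : ℕ} (i j : Fin d) {n : WithTop ℕ∞} :
    ContDiff ℝ n fun A : Fin d → Fin d → ℝ => A i j := by fun_prop

lemma contDiff_cof {d : ℕ} (i j : Fin d) {n : WithTop ℕ∞} :
    ContDiff ℝ n fun A : Fin d → Fin d → ℝ => cof A i j := by
  simp only [cof, Matrix.adjugate_apply, Matrix.det_apply]
  refine ContDiff.sum fun σ _ => ContDiff.const_smul _ (contDiff_prod fun k _ => ?_)
  by_cases h : σ k = i
  · simp only [Matrix.updateRow_apply, h, if_true]
    exact contDiff_const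
  · simp only [Matrix.updateRow_apply, h, if_false, Matrix.of_apply]
    fun_prop

lemma cof_of_mem_SOm {d : ℕ} {A : Fin d → Fin d → ℝ} (hA : A ∈ SOm d) : cof A = A := by
  have h1 : (Matrix.of A).adjugate = (Matrix.of A).transpose := by
    have h2 : Matrix.of A * (Matrix.of A).adjugate = 1 := by
      rw [Matrix.mul_adjugate, hA.2, one_smul]
    calc (Matrix.of A).adjugate
        = (Matrix.of A).transpose * Matrix.of A * (Matrix.of A).adjugate := by
          rw [hA.1, one_mul]
      _ = (Matrix.of A).transpose := by rw [mul_assoc, h2, mul_one]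
  ext i j
  simp [cof, h1]

lemma exists_abs_sub_cof_le (d : ℕ) (L : ℝ) :
    ∃ C : ℝ, 0 ≤ C ∧ ∀ A : Fin d → Fin d → ℝ, ‖A‖ ≤ L → ∀ i j,
      |A i j - cof A i j| ≤ C * Metric.infDist A (SOm d) := by
  have h : ∀ i j : Fin d, ∃ C : ℝ, 0 ≤ C ∧ ∀ A : Fin d → Fin d → ℝ, ‖A‖ ≤ L →
      |A i j - cof A i j| ≤ C * Metric.infDist A (SOm d) := fun i j =>
    exists_abs_le_infDist_SOm ((contDiff_entry i j).sub (contDiff_cof i j))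
      (fun R hR => by simp [cof_of_mem_SOm hR]) L
  choose C hC0 hC using h
  refine ⟨∑ i, ∑ j, C i j, Finset.sum_nonneg fun i _ => Finset.sum_nonneg fun j _ => hC0 i j,
    fun A hA i j => (hC i j A hA).trans ?_⟩
  refine mul_le_mul_of_nonneg_right ?_ Metric.infDist_nonneg
  exact (Finset.single_le_sum (f := fun j => C i j) (fun j _ => hC0 i j)
    (Finset.mem_univ j)).trans (Finset.single_le_sum (f := fun i => ∑ j, C i j)
    (fun i _ => Finset.sum_nonneg fun j _ => hC0 i j) (Finset.mem_univ i))

lemma exists_abs_sum_sq_sub_le (d : ℕ) (L : ℝ) :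
    ∃ C : ℝ, 0 ≤ C ∧ ∀ A : Fin d → Fin d → ℝ, ‖A‖ ≤ L →
      |(∑ i, ∑ j, A i j ^ 2) - d| ≤ C * Metric.infDist A (SOm d) := by
  refine exists_abs_le_infDist_SOm (by fun_prop) (fun R hR => ?_) L
  rw [sub_eq_zero, Finset.sum_comm]
  have : ∀ j, ∑ i, R i j ^ 2 = 1 := fun j => by
    simpa [sq] using sum_mul_of_mem_SOm hR j j
  simp [this]

/-- The symmetric part of `Rᵀ A - 1` is controlled by the distance of `A` to `SO(d)`, up to a
quadratic error. -/
lemma exists_abs_sym_le (d : ℕ) (L : ℝ) :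
    ∃ C : ℝ, 0 ≤ C ∧ ∀ A : Fin d → Fin d → ℝ, ‖A‖ ≤ L → ∀ R ∈ SOm d, ∀ i j,
      |(∑ k, R k i * (A k j - R k j)) + ∑ k, R k j * (A k i - R k i)|
        ≤ C * (Metric.infDist A (SOm d) + ‖A - R‖ ^ 2) := by
  have h : ∀ i j : Fin d, ∃ C : ℝ, 0 ≤ C ∧ ∀ A : Fin d → Fin d → ℝ, ‖A‖ ≤ L →
      |(∑ k, A k i * A k j) - if i = j then 1 else 0| ≤ C * Metric.infDist A (SOm d) := fun i j =>
    exists_abs_le_infDist_SOm (by fun_prop)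
      (fun R hR => by simp [sum_mul_of_mem_SOm hR]) L
  choose C hC0 hC using h
  refine ⟨(∑ i, ∑ j, C i j) + d, add_nonneg (Finset.sum_nonneg fun i _ =>
    Finset.sum_nonneg fun j _ => hC0 i j) (Nat.cast_nonneg _), fun A hA R hR i j => ?_⟩
  have e1 : (∑ k, R k i * (A k j - R k j)) + ∑ k, R k j * (A k i - R k i)
      = ((∑ k, A k i * A k j) - if i = j then 1 else 0)
        - ∑ k, (A k i - R k i) * (A k j - R k j) := by
    have h1 := sum_mul_of_mem_SOm hR i j
    rw [← h1, ← Finset.sum_sub_distrib, ← Finset.sum_sub_distrib, ← Finset.sum_add_distrib]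
    exact Finset.sum_congr rfl fun k _ => by ring
  have e2 : |∑ k, (A k i - R k i) * (A k j - R k j)| ≤ d * ‖A - R‖ ^ 2 := by
    refine (Finset.abs_sum_le_sum_abs _ _).trans ?_
    calc ∑ k, |(A k i - R k i) * (A k j - R k j)| ≤ ∑ _k : Fin d, ‖A - R‖ ^ 2 := by
          refine Finset.sum_le_sum fun k _ => ?_
          rw [abs_mul, sq]
          exact mul_le_mul (abs_entry_le_norm (A - R) k i) (abs_entry_le_norm (A - R) k j)
            (abs_nonneg _) (norm_nonneg _)
      _ = _ := by simp
  have e3 : C i j ≤ ∑ i, ∑ j, C i j :=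
    (Finset.single_le_sum (f := fun j => C i j) (fun j _ => hC0 i j)
      (Finset.mem_univ j)).trans (Finset.single_le_sum (f := fun i => ∑ j, C i j)
      (fun i _ => Finset.sum_nonneg fun j _ => hC0 i j) (Finset.mem_univ i))
  rw [e1]
  have h0 : (0 : ℝ) ≤ Metric.infDist A (SOm d) := Metric.infDist_nonneg
  have hs : (0 : ℝ) ≤ ∑ i, ∑ j, C i j := (hC0 i j).trans e3
  have hd : (0 : ℝ) ≤ d := Nat.cast_nonneg _
  calc _ ≤ C i j * Metric.infDist A (SOm d) + d * ‖A - R‖ ^ 2 :=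
        (abs_sub _ _).trans (add_le_add (hC i j A hA) e2)
    _ ≤ _ := by nlinarith [mul_le_mul_of_nonneg_right e3 h0, mul_nonneg hs (sq_nonneg ‖A - R‖),
        mul_nonneg hd h0]

/-- The `j`-th partial derivative. -/
noncomputable def pd {d : ℕ} (u : (Fin d → ℝ) → ℝ) (j : Fin d) (x : Fin d → ℝ) : ℝ :=
  fderiv ℝ u x (Pi.single j 1)

/-- The convolution of two real functions, written as an integral. -/
noncomputable def moll {d : ℕ} (ψ g : (Fin d → ℝ) → ℝ) (x : Fin d → ℝ) : ℝ :=
  ∫ z, ψ z * g (x - z)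

lemma moll_eq_convolution {d : ℕ} (ψ g : (Fin d → ℝ) → ℝ) :
    moll ψ g = convolution ψ g (ContinuousLinearMap.lsmul ℝ ℝ) volume := by
  ext x
  simp [moll, convolution]

lemma norm_single_one {d : ℕ} (j : Fin d) : ‖(Pi.single j 1 : Fin d → ℝ)‖ = 1 := by
  rw [Pi.norm_single, norm_one]

lemma abs_pd_le {d : ℕ} {u : (Fin d → ℝ) → ℝ} {L : NNReal} (hu : LipschitzWith L u) (j : Fin d)
    (x : Fin d → ℝ) : |pd u j x| ≤ L := by
  have h := (fderiv ℝ u x).le_opNorm (Pi.single j 1)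
  rw [norm_single_one, mul_one, Real.norm_eq_abs] at h
  exact h.trans (norm_fderiv_le_of_lipschitz ℝ hu)

lemma measurable_pd {d : ℕ} (u : (Fin d → ℝ) → ℝ) (j : Fin d) : Measurable (pd u j) :=
  measurable_fderiv_apply_const ℝ u _

lemma locallyIntegrable_of_bound {d : ℕ} {g : (Fin d → ℝ) → ℝ} {K : ℝ} (hg : Measurable g)
    (hK : ∀ x, |g x| ≤ K) : LocallyIntegrable g := by
  refine (locallyIntegrable_const K).mono hg.aestronglyMeasurable ?_
  exact Filter.Eventually.of_forall fun x => (hK x).trans (le_abs_self K)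

lemma locallyIntegrable_pd {d : ℕ} {u : (Fin d → ℝ) → ℝ} {L : NNReal} (hu : LipschitzWith L u)
    (j : Fin d) : LocallyIntegrable (pd u j) :=
  locallyIntegrable_of_bound (measurable_pd u j) (abs_pd_le hu j)

lemma integrable_mul_of_bound {d : ℕ} {ψ g : (Fin d → ℝ) → ℝ} {K : ℝ} (hψ : Integrable ψ)
    (hg : Measurable g) (hK : ∀ x, |g x| ≤ K) : Integrable fun z => ψ z * g z :=
  hψ.mul_bdd (c := K) hg.aestronglyMeasurable (Filter.Eventually.of_forall hK)

lemma integrable_mul_shift {d : ℕ} {ψ g : (Fin d → ℝ) → ℝ} {K : ℝ} (hψ : Integrable ψ)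
    (hg : Measurable g) (hK : ∀ x, |g x| ≤ K) (x : Fin d → ℝ) :
    Integrable fun z => ψ z * g (x - z) :=
  integrable_mul_of_bound hψ (hg.comp (measurable_const.sub measurable_id)) fun _ => hK _

lemma ae_differentiableAt_shift {d : ℕ} {u : (Fin d → ℝ) → ℝ} {L : NNReal}
    (hu : LipschitzWith L u) (x : Fin d → ℝ) :
    ∀ᵐ z, DifferentiableAt ℝ u (x - z) := by
  have h := hu.ae_differentiableAt (μ := (volume : Measure (Fin d → ℝ)))
  exact (Measure.measurePreserving_sub_left volume x).quasiMeasurePreserving.ae h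

lemma hasFDerivAt_moll {d : ℕ} {u ψ : (Fin d → ℝ) → ℝ} {L : NNReal} (hu : LipschitzWith L u)
    (hψ : Continuous ψ) (hc : HasCompactSupport ψ) (x : Fin d → ℝ) :
    HasFDerivAt (moll ψ u) (∫ z, ψ z • fderiv ℝ u (x - z)) x := by
  refine (hasFDerivAt_integral_of_dominated_loc_of_lip (F := fun x z => ψ z * u (x - z))
    (F' := fun z => ψ z • fderiv ℝ u (x - z)) (bound := fun z => |ψ z| * L) (s := univ)
    Filter.univ_mem ?_ ?_ ?_ ?_ ?_ ?_).2
  · exact Filter.Eventually.of_forall fun w =>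
      (hψ.mul (hu.continuous.comp (by fun_prop))).aestronglyMeasurable
  · exact (hψ.mul (hu.continuous.comp (by fun_prop))).integrable_of_hasCompactSupport hc.mul_right
  · exact (hψ.aestronglyMeasurable).smul
      ((measurable_fderiv ℝ u).comp (measurable_const.sub measurable_id)).aestronglyMeasurable
  · refine Filter.Eventually.of_forall fun z => LipschitzOnWith.of_dist_le_mul fun a _ b _ => ?_
    have h := hu.dist_le_mul (a - z) (b - z)
    rw [dist_sub_right] at h
    rw [Real.dist_eq, ← mul_sub, abs_mul, Real.coe_nnabs, abs_mul, abs_abs, NNReal.abs_eq,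
      mul_assoc]
    exact mul_le_mul_of_nonneg_left h (abs_nonneg _)
  · exact (hψ.abs.integrable_of_hasCompactSupport hc.abs).mul_const _
  · filter_upwards [ae_differentiableAt_shift hu x] with z hz
    have h1 : HasFDerivAt (fun a => u (a - z)) (fderiv ℝ u (x - z)) x := by
      exact hz.hasFDerivAt.comp x ((hasFDerivAt_id x).sub_const z)
    exact h1.const_mul (ψ z)

lemma pd_moll {d : ℕ} {u ψ : (Fin d → ℝ) → ℝ} {L : NNReal} (hu : LipschitzWith L u)
    (hψ : Continuous ψ) (hc : HasCompactSupport ψ) (j : Fin d) :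
    pd (moll ψ u) j = moll ψ (pd u j) := by
  ext x
  rw [pd, (hasFDerivAt_moll hu hψ hc x).fderiv, ContinuousLinearMap.integral_apply]
  · rfl
  · refine ((hψ.norm.integrable_of_hasCompactSupport hc.norm).mul_const (L : ℝ)).mono
      (hψ.aestronglyMeasurable.smul ((measurable_fderiv ℝ u).comp
        (measurable_const.sub measurable_id)).aestronglyMeasurable) ?_
    refine Filter.Eventually.of_forall fun z => ?_
    rw [norm_smul, norm_mul, norm_norm]
    exact mul_le_mul_of_nonneg_left ((norm_fderiv_le_of_lipschitz ℝ hu).trans (le_abs_self _))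
      (norm_nonneg _)

lemma contDiff_moll {d : ℕ} {g ψ : (Fin d → ℝ) → ℝ} (hg : LocallyIntegrable g) {n : ℕ∞}
    (hψ : ContDiff ℝ n ψ) (hc : HasCompactSupport ψ) : ContDiff ℝ n (moll ψ g) := by
  rw [moll_eq_convolution]
  exact hc.contDiff_convolution_left _ hψ hg

lemma pd_moll_left {d : ℕ} {g ψ : (Fin d → ℝ) → ℝ} {K : ℝ} (hg : Measurable g)
    (hK : ∀ x, |g x| ≤ K) (hψ : ContDiff ℝ 1 ψ) (hc : HasCompactSupport ψ) (j : Fin d) :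
    pd (moll ψ g) j = moll (pd ψ j) g := by
  ext x
  have h := hc.hasFDerivAt_convolution_left (ContinuousLinearMap.lsmul ℝ ℝ) hψ
    (locallyIntegrable_of_bound hg hK) x
  rw [moll_eq_convolution, pd, h.fderiv, convolution, ContinuousLinearMap.integral_apply]
  · simp [moll, pd]
  · exact (hc.fderiv (𝕜 := ℝ)).convolutionExists_left _ (hψ.continuous_fderiv one_ne_zero)
      (locallyIntegrable_of_bound hg hK) x

lemma contDiff_pd {d : ℕ} {u : (Fin d → ℝ) → ℝ} {m n : WithTop ℕ∞} (hu : ContDiff ℝ n u)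
    (h : m + 1 ≤ n) (j : Fin d) : ContDiff ℝ m (pd u j) :=
  (hu.fderiv_right h).clm_apply contDiff_const

lemma hasCompactSupport_pd {d : ℕ} {u : (Fin d → ℝ) → ℝ} (hu : HasCompactSupport u) (j : Fin d) :
    HasCompactSupport (pd u j) :=
  (hu.fderiv (𝕜 := ℝ)).comp_left (g := fun A : (Fin d → ℝ) →L[ℝ] ℝ => A (Pi.single j 1)) rfl

lemma lipschitzWith_moll {d : ℕ} {u ψ : (Fin d → ℝ) → ℝ} {L : NNReal} (hu : LipschitzWith L u)
    (hψ : Continuous ψ) (hc : HasCompactSupport ψ) (h0 : ∀ z, 0 ≤ ψ z) (h1 : ∫ z, ψ z = 1) :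
    LipschitzWith L (moll ψ u) := by
  refine LipschitzWith.of_dist_le_mul fun a b => ?_
  have hi : ∀ a, Integrable fun z => ψ z * u (a - z) := fun a =>
    (hψ.mul (hu.continuous.comp (by fun_prop))).integrable_of_hasCompactSupport hc.mul_right
  rw [Real.dist_eq, moll, moll, ← integral_sub (hi a) (hi b)]
  calc |∫ z, ψ z * u (a - z) - ψ z * u (b - z)| ≤ ∫ z, ψ z * (L * dist a b) := by
        rw [← Real.norm_eq_abs]
        refine norm_integral_le_of_norm_le
          ((hψ.integrable_of_hasCompactSupport hc).mul_const _)
          (Filter.Eventually.of_forall fun z => ?_)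
        have h := hu.dist_le_mul (a - z) (b - z)
        rw [dist_sub_right] at h
        rw [← mul_sub, norm_mul, Real.norm_of_nonneg (h0 z)]
        exact mul_le_mul_of_nonneg_left h (h0 z)
    _ = L * dist a b := by rw [integral_mul_const, h1, one_mul]

/-- A smooth mollifier supported in the ball of radius `t`. -/
lemma exists_mollifier (d : ℕ) {t : ℝ} (ht : 0 < t) : ∃ ψ : (Fin d → ℝ) → ℝ,
    ContDiff ℝ (⊤ : ℕ∞) ψ ∧ HasCompactSupport ψ ∧ (∀ z, 0 ≤ ψ z) ∧ (∫ z, ψ z = 1) ∧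
      ∀ z, ψ z ≠ 0 → ‖z‖ < t := by
  let b : ContDiffBump (0 : Fin d → ℝ) := ⟨t / 2, t, by positivity, by linarith⟩
  refine ⟨b.normed volume, b.contDiff_normed, b.hasCompactSupport_normed, b.nonneg_normed,
    b.integral_normed, fun z hz => ?_⟩
  have : z ∈ Function.support (b.normed volume) := hz
  rw [b.support_normed_eq] at this
  simpa using this

/-- Smooth approximation of a Lipschitz function. -/
lemma exists_smooth_approx {d : ℕ} (L : NNReal) : ∃ T : ℕ → ((Fin d → ℝ) → ℝ) → (Fin d → ℝ) → ℝ,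
    ∀ u : (Fin d → ℝ) → ℝ, LipschitzWith L u →
      (∀ n, ContDiff ℝ (⊤ : ℕ∞) (T n u)) ∧ (∀ n, LipschitzWith L (T n u)) ∧
      (∀ x, Filter.Tendsto (fun n => T n u x) Filter.atTop (nhds (u x))) ∧
      (∀ᵐ x, ∀ j, Filter.Tendsto (fun n => pd (T n u) j x) Filter.atTop (nhds (pd u j x))) ∧
      ∀ n x, T n u x ≠ 0 → ∃ w, u w ≠ 0 ∧ ‖x - w‖ < 1 := by
  let b : ℕ → ContDiffBump (0 : Fin d → ℝ) := fun n =>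
    ⟨1 / ((n : ℝ) + 1) / 2, 1 / ((n : ℝ) + 1), by positivity, by
      have : 0 < 1 / ((n : ℝ) + 1) := by positivity
      linarith⟩
  have hb : Filter.Tendsto (fun n => (b n).rOut) Filter.atTop (nhds 0) :=
    tendsto_one_div_add_atTop_nhds_zero_nat
  refine ⟨fun n => moll ((b n).normed volume), fun u hu => ⟨fun n => ?_, fun n => ?_, fun x => ?_,
    ?_, fun n x hx => ?_⟩⟩
  · exact contDiff_moll hu.continuous.locallyIntegrable (b n).contDiff_normed
      (b n).hasCompactSupport_normed
  · exact lipschitzWith_moll hu (b n).continuous_normed (b n).hasCompactSupport_normed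
      (b n).nonneg_normed (b n).integral_normed
  · simp only [moll_eq_convolution]
    exact ContDiffBump.convolution_tendsto_right_of_continuous hb hu.continuous x
  · rw [ae_all_iff]
    intro j
    have := ContDiffBump.ae_convolution_tendsto_right_of_locallyIntegrable (K := 2) (φ := b)
      (l := Filter.atTop) (μ := (volume : Measure (Fin d → ℝ))) hb
      (Filter.Eventually.of_forall fun n => by
        change 1 / ((n : ℝ) + 1) ≤ 2 * (1 / ((n : ℝ) + 1) / 2)
        linarith) (locallyIntegrable_pd hu j)
    filter_upwards [this] with x hx
    simp only [pd_moll hu (b _).continuous_normed (b _).hasCompactSupport_normed]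
    simpa only [moll_eq_convolution] using hx
  · by_contra! hcon
    refine hx (integral_eq_zero_of_ae (Filter.Eventually.of_forall fun z => ?_))
    by_cases hz : u (x - z) = 0
    · simp [hz]
    · have h1 := hcon _ hz
      have : z ∉ Function.support ((b n).normed volume) := by
        rw [(b n).support_normed_eq]
        simp only [sub_sub_cancel] at h1
        simp only [Metric.mem_ball, dist_zero_right, not_lt]
        refine le_trans ?_ h1
        change 1 / ((n : ℝ) + 1) ≤ 1
        rw [div_le_one (by positivity)]
        linarith [(Nat.cast_nonneg n : (0 : ℝ) ≤ n)]
      simp [Function.notMem_support.1 this]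

/-- The gradient matrix of a map given by its components. -/
noncomputable def grad {d : ℕ} (y : Fin d → (Fin d → ℝ) → ℝ) (x : Fin d → ℝ) : Fin d → Fin d → ℝ :=
  fun i j => pd (y i) j x

lemma pd_comm {d : ℕ} {u : (Fin d → ℝ) → ℝ} (hu : ContDiff ℝ 2 u) (j l : Fin d) (x : Fin d → ℝ) :
    pd (pd u l) j x = pd (pd u j) l x := by
  have h1 : ContDiff ℝ 1 (fderiv ℝ u) := hu.fderiv_right (by norm_num)
  have h2 : HasFDerivAt (fderiv ℝ u) (fderiv ℝ (fderiv ℝ u) x) x :=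
    (h1.differentiable (by norm_num) x).hasFDerivAt
  have key := second_derivative_symmetric
    (fun y => (hu.differentiable (by norm_num) y).hasFDerivAt) h2
  have h3 : ∀ a b : Fin d, pd (pd u a) b x
      = fderiv ℝ (fderiv ℝ u) x (Pi.single b 1) (Pi.single a 1) := by
    intro a b
    have := (h2.clm_apply (hasFDerivAt_const (Pi.single a (1:ℝ)) x)).fderiv
    unfold pd
    rw [this]
    simp
  rw [h3, h3, key]

/-- The determinant as a continuous multilinear map of the rows. -/
noncomputable def detRows (d : ℕ) :
    ContinuousMultilinearMap ℝ (fun _ : Fin d => (Fin d → ℝ)) ℝ :=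
  ⟨(Matrix.detRowAlternating (n := Fin d) (R := ℝ)).toMultilinearMap, by
    change Continuous fun A : Fin d → Fin d → ℝ => (Matrix.of A).det
    exact Continuous.matrix_det continuous_id⟩

lemma detRows_swap {d : ℕ} (A : Fin d → Fin d → ℝ) {i k : Fin d} (h : k ≠ i) (a b : Fin d → ℝ) :
    detRows d (Function.update (Function.update A i a) k b)
      = - detRows d (Function.update (Function.update A i b) k a) := by
  have := (Matrix.detRowAlternating (n := Fin d) (R := ℝ)).map_swap
    (Function.update (Function.update A i b) k a) h
  change detRows d _ = - detRows d _ at this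
  rw [← this]
  congr 1
  funext m
  by_cases hm : m = k
  · subst hm; simp [Function.update_of_ne h.symm]
  · by_cases hi : m = i
    · subst hi; simp [Function.update_of_ne hm]
    · simp [Equiv.swap_apply_of_ne_of_ne hm hi, hm, hi]

lemma cof_eq_detRows {d : ℕ} (A : Fin d → Fin d → ℝ) (i j : Fin d) :
    cof A i j = detRows d (Function.update A i (Pi.single j 1)) := by
  rw [cof, Matrix.adjugate_apply]
  rfl

/-- The rows of the cofactor matrix of a smooth gradient are divergence free. -/
lemma sum_pd_cof {d : ℕ} {y : Fin d → (Fin d → ℝ) → ℝ} (hy : ∀ i, ContDiff ℝ 2 (y i)) (i : Fin d)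
    (x : Fin d → ℝ) : ∑ j, pd (fun x => cof (grad y x) i j) j x = 0 := by
  have hrow : ∀ k, HasFDerivAt (fun x => grad y x k)
      (ContinuousLinearMap.pi fun l => fderiv ℝ (pd (y k) l) x) x := by
    intro k
    rw [hasFDerivAt_pi]
    intro l
    exact ((contDiff_pd (m := 1) (hy k) (by norm_num) l).differentiable (by norm_num) x).hasFDerivAt
  have h1 : ∀ j, pd (fun x => cof (grad y x) i j) j x
      = ∑ k ∈ Finset.univ.erase i, ∑ l, pd (pd (y k) l) j x *
        detRows d (Function.update (Function.update (grad y x) i (Pi.single j 1)) k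
          (Pi.single l 1)) := by
    intro j
    have h2 : ∀ k, HasFDerivAt
        (fun x => Function.update (grad y x) i (Pi.single j (1:ℝ)) k)
        (if k = i then 0 else ContinuousLinearMap.pi fun l => fderiv ℝ (pd (y k) l) x) x := by
      intro k
      by_cases hk : k = i
      · subst hk
        simpa using hasFDerivAt_const (𝕜 := ℝ) (Pi.single j (1:ℝ) : Fin d → ℝ) x
      · simpa [hk] using hrow k
    have h3 := HasFDerivAt.multilinear_comp (f := detRows d) h2
    simp only [cof_eq_detRows]
    unfold pd
    rw [h3.fderiv, sum_apply,
      ← Finset.add_sum_erase _ _ (Finset.mem_univ i)]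
    simp only [if_true, ContinuousLinearMap.comp_zero, zero_apply, zero_add]
    refine Finset.sum_congr rfl fun k hk => ?_
    rw [if_neg (Finset.ne_of_mem_erase hk)]
    change detRows d (Function.update (Function.update (grad y x) i (Pi.single j 1)) k
      (fun l => fderiv ℝ (pd (y k) l) x (Pi.single j 1))) = _
    rw [pi_eq_sum_univ' (fun l => fderiv ℝ (pd (y k) l) x (Pi.single j (1:ℝ)))]
    refine ((detRows d).toMultilinearMap.map_update_sum _ _ _ _).trans ?_
    refine Finset.sum_congr rfl fun l _ => ?_
    refine ((detRows d).toMultilinearMap.map_update_smul _ _ _ _).trans ?_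
    rw [smul_eq_mul]
    congr 2
  simp only [h1]
  rw [Finset.sum_comm]
  refine Finset.sum_eq_zero fun k hk => ?_
  set F : Fin d → Fin d → ℝ := fun j l => pd (pd (y k) l) j x *
        detRows d (Function.update (Function.update (grad y x) i (Pi.single j 1)) k
          (Pi.single l 1)) with hF
  have hanti : ∀ j l, F j l = - F l j := by
    intro j l
    simp only [hF]
    rw [detRows_swap _ (Finset.ne_of_mem_erase hk), pd_comm (hy k) j l]
    ring
  change ∑ j, ∑ l, F j l = 0
  have : ∑ j, ∑ l, F j l = - ∑ j, ∑ l, F j l := by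
    conv_lhs => rw [Finset.sum_comm]
    rw [← Finset.sum_neg_distrib]
    refine Finset.sum_congr rfl fun j _ => ?_
    rw [← Finset.sum_neg_distrib]
    exact Finset.sum_congr rfl fun l _ => hanti _ _
  linarith

lemma integral_mul_pd {d : ℕ} {u v : (Fin d → ℝ) → ℝ} (hu : ContDiff ℝ 1 u) (hv : ContDiff ℝ 1 v)
    (hc : HasCompactSupport v) (j : Fin d) :
    ∫ x, u x * pd v j x = - ∫ x, pd u j x * v x := by
  refine integral_mul_fderiv_eq_neg_fderiv_mul_of_integrable ?_ ?_ ?_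
    (fun x _ => hu.differentiable (by norm_num) x) (fun x _ => hv.differentiable (by norm_num) x)
  · exact ((contDiff_pd (m := 0) hu (by norm_num) j).continuous.mul
      hv.continuous).integrable_of_hasCompactSupport hc.mul_left
  · exact (hu.continuous.mul (contDiff_pd (m := 0) hv (by norm_num) j).continuous)
      |>.integrable_of_hasCompactSupport (hasCompactSupport_pd hc j).mul_left
  · exact (hu.continuous.mul hv.continuous).integrable_of_hasCompactSupport hc.mul_left

lemma contDiff_grad {d : ℕ} {y : Fin d → (Fin d → ℝ) → ℝ} {m n : WithTop ℕ∞}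
    (hy : ∀ i, ContDiff ℝ n (y i)) (h : m + 1 ≤ n) : ContDiff ℝ m (grad y) :=
  contDiff_pi.2 fun i => contDiff_pi.2 fun j => contDiff_pd (hy i) h j

lemma piola_smooth {d : ℕ} {y : Fin d → (Fin d → ℝ) → ℝ} (hy : ∀ i, ContDiff ℝ 2 (y i))
    {η : (Fin d → ℝ) → ℝ} (hη : ContDiff ℝ 1 η) (hc : HasCompactSupport η) (i : Fin d) :
    ∫ x, ∑ j, cof (grad y x) i j * pd η j x = 0 := by
  have hcof : ∀ j, ContDiff ℝ 1 (fun x => cof (grad y x) i j) := fun j =>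
    (contDiff_cof i j).comp (contDiff_grad hy (by norm_num))
  rw [integral_finsetSum]
  · simp only [fun j => integral_mul_pd (hcof j) hη hc j]
    rw [Finset.sum_neg_distrib, ← integral_finsetSum]
    · simp [← Finset.sum_mul, sum_pd_cof hy]
    · intro j _
      exact ((contDiff_pd (m := 0) (hcof j) (by norm_num) j).continuous.mul
        hη.continuous).integrable_of_hasCompactSupport hc.mul_left
  · intro j _
    exact ((hcof j).continuous.mul (contDiff_pd (m := 0) hη (by norm_num) j).continuous)
      |>.integrable_of_hasCompactSupport (hasCompactSupport_pd hc j).mul_left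

lemma measurable_grad {d : ℕ} (y : Fin d → (Fin d → ℝ) → ℝ) : Measurable (grad y) :=
  measurable_pi_lambda _ fun i => measurable_pi_lambda _ fun j => measurable_pd (y i) j

lemma measurable_cof {d : ℕ} (i j : Fin d) :
    Measurable (fun A : Fin d → Fin d → ℝ => cof A i j) :=
  (contDiff_cof (n := 0) i j).continuous.measurable

lemma norm_grad_le {d : ℕ} {y : Fin d → (Fin d → ℝ) → ℝ} {L : NNReal}
    (hy : ∀ i, LipschitzWith L (y i)) (x : Fin d → ℝ) : ‖grad y x‖ ≤ L :=
  (pi_norm_le_iff_of_nonneg L.2).2 fun i => (pi_norm_le_iff_of_nonneg L.2).2 fun j =>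
    abs_pd_le (hy i) j x

lemma exists_abs_cof_le (d : ℕ) (L : ℝ) :
    ∃ C, 0 ≤ C ∧ ∀ A : Fin d → Fin d → ℝ, ‖A‖ ≤ L → ∀ i j, |cof A i j| ≤ C := by
  obtain ⟨C, hC, h⟩ := exists_abs_sub_cof_le d L
  refine ⟨max 0 (L + C * (L + 1)), le_max_left _ _, fun A hA i j => ?_⟩
  refine le_trans ?_ (le_max_right _ _)
  have h1 := h A hA i j
  have h2 := abs_entry_le_norm A i j
  have h3 : |cof A i j| ≤ |A i j| + |A i j - cof A i j| := by
    have := abs_sub (A i j) (A i j - cof A i j)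
    simpa using this
  have h4 : Metric.infDist A (SOm d) ≤ L + 1 := (infDist_SOm_le A).trans (by linarith)
  nlinarith [mul_le_mul_of_nonneg_left h4 hC]

/-- Piola's identity for Lipschitz maps and Lipschitz test functions. -/
lemma piola {d : ℕ} {y : Fin d → (Fin d → ℝ) → ℝ} {L K : NNReal} (hy : ∀ i, LipschitzWith L (y i))
    {η : (Fin d → ℝ) → ℝ} (hη : LipschitzWith K η) (hc : HasCompactSupport η) (i : Fin d) :
    ∫ x, ∑ j, cof (grad y x) i j * pd η j x = 0 := by
  obtain ⟨T, hT⟩ := exists_smooth_approx (d := d) L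
  obtain ⟨S, hS⟩ := exists_smooth_approx (d := d) K
  obtain ⟨hS1, hS2, hS3, hS4, hS5⟩ := hS η hη
  obtain ⟨M, hM0, hM⟩ := exists_abs_cof_le d L
  obtain ⟨r, hr⟩ := hc.isCompact.isBounded.subset_closedBall (0 : Fin d → ℝ)
  have hz : ∀ n x, S n η x ≠ 0 → x ∈ Metric.closedBall (0 : Fin d → ℝ) (r + 1) := by
    intro n x hx
    obtain ⟨w, hw, hxw⟩ := hS5 n x hx
    have := hr (subset_tsupport _ hw)
    rw [mem_closedBall_zero_iff] at this ⊢
    calc ‖x‖ = ‖w + (x - w)‖ := by simp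
      _ ≤ ‖w‖ + ‖x - w‖ := norm_add_le _ _
      _ ≤ r + 1 := by linarith
  have hcS : ∀ n, HasCompactSupport (S n η) := fun n =>
    HasCompactSupport.intro (isCompact_closedBall 0 (r + 1)) fun x hx => by
      by_contra h
      exact hx (hz n x h)
  have hpdz : ∀ n j x, x ∉ Metric.closedBall (0 : Fin d → ℝ) (r + 1) → pd (S n η) j x = 0 := by
    intro n j x hx
    have : x ∉ tsupport (S n η) := fun h =>
      hx ((closure_minimal (fun x hx => hz n x hx) Metric.isClosed_closedBall) h)
    have h2 := fderiv_of_notMem_tsupport (𝕜 := ℝ) this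
    simp [pd, h2]
  have h0 : ∀ n, ∫ x, ∑ j, cof (grad (fun i => T n (y i)) x) i j * pd (S n η) j x = 0 := fun n =>
    piola_smooth (fun i => ((hT _ (hy i)).1 n).of_le (by
        rw [show (2 : WithTop ℕ∞) = ((2 : ℕ∞) : WithTop ℕ∞) from rfl]
        exact_mod_cast (le_top : (2 : ℕ∞) ≤ ⊤)))
      ((hS1 n).of_le (by exact_mod_cast le_top)) (hcS n) i
  refine tendsto_nhds_unique
    (tendsto_integral_of_dominated_convergence
      (F := fun n x => ∑ j, cof (grad (fun i => T n (y i)) x) i j * pd (S n η) j x)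
      ((Metric.closedBall (0 : Fin d → ℝ) (r + 1)).indicator fun _ => ∑ j : Fin d, M * K)
      (fun n => ?_) ?_ (fun n => ?_) ?_) ?_
  · refine (Finset.measurable_sum _ fun j _ => ?_).aestronglyMeasurable
    exact ((measurable_cof i j).comp (measurable_grad _)).mul (measurable_pd _ j)
  · exact (integrable_indicator_iff Metric.isClosed_closedBall.measurableSet).2
      (integrableOn_const (measure_closedBall_lt_top).ne)
  · refine Filter.Eventually.of_forall fun x => ?_
    by_cases hx : x ∈ Metric.closedBall (0 : Fin d → ℝ) (r + 1)
    · rw [indicator_of_mem hx]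
      refine (norm_sum_le _ _).trans (Finset.sum_le_sum fun j _ => ?_)
      rw [norm_mul]
      exact mul_le_mul (hM _ (norm_grad_le (fun i => (hT _ (hy i)).2.1 n) x) i j)
        (abs_pd_le (hS2 n) j x) (norm_nonneg _) hM0
    · rw [indicator_of_notMem hx]
      simp [hpdz n _ x hx]
  · have hall : ∀ᵐ x, ∀ i, ∀ j, Filter.Tendsto (fun n => pd (T n (y i)) j x) Filter.atTop
        (nhds (pd (y i) j x)) := ae_all_iff.2 fun i => (hT _ (hy i)).2.2.2.1
    filter_upwards [hall, hS4] with x h1 h2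
    refine tendsto_finsetSum _ fun j _ => Filter.Tendsto.mul ?_ (h2 j)
    refine ((contDiff_cof (n := 0) i j).continuous.tendsto _).comp ?_
    rw [tendsto_pi_nhds]
    intro k
    rw [tendsto_pi_nhds]
    intro l
    exact h1 k l
  · simp [h0]

/-- Jensen's inequality for squares with respect to a probability density. -/
lemma sq_integral_le {α : Type*} [MeasurableSpace α] {μ : Measure α} {ψ h : α → ℝ}
    (h0 : ∀ z, 0 ≤ ψ z) (hi : Integrable ψ μ) (h1 : ∫ z, ψ z ∂μ = 1)
    (hh : Integrable (fun z => ψ z * h z) μ) (hh2 : Integrable (fun z => ψ z * h z ^ 2) μ) :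
    (∫ z, ψ z * h z ∂μ) ^ 2 ≤ ∫ z, ψ z * h z ^ 2 ∂μ := by
  set m := ∫ z, ψ z * h z ∂μ with hm
  have h3 : 0 ≤ ∫ z, ψ z * (h z - m) ^ 2 ∂μ :=
    integral_nonneg fun z => mul_nonneg (h0 z) (sq_nonneg _)
  have h4 : ∫ z, ψ z * (h z - m) ^ 2 ∂μ = ∫ z, ψ z * h z ^ 2 ∂μ - m ^ 2 := by
    have : ∀ z, ψ z * (h z - m) ^ 2 = ψ z * h z ^ 2 - 2 * m * (ψ z * h z) + m ^ 2 * ψ z :=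
      fun z => by ring
    simp only [this]
    have e1 : Integrable (fun z => 2 * m * (ψ z * h z)) μ := hh.const_mul _
    have e2 : Integrable (fun z => m ^ 2 * ψ z) μ := hi.const_mul _
    have e3 : Integrable (fun z => ψ z * h z ^ 2 - 2 * m * (ψ z * h z)) μ := hh2.sub e1
    rw [integral_add e3 e2, integral_sub hh2 e1, integral_const_mul, integral_const_mul, h1, ← hm]
    ring
  linarith

lemma integrableOn_of_bounded' {α : Type*} [MeasurableSpace α] {μ : Measure α} {s : Set α}
    {g : α → ℝ} {M : ℝ} (hs : μ s ≠ ⊤) (hm : MeasurableSet s) (hg : Measurable g)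
    (hb : ∀ x ∈ s, |g x| ≤ M) : IntegrableOn g s μ :=
  IntegrableOn.of_bound hs.lt_top hg.aestronglyMeasurable M
    ((ae_restrict_iff' hm).2 (Filter.Eventually.of_forall hb))

lemma sq_sum_mul_le {d : ℕ} (z a : Fin d → ℝ) :
    (∑ j, z j * a j) ^ 2 ≤ d * ‖z‖ ^ 2 * ∑ j, a j ^ 2 := by
  have h1 : (∑ j, z j * a j) ^ 2 ≤ (∑ j, z j ^ 2) * ∑ j, a j ^ 2 :=
    Finset.sum_mul_sq_le_sq_mul_sq _ _ _
  have h2 : ∑ j, z j ^ 2 ≤ d * ‖z‖ ^ 2 := by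
    calc ∑ j, z j ^ 2 ≤ ∑ _j : Fin d, ‖z‖ ^ 2 := Finset.sum_le_sum fun j _ => by
          rw [← sq_abs]
          exact pow_le_pow_left₀ (abs_nonneg _) (norm_le_pi_norm z j) 2
      _ = _ := by simp
  exact h1.trans (mul_le_mul_of_nonneg_right h2 (Finset.sum_nonneg fun _ _ => sq_nonneg _))

lemma fderiv_eq_sum_pd {d : ℕ} (u : (Fin d → ℝ) → ℝ) (x z : Fin d → ℝ) :
    fderiv ℝ u x z = ∑ j, z j * pd u j x := by
  conv_lhs => rw [pi_eq_sum_univ' z, map_sum]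
  refine Finset.sum_congr rfl fun j _ => ?_
  rw [map_smul, smul_eq_mul]
  rfl

lemma sq_sub_le_integral {d : ℕ} {u : (Fin d → ℝ) → ℝ} (hu : ContDiff ℝ 1 u) (x z : Fin d → ℝ) :
    (u (x + z) - u x) ^ 2 ≤
      ∫ s in Icc (0 : ℝ) 1, d * ‖z‖ ^ 2 * ∑ j, pd u j (x + s • z) ^ 2 := by
  have hc : ∀ j, Continuous fun s : ℝ => pd u j (x + s • z) := fun j =>
    (contDiff_pd (m := 0) hu (by norm_num) j).continuous.comp (by fun_prop)
  have hg : Continuous fun s : ℝ => ∑ j, z j * pd u j (x + s • z) :=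
    continuous_finsetSum _ fun j _ => (hc j).const_mul _
  have h1 : u (x + z) - u x = ∫ s in (0:ℝ)..1, ∑ j, z j * pd u j (x + s • z) := by
    rw [intervalIntegral.integral_eq_sub_of_hasDerivAt (f := fun s : ℝ => u (x + s • z))]
    · simp
    · intro s _
      have h2 : HasDerivAt (fun s : ℝ => x + s • z) z s := by
        simpa using ((hasDerivAt_id s).smul_const z).const_add x
      have := (hu.differentiable (by norm_num) (x + s • z)).hasFDerivAt.comp_hasDerivAt s h2
      rwa [fderiv_eq_sum_pd] at this
    · exact hg.intervalIntegrable _ _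
  rw [h1, intervalIntegral.integral_of_le zero_le_one, ← integral_Icc_eq_integral_Ioc]
  have h5 := sq_integral_le (μ := volume.restrict (Icc (0:ℝ) 1)) (ψ := fun _ => 1)
    (h := fun s => ∑ j, z j * pd u j (x + s • z)) (fun _ => zero_le_one)
    (integrable_const _) (by simp)
    (by simp only [one_mul]; exact hg.continuousOn.integrableOn_Icc (μ := volume))
    (by simp only [one_mul]; exact (hg.pow 2).continuousOn.integrableOn_Icc (μ := volume))
  simp only [one_mul] at h5
  refine h5.trans ?_
  refine integral_mono ((hg.pow 2).continuousOn.integrableOn_Icc) ?_ fun s => sq_sum_mul_le z _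
  refine Continuous.continuousOn ?_ |>.integrableOn_Icc
  exact (continuous_finsetSum _ fun j _ => (hc j).pow 2).const_mul _

lemma translate_smooth {d : ℕ} {u : (Fin d → ℝ) → ℝ} {L : NNReal} (hu : ContDiff ℝ 1 u)
    (hL : LipschitzWith L u) {K : Set (Fin d → ℝ)} (hK : Convex ℝ K) (mK : MeasurableSet K)
    (fK : volume K ≠ ⊤) (z : Fin d → ℝ) :
    ∫ x in K ∩ {x | x - z ∈ K}, (u x - u (x - z)) ^ 2 ≤
      d * ‖z‖ ^ 2 * ∫ x in K, ∑ j, pd u j x ^ 2 := by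
  set A := K ∩ {x | x - z ∈ K} with hA
  have mA : MeasurableSet A := mK.inter ((measurable_id.sub_const z) mK)
  have fA : volume A ≠ ⊤ := measure_ne_top_of_subset inter_subset_left fK
  have hp : ∀ j, Continuous (pd u j) := fun j => (contDiff_pd (m :=
      0) hu (by norm_num) j).continuous
  have hS : Continuous fun x => ∑ j, pd u j x ^ 2 :=
    continuous_finsetSum _ fun j _ => (hp j).pow 2
  have hS0 : ∀ x, 0 ≤ ∑ j, pd u j x ^ 2 := fun x => Finset.sum_nonneg fun _ _ => sq_nonneg _
  have hSb : ∀ x, |∑ j, pd u j x ^ 2| ≤ ∑ _j : Fin d, (L : ℝ) ^ 2 := fun x => by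
    rw [abs_of_nonneg (hS0 x)]
    refine Finset.sum_le_sum fun j _ => ?_
    rw [← sq_abs]
    exact pow_le_pow_left₀ (abs_nonneg _) (abs_pd_le hL j x) 2
  have hdu : Continuous fun x => (u x - u (x - z)) ^ 2 :=
    (hL.continuous.sub (hL.continuous.comp (by fun_prop))).pow 2
  have hdub : ∀ x, |(u x - u (x - z)) ^ 2| ≤ (L * ‖z‖) ^ 2 := fun x => by
    rw [abs_pow]
    refine pow_le_pow_left₀ (abs_nonneg _) ?_ 2
    have := hL.dist_le_mul x (x - z)
    rw [Real.dist_eq, dist_eq_norm] at this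
    simpa using this
  have hc0 : (0:ℝ) ≤ d * ‖z‖ ^ 2 := by positivity
  have i1 : IntegrableOn (fun x => (u x - u (x - z)) ^ 2) A :=
    integrableOn_of_bounded' fA mA hdu.measurable fun x _ => hdub x
  have i2 : IntegrableOn (fun x => ∑ j, pd u j x ^ 2) K :=
    integrableOn_of_bounded' fK mK hS.measurable fun x _ => hSb x
  have h3 : Integrable (K.indicator fun x => ∑ j, pd u j x ^ 2) :=
    (integrable_indicator_iff mK).2 i2
  set H : (Fin d → ℝ) → ENNReal := K.indicator fun x => ENNReal.ofReal (∑ j, pd u j x ^ 2) with hH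
  have mH : Measurable H := (hS.measurable.ennreal_ofReal).indicator mK
  have key : ∫⁻ x in A, ENNReal.ofReal ((u x - u (x - z)) ^ 2) ≤
      ENNReal.ofReal (d * ‖z‖ ^ 2) * ∫⁻ x in K, ENNReal.ofReal (∑ j, pd u j x ^ 2) := by
    calc ∫⁻ x in A, ENNReal.ofReal ((u x - u (x - z)) ^ 2)
        ≤ ∫⁻ x in A, ∫⁻ s in Icc (0 : ℝ) 1,
            ENNReal.ofReal (d * ‖z‖ ^ 2) * H (x - z + s • z) := by
          refine setLIntegral_mono' mA fun x hx => ?_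
          have h1 := sq_sub_le_integral hu (x - z) z
          rw [sub_add_cancel] at h1
          refine (ENNReal.ofReal_le_ofReal h1).trans ?_
          rw [ofReal_integral_eq_lintegral_ofReal]
          · refine setLIntegral_mono' measurableSet_Icc fun s hs => ?_
            have hxs : x - z + s • z ∈ K := by
              have := hK hx.2 hx.1 (sub_nonneg.2 hs.2) hs.1 (by ring)
              convert this using 1
              module
            rw [hH, indicator_of_mem hxs, ENNReal.ofReal_mul hc0]
          · refine Continuous.continuousOn ?_ |>.integrableOn_Icc
            exact continuous_const.mul (hS.comp (by fun_prop))
          · exact Filter.Eventually.of_forall fun s => mul_nonneg hc0 (hS0 _)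
      _ ≤ ∫⁻ x, ∫⁻ s in Icc (0 : ℝ) 1, ENNReal.ofReal (d * ‖z‖ ^ 2) * H (x - z + s • z) :=
          setLIntegral_le_lintegral _ _
      _ = ∫⁻ s in Icc (0 : ℝ) 1, ∫⁻ x, ENNReal.ofReal (d * ‖z‖ ^ 2) * H (x - z + s • z) := by
          refine lintegral_lintegral_swap (Measurable.aemeasurable ?_)
          refine measurable_const.mul (mH.comp ?_)
          refine Continuous.measurable ?_
          fun_prop
      _ = ∫⁻ s in Icc (0 : ℝ) 1, ENNReal.ofReal (d * ‖z‖ ^ 2) * ∫⁻ x, H x := by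
          refine lintegral_congr fun s => ?_
          rw [lintegral_const_mul' _ _ ENNReal.ofReal_ne_top]
          congr 1
          have := lintegral_add_right_eq_self (μ := (volume : Measure (Fin d → ℝ))) H (s • z - z)
          rw [← this]
          refine lintegral_congr fun x => ?_
          congr 1
          module
      _ = _ := by
          rw [setLIntegral_const, Real.volume_Icc, hH, lintegral_indicator mK]
          simp
  rw [← ENNReal.ofReal_le_ofReal_iff (mul_nonneg hc0 (integral_nonneg fun x => hS0 x)),
    ENNReal.ofReal_mul hc0,
    ofReal_integral_eq_lintegral_ofReal i1 (Filter.Eventually.of_forall fun x => sq_nonneg _),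
    ofReal_integral_eq_lintegral_ofReal i2 (Filter.Eventually.of_forall hS0)]
  exact key

/-- The basic translation estimate for a Lipschitz function on a convex set. -/
lemma translate_lipschitz {d : ℕ} {u : (Fin d → ℝ) → ℝ} {L : NNReal}
    (hL : LipschitzWith L u) {K : Set (Fin d → ℝ)} (hK : Convex ℝ K) (mK : MeasurableSet K)
    (fK : volume K ≠ ⊤) (z : Fin d → ℝ) :
    ∫ x in K ∩ {x | x - z ∈ K}, (u x - u (x - z)) ^ 2 ≤
      d * ‖z‖ ^ 2 * ∫ x in K, ∑ j, pd u j x ^ 2 := by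
  obtain ⟨T, hT⟩ := exists_smooth_approx (d := d) L
  obtain ⟨h1, h2, h3, h4, -⟩ := hT u hL
  have mA : MeasurableSet (K ∩ {x | x - z ∈ K}) := mK.inter ((measurable_id.sub_const z) mK)
  have fA : volume (K ∩ {x | x - z ∈ K}) ≠ ⊤ := measure_ne_top_of_subset inter_subset_left fK
  refine le_of_tendsto_of_tendsto' (b := Filter.atTop)
    (f := fun n => ∫ x in K ∩ {x | x - z ∈ K}, (T n u x - T n u (x - z)) ^ 2)
    (g := fun n => d * ‖z‖ ^ 2 * ∫ x in K, ∑ j, pd (T n u) j x ^ 2) ?_ ?_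
    (fun n => translate_smooth ((h1 n).of_le (by
      rw [show (1 : WithTop ℕ∞) = ((1 : ℕ∞) : WithTop ℕ∞) from rfl]
      exact_mod_cast (le_top : (1 : ℕ∞) ≤ ⊤))) (h2 n) hK mK fK z)
  · refine tendsto_integral_of_dominated_convergence (fun _ => (L * ‖z‖) ^ 2) (fun n => ?_)
      (integrableOn_const fA) (fun n => ?_) ?_
    · have := (h2 n).continuous
      refine Continuous.aestronglyMeasurable ?_
      exact (this.sub (this.comp (by fun_prop))).pow 2
    · refine Filter.Eventually.of_forall fun x => ?_
      rw [norm_pow]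
      refine pow_le_pow_left₀ (norm_nonneg _) ?_ 2
      have := (h2 n).dist_le_mul x (x - z)
      rw [Real.dist_eq, dist_eq_norm] at this
      simpa using this
    · exact Filter.Eventually.of_forall fun x => ((h3 x).sub (h3 (x - z))).pow 2
  · refine Filter.Tendsto.const_mul _ ?_
    refine tendsto_integral_of_dominated_convergence (fun _ => ∑ _j : Fin d, (L : ℝ) ^ 2)
      (fun n => ?_) (integrableOn_const (C := ∑ _j : Fin d, (L : ℝ) ^ 2) fK) (fun n => ?_) ?_
    · exact (Finset.measurable_sum _ fun j _ =>
        (measurable_pd _ j).pow_const 2).aestronglyMeasurable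
    · refine Filter.Eventually.of_forall fun x => ?_
      refine (norm_sum_le _ _).trans (Finset.sum_le_sum fun j _ => ?_)
      rw [norm_pow]
      exact pow_le_pow_left₀ (norm_nonneg _) (abs_pd_le (h2 n) j x) 2
    · refine ae_restrict_of_ae ?_
      filter_upwards [h4] with x hx
      exact tendsto_finsetSum _ fun j _ => (hx j).pow 2

/-- The distance of the gradient to the rotations. -/
noncomputable def eg {d : ℕ} (y : Fin d → (Fin d → ℝ) → ℝ) (x : Fin d → ℝ) : ℝ :=
  Metric.infDist (grad y x) (SOm d)

lemma eg_nonneg {d : ℕ} (y : Fin d → (Fin d → ℝ) → ℝ) (x : Fin d → ℝ) : 0 ≤ eg y x :=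
  Metric.infDist_nonneg

lemma measurable_eg {d : ℕ} (y : Fin d → (Fin d → ℝ) → ℝ) : Measurable (eg y) :=
  (Metric.continuous_infDist_pt _).measurable.comp (measurable_grad y)

lemma eg_le {d : ℕ} {y : Fin d → (Fin d → ℝ) → ℝ} {L : NNReal}
    (hy : ∀ i, LipschitzWith L (y i)) (x : Fin d → ℝ) : eg y x ≤ L + 1 :=
  (infDist_SOm_le _).trans (by linarith [norm_grad_le hy x])

lemma lipschitzWith_mul_of_bound {α : Type*} [PseudoMetricSpace α] {f g : α →
    ℝ} {K K' M M' : NNReal}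
    (hf : LipschitzWith K f) (hg : LipschitzWith K' g) (bf : ∀ x, |f x| ≤ M)
    (bg : ∀ x, |g x| ≤ M') : LipschitzWith (M * K' + M' * K) fun x => f x * g x := by
  refine LipschitzWith.of_dist_le_mul fun a b => ?_
  have h1 := hf.dist_le_mul a b
  have h2 := hg.dist_le_mul a b
  rw [Real.dist_eq] at *
  calc |f a * g a - f b * g b| = |f a * (g a - g b) + g b * (f a - f b)| := by ring_nf
    _ ≤ |f a| * |g a - g b| + |g b| * |f a - f b| := by
        rw [← abs_mul, ← abs_mul]; exact abs_add_le _ _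
    _ ≤ M * (K' * dist a b) + M' * (K * dist a b) := by
        gcongr
        · exact bf a
        · exact bg b
    _ = _ := by push_cast; ring

/-- The Lipschitz cutoff equal to one on the ball of radius `1 - κ`. -/
noncomputable def cutoff {d : ℕ} (κ : ℝ) (x : Fin d → ℝ) : ℝ :=
  max 0 (min 1 ((1 - κ / 2 - ‖x‖) * (2 / κ)))

lemma cutoff_nonneg {d : ℕ} (κ : ℝ) (x : Fin d → ℝ) : 0 ≤ cutoff κ x := le_max_left _ _

lemma cutoff_le_one {d : ℕ} (κ : ℝ) (x : Fin d → ℝ) : cutoff κ x ≤ 1 :=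
  max_le zero_le_one (min_le_left _ _)

lemma cutoff_eq_one {d : ℕ} {κ : ℝ} (hκ : 0 < κ) {x : Fin d → ℝ} (hx : ‖x‖ ≤ 1 - κ) :
    cutoff κ x = 1 := by
  have : 1 ≤ (1 - κ / 2 - ‖x‖) * (2 / κ) := by
    rw [mul_div_assoc', le_div_iff₀ hκ]
    linarith
  rw [cutoff, min_eq_left this, max_eq_right zero_le_one]

lemma cutoff_eq_zero {d : ℕ} {κ : ℝ} (hκ : 0 < κ) {x : Fin d → ℝ} (hx : 1 - κ / 2 ≤ ‖x‖) :
    cutoff κ x = 0 := by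
  have : (1 - κ / 2 - ‖x‖) * (2 / κ) ≤ 0 :=
    mul_nonpos_of_nonpos_of_nonneg (by linarith) (by positivity)
  rw [cutoff, max_eq_left]
  exact (min_le_right _ _).trans this

lemma lipschitzWith_cutoff {d : ℕ} {κ : ℝ} (hκ : 0 < κ) :
    LipschitzWith (2 / κ).toNNReal (cutoff κ : (Fin d → ℝ) → ℝ) := by
  refine (LipschitzWith.const_min ?_ 1).const_max 0
  refine LipschitzWith.of_dist_le_mul fun a b => ?_
  rw [Real.coe_toNNReal _ (by positivity), Real.dist_eq, dist_eq_norm, ← sub_mul, abs_mul,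
    abs_of_pos (show 0 < 2 / κ by positivity), mul_comm]
  refine mul_le_mul_of_nonneg_left ?_ (by positivity)
  rw [show 1 - κ / 2 - ‖a‖ - (1 - κ / 2 - ‖b‖) = -(‖a‖ - ‖b‖) by ring, abs_neg]
  exact abs_norm_sub_norm_le a b

lemma pd_eq_zero_of_support {d : ℕ} {η : (Fin d → ℝ) → ℝ} {S : Set (Fin d → ℝ)} (hS : IsClosed S)
    (h : ∀ x ∉ S, η x = 0) (j : Fin d) {x : Fin d → ℝ} (hx : x ∉ S) : pd η j x = 0 := by
  have : x ∉ tsupport η := fun hx' =>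
    hx (closure_minimal (Function.support_subset_iff'.2 h) hS hx')
  simp [pd, fderiv_of_notMem_tsupport (𝕜 := ℝ) this]

lemma setIntegral_shift_le {d : ℕ} {h : (Fin d → ℝ) → ℝ} (h0 : ∀ x, 0 ≤ h x)
    {S Q : Set (Fin d → ℝ)} (hi : IntegrableOn h Q) (z : Fin d → ℝ)
    (hSQ : ∀ x ∈ S, x - z ∈ Q) : ∫ x in S, h (x - z) ≤ ∫ x in Q, h x := by
  have mp := measurePreserving_sub_right (volume : Measure (Fin d → ℝ)) z
  have me : MeasurableEmbedding (fun x : Fin d → ℝ => x - z) :=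
    (Homeomorph.subRight z).measurableEmbedding
  rw [← mp.setIntegral_preimage_emb me h Q]
  refine setIntegral_mono_set ?_ (Filter.Eventually.of_forall fun x => h0 _) ?_
  · exact (mp.integrableOn_comp_preimage me).2 hi
  · exact Filter.Eventually.of_forall fun x hx => hSQ x hx

lemma grad_shift {d : ℕ} (y : Fin d → (Fin d → ℝ) → ℝ) (z x : Fin d → ℝ) :
    grad (fun i x => y i (x - z)) x = grad y (x - z) := by
  funext i j
  simp [grad, pd, fderiv_comp_sub]

lemma lipschitz_shift {d : ℕ} {u : (Fin d → ℝ) → ℝ} {L : NNReal} (hu : LipschitzWith L u)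
    (z : Fin d → ℝ) : LipschitzWith L fun x => u (x - z) := by
  have := hu.comp ((IsometryEquiv.subRight z).isometry.lipschitz)
  simpa [Function.comp_def] using this

lemma pd_affine {d : ℕ} {u : (Fin d → ℝ) → ℝ} {x : Fin d → ℝ} (hu : DifferentiableAt ℝ u x)
    (a : Fin d → ℝ) (j : Fin d) : pd (fun x => u x - ∑ k, a k * x k) j x = pd u j x - a j := by
  have h : HasFDerivAt (fun x : Fin d → ℝ => ∑ k, a k * x k)
      (∑ k, a k • ContinuousLinearMap.proj (R := ℝ) (φ := fun _ : Fin d => ℝ) k) x :=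
    HasFDerivAt.fun_sum fun k _ => (hasFDerivAt_apply (𝕜 := ℝ) k x).const_mul (a k)
  unfold pd
  rw [(hu.hasFDerivAt.fun_sub h).fderiv]
  simp [Pi.single_apply]

lemma lipschitz_affine {d : ℕ} (a : Fin d → ℝ) :
    ∃ K : NNReal, LipschitzWith K fun x : Fin d → ℝ => ∑ k, a k * x k := by
  refine ⟨‖∑ k, a k • ContinuousLinearMap.proj (R := ℝ) (φ := fun _ : Fin d => ℝ) k‖₊, ?_⟩
  have h := (∑ k, a k • ContinuousLinearMap.proj (R := ℝ) (φ := fun _ : Fin d => ℝ) k).lipschitz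
  refine LipschitzWith.of_dist_le_mul fun x x' => ?_
  simpa using h.dist_le_mul x x'

lemma sq_entry_le {d : ℕ} (A : Fin d → Fin d → ℝ) (i j : Fin d) : A i j ^ 2 ≤ ‖A‖ ^ 2 := by
  rw [← sq_abs]
  exact pow_le_pow_left₀ (abs_nonneg _) (abs_entry_le_norm A i j) 2

/-- Translation estimate for the deviation of a Lipschitz map from an affine map. -/
lemma translate_affine {d : ℕ} {y : Fin d → (Fin d → ℝ) → ℝ} {L : NNReal}
    (hy : ∀ i, LipschitzWith L (y i)) (c : Fin d → Fin d → ℝ) (i : Fin d)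
    {K : Set (Fin d → ℝ)} (hK : Convex ℝ K) (mK : MeasurableSet K)
    (fK : volume K ≠ ⊤) (z : Fin d → ℝ) :
    ∫ x in K ∩ {x | x - z ∈ K}, (y i x - y i (x - z) - ∑ k, c i k * z k) ^ 2 ≤
      d * ‖z‖ ^ 2 * (d * ∫ x in K, ‖grad y x - c‖ ^ 2) := by
  obtain ⟨K', hK'⟩ := lipschitz_affine (c i)
  have h := translate_lipschitz ((hy i).sub hK') hK mK fK z
  have e1 : ∀ x : Fin d → ℝ, (y i x - ∑ k, c i k * x k)
      - (y i (x - z) - ∑ k, c i k * (x - z) k) = y i x - y i (x - z) - ∑ k, c i k * z k := by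
    intro x
    simp only [Pi.sub_apply, mul_sub, Finset.sum_sub_distrib]
    ring
  simp only [e1] at h
  refine h.trans (mul_le_mul_of_nonneg_left ?_ (by positivity))
  rw [← integral_const_mul]
  refine integral_mono_ae ?_ ?_ ?_
  · refine integrableOn_of_bounded' (M := ∑ _j : Fin d, ((L : ℝ) + K') ^ 2) fK mK ?_ fun x _ => ?_
    · exact Finset.measurable_sum _ fun j _ => (measurable_pd _ j).pow_const 2
    · rw [abs_of_nonneg (Finset.sum_nonneg fun _ _ => sq_nonneg _)]
      refine Finset.sum_le_sum fun j _ => ?_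
      rw [← sq_abs]
      exact pow_le_pow_left₀ (abs_nonneg _) (by simpa using abs_pd_le ((hy i).sub hK') j x) 2
  · refine Integrable.const_mul ?_ _
    refine integrableOn_of_bounded' (M := (L + ‖c‖) ^ 2) fK mK ?_ fun x _ => ?_
    · exact ((measurable_grad y).sub_const c).norm.pow_const 2
    · rw [abs_of_nonneg (sq_nonneg _)]
      exact pow_le_pow_left₀ (norm_nonneg _) ((norm_sub_le _ _).trans
        (by linarith [norm_grad_le hy x])) 2
  · refine ae_restrict_of_ae ?_
    filter_upwards [(hy i).ae_differentiableAt] with x hx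
    calc ∑ j, pd (fun x => y i x - ∑ k, c i k * x k) j x ^ 2
        ≤ ∑ _j : Fin d, ‖grad y x - c‖ ^ 2 := Finset.sum_le_sum fun j _ => by
          rw [pd_affine hx]
          exact sq_entry_le (grad y x - c) i j
      _ = _ := by simp

lemma young_pointwise (w G p v f : ℝ) :
    f ^ 2 * w ^ 2 / 2 - 5 * (p ^ 2 * v ^ 2) - 2 * (f ^ 2 * G ^ 2)
      ≤ (w - G) * (f ^ 2 * w + 2 * f * p * v) := by
  nlinarith [sq_nonneg (f * w / 2 + 2 * p * v), sq_nonneg (f * w / 2 - f * G),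
    sq_nonneg (f * G - p * v)]

lemma pd_cutoff_sq_mul {d : ℕ} {φ v : (Fin d → ℝ) → ℝ} {x : Fin d → ℝ}
    (hφ : DifferentiableAt ℝ φ x) (hv : DifferentiableAt ℝ v x) (j : Fin d) :
    pd (fun x => φ x * φ x * v x) j x = φ x ^ 2 * pd v j x + 2 * φ x * pd φ j x * v x := by
  unfold pd
  rw [((hφ.hasFDerivAt.fun_mul hφ.hasFDerivAt).fun_mul hv.hasFDerivAt).fderiv]
  simp
  ring

lemma pd_diff_shift {d : ℕ} {u : (Fin d → ℝ) → ℝ} {x z : Fin d → ℝ} (h1 : DifferentiableAt ℝ u x)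
    (h2 : DifferentiableAt ℝ u (x - z)) (a : ℝ) (j : Fin d) :
    DifferentiableAt ℝ (fun x => u x - u (x - z) - a) x ∧
    pd (fun x => u x - u (x - z) - a) j x = pd u j x - pd u j (x - z) := by
  have h3 : HasFDerivAt (fun a => u (a - z)) (fderiv ℝ u (x - z)) x :=
    h2.hasFDerivAt.comp x ((hasFDerivAt_id x).sub_const z)
  have h4 := (h1.hasFDerivAt.fun_sub h3).sub_const a
  refine ⟨h4.differentiableAt, ?_⟩
  unfold pd
  rw [h4.fderiv]
  simp

set_option maxHeartbeats 1000000 in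
/-- Interior translation estimate for the gradient of a Lipschitz map. -/
lemma exists_translate_grad (d : ℕ) (L : NNReal) {κ : ℝ} (hκ : 0 < κ) :
    ∃ C, 0 ≤ C ∧ ∀ y : Fin d → (Fin d → ℝ) → ℝ, (∀ i, LipschitzWith L (y i)) →
      ∀ (c : Fin d → Fin d → ℝ) (z : Fin d → ℝ), ‖z‖ ≤ κ / 4 → ∀ i j,
      ∫ x in Metric.ball 0 (1 - κ), (grad y x i j - grad y (x - z) i j) ^ 2 ≤
        C * (‖z‖ ^ 2 * (∫ x in Metric.ball 0 1, ‖grad y x - c‖ ^ 2)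
          + ∫ x in Metric.ball 0 1, eg y x ^ 2) := by
  obtain ⟨Ce, hCe0, hCe⟩ := exists_abs_sub_cof_le d L
  set A : ℝ := 5 * (d * (2 / κ) ^ 2) with hA
  set B : ℝ := 4 * d * Ce ^ 2 with hB
  have hA0 : 0 ≤ A := by positivity
  have hB0 : 0 ≤ B := by positivity
  refine ⟨2 * (A * (d * d) + 2 * B), by positivity, fun y hy c z hz i j₀ => ?_⟩
  set S : Set (Fin d → ℝ) := Metric.closedBall 0 (1 - κ / 2) with hS
  set Q : Set (Fin d → ℝ) := Metric.ball 0 1 with hQ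
  have mS : MeasurableSet S := Metric.isClosed_closedBall.measurableSet
  have fS : volume S ≠ ⊤ := measure_closedBall_lt_top.ne
  have fQ : volume Q ≠ ⊤ := measure_ball_lt_top.ne
  have hSQ : ∀ x ∈ S, x ∈ Q := fun x hx => by
    rw [hS, mem_closedBall_zero_iff] at hx
    rw [hQ, mem_ball_zero_iff]
    linarith
  have hSQz : ∀ x ∈ S, x - z ∈ Q := fun x hx => by
    rw [hS, mem_closedBall_zero_iff] at hx
    rw [hQ, mem_ball_zero_iff]
    linarith [norm_sub_le x z]
  set a : ℝ := ∑ k, c i k * z k with ha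
  set v : (Fin d → ℝ) → ℝ := fun x => y i x - y i (x - z) - a with hv
  set φ : (Fin d → ℝ) → ℝ := cutoff κ with hφ
  set w : Fin d → (Fin d → ℝ) → ℝ := fun j x => grad y x i j - grad y (x - z) i j with hw
  set G : Fin d → (Fin d → ℝ) → ℝ := fun j x =>
    (grad y x i j - cof (grad y x) i j) - (grad y (x - z) i j - cof (grad y (x - z)) i j) with hG
  have lipv : LipschitzWith (L + L) v := by
    have := ((hy i).sub (lipschitz_shift (hy i) z)).sub (LipschitzWith.const a)
    simpa [hv] using this
  have bv : ∀ x, |v x| ≤ L * ‖z‖ + |a| := fun x => by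
    have := (hy i).dist_le_mul x (x - z)
    rw [Real.dist_eq, dist_eq_norm, sub_sub_cancel] at this
    calc |v x| ≤ |y i x - y i (x - z)| + |a| := abs_sub _ _
      _ ≤ _ := by linarith
  have bφ : ∀ x, |φ x| ≤ 1 := fun x => by
    rw [abs_of_nonneg (cutoff_nonneg κ x)]
    exact cutoff_le_one κ x
  have lipφ := lipschitzWith_cutoff (d := d) hκ
  have bw : ∀ j x, |w j x| ≤ L + L := fun j x => (abs_sub _ _).trans
    (add_le_add (abs_pd_le (hy i) j x) (abs_pd_le (hy i) j _))
  have bp : ∀ j x, pd φ j x ^ 2 ≤ (2 / κ) ^ 2 := fun j x => by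
    rw [← sq_abs]
    have := abs_pd_le lipφ j x
    rw [Real.coe_toNNReal _ (by positivity)] at this
    exact pow_le_pow_left₀ (abs_nonneg _) this 2
  have bG : ∀ j x, G j x ^ 2 ≤ 2 * Ce ^ 2 * (eg y x ^ 2 + eg y (x - z) ^ 2) := fun j x => by
    have h1 := hCe _ (norm_grad_le hy x) i j
    have h2 := hCe _ (norm_grad_le hy (x - z)) i j
    have h3 := sq_le_sq' (abs_le.1 h1).1 (abs_le.1 h1).2
    have h4 := sq_le_sq' (abs_le.1 h2).1 (abs_le.1 h2).2
    simp only [hG]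
    unfold eg
    nlinarith [sq_nonneg ((grad y x i j - cof (grad y x) i j) +
      (grad y (x - z) i j - cof (grad y (x - z)) i j))]
  set η : (Fin d → ℝ) → ℝ := fun x => φ x * φ x * v x with hη
  have η0 : ∀ x ∉ S, η x = 0 := fun x hx => by
    have : φ x = 0 := cutoff_eq_zero hκ (by
      rw [hS, mem_closedBall_zero_iff, not_le] at hx
      exact hx.le)
    simp [hη, this]
  have cη : HasCompactSupport η := HasCompactSupport.intro (isCompact_closedBall _ _) η0
  obtain ⟨K, lipη⟩ : ∃ K, LipschitzWith K η :=
    ⟨_, lipschitzWith_mul_of_bound (M := 1) (M' := (L * ‖z‖ + |a|).toNNReal)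
      (lipschitzWith_mul_of_bound (M := 1) (M' := 1) lipφ lipφ (by simpa using bφ)
        (by simpa using bφ)) lipv (fun x => by
          rw [abs_mul]
          simpa using mul_le_one₀ (bφ x) (abs_nonneg _) (bφ x)) fun x => by
      rw [Real.coe_toNNReal _ (by positivity)]
      exact bv x⟩
  have P1 := piola hy lipη cη i
  have P2 := piola (fun i => lipschitz_shift (hy i) z) lipη cη i
  simp only [grad_shift] at P2
  obtain ⟨M, hM0, hM⟩ := exists_abs_cof_le d L
  have toS : ∀ (g : Fin d → (Fin d → ℝ) → ℝ), (∫ x, ∑ j, g j x * pd η j x)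
      = ∫ x in S, ∑ j, g j x * pd η j x := fun g => by
    rw [setIntegral_eq_integral_of_forall_compl_eq_zero]
    intro x hx
    exact Finset.sum_eq_zero fun j _ => by
      rw [pd_eq_zero_of_support Metric.isClosed_closedBall η0 j hx, mul_zero]
  have mcof : ∀ j, Measurable fun x => cof (grad y x) i j := fun j =>
    (measurable_cof i j).comp (measurable_grad y)
  have mcofz : ∀ j, Measurable fun x => cof (grad y (x - z)) i j := fun j =>
    (mcof j).comp (measurable_id.sub_const z)
  have mpη : ∀ j, Measurable (pd η j) := fun j => measurable_pd _ j
  have intS : ∀ (g : Fin d → (Fin d → ℝ) → ℝ), (∀ j, Measurable (g j)) → (∀ j x, |g j x| ≤ M) →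
      IntegrableOn (fun x => ∑ j, g j x * pd η j x) S := fun g mg bg => by
    refine integrable_finsetSum _ fun j _ => ?_
    refine integrableOn_of_bounded' (M := M * K) fS mS ((mg j).mul (mpη j)) fun x _ => ?_
    rw [abs_mul]
    exact mul_le_mul (bg j x) (abs_pd_le lipη j x) (abs_nonneg _) hM0
  rw [toS (fun j x => cof (grad y x) i j)] at P1
  rw [toS (fun j x => cof (grad y (x - z)) i j)] at P2
  have P3 : ∫ x in S, ∑ j, (w j x - G j x) * pd η j x = 0 := by
    have : ∀ x, ∑ j, (w j x - G j x) * pd η j x = (∑ j, cof (grad y x) i j * pd η j x)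
        - ∑ j, cof (grad y (x - z)) i j * pd η j x := fun x => by
      rw [← Finset.sum_sub_distrib]
      refine Finset.sum_congr rfl fun j _ => ?_
      simp only [hw, hG]
      ring
    simp only [this]
    rw [integral_sub (intS _ mcof fun j x => hM _ (norm_grad_le hy x) i j)
      (intS _ mcofz fun j x => hM _ (norm_grad_le hy (x - z)) i j), P1, P2, sub_zero]
  have mw : ∀ j, Measurable (w j) := fun j =>
    (measurable_pd _ j).sub ((measurable_pd _ j).comp (measurable_id.sub_const z))
  have mez : Measurable fun x => eg y (x - z) := (measurable_eg y).comp (measurable_id.sub_const z)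
  have beg : ∀ x, |eg y x ^ 2| ≤ ((L : ℝ) + 1) ^ 2 := fun x => by
    rw [abs_of_nonneg (sq_nonneg _)]
    exact pow_le_pow_left₀ (eg_nonneg y x) (eg_le hy x) 2
  have mφ : Measurable φ := lipφ.continuous.measurable
  have iL : IntegrableOn (fun x => φ x ^ 2 * w j₀ x ^ 2 / 2) S := by
    refine integrableOn_of_bounded' (M := (L + L) ^ 2) fS mS
      (((mφ.pow_const 2).mul ((mw j₀).pow_const 2)).div_const 2) fun x _ => ?_
    rw [abs_of_nonneg (by positivity)]
    have h1 : w j₀ x ^ 2 ≤ (L + L) ^ 2 := by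
      rw [← sq_abs]; exact pow_le_pow_left₀ (abs_nonneg _) (bw j₀ x) 2
    have h2 : φ x ^ 2 ≤ 1 := by
      rw [← sq_abs]; exact pow_le_one₀ (abs_nonneg _) (bφ x)
    nlinarith [mul_le_mul h2 h1 (sq_nonneg _) zero_le_one, sq_nonneg (φ x * w j₀ x)]
  have iv : IntegrableOn (fun x => v x ^ 2) S := by
    refine integrableOn_of_bounded' (M := (L * ‖z‖ + |a|) ^ 2) fS mS
      (lipv.continuous.measurable.pow_const 2) fun x _ => ?_
    rw [abs_pow]
    exact pow_le_pow_left₀ (abs_nonneg _) (bv x) 2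
  have ie : IntegrableOn (fun x => eg y x ^ 2) S :=
    integrableOn_of_bounded' fS mS ((measurable_eg y).pow_const 2) fun x _ => beg x
  have ieQ : IntegrableOn (fun x => eg y x ^ 2) Q :=
    integrableOn_of_bounded' fQ measurableSet_ball ((measurable_eg y).pow_const 2) fun x _ => beg x
  have iez : IntegrableOn (fun x => eg y (x - z) ^ 2) S :=
    integrableOn_of_bounded' fS mS (mez.pow_const 2) fun x _ => beg (x - z)
  have iW : IntegrableOn (fun x => ∑ j, (w j x - G j x) * pd η j x) S := by
    have : ∀ x, ∑ j, (w j x - G j x) * pd η j x = (∑ j, cof (grad y x) i j * pd η j x)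
        - ∑ j, cof (grad y (x - z)) i j * pd η j x := fun x => by
      rw [← Finset.sum_sub_distrib]
      refine Finset.sum_congr rfl fun j _ => ?_
      simp only [hw, hG]
      ring
    simp only [this]
    exact (intS _ mcof fun j x => hM _ (norm_grad_le hy x) i j).sub
      (intS _ mcofz fun j x => hM _ (norm_grad_le hy (x - z)) i j)
  have pt : ∀ᵐ x, φ x ^ 2 * w j₀ x ^ 2 / 2 ≤ A * v x ^ 2 + B * (eg y x ^ 2 + eg y (x - z) ^ 2)
      + ∑ j, (w j x - G j x) * pd η j x := by
    have hz : ∀ᵐ x, DifferentiableAt ℝ (y i) (x - z) :=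
      (measurePreserving_sub_right volume z).quasiMeasurePreserving.ae
        ((hy i).ae_differentiableAt (μ := volume))
    filter_upwards [(hy i).ae_differentiableAt, hz, lipφ.ae_differentiableAt] with x h1 h2 h3
    have h4 : ∀ j, pd η j x = φ x ^ 2 * w j x + 2 * φ x * pd φ j x * v x := fun j => by
      obtain ⟨h5, h6⟩ := pd_diff_shift h1 h2 a j
      rw [hη, pd_cutoff_sq_mul h3 h5 j, h6]
      rfl
    have h5 : φ x ^ 2 ≤ 1 := by
      rw [← sq_abs]; exact pow_le_one₀ (abs_nonneg _) (bφ x)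
    have h6 : ∀ j, φ x ^ 2 * w j x ^ 2 / 2 - 5 * ((2 / κ) ^ 2 * v x ^ 2)
        - 2 * (2 * Ce ^ 2 * (eg y x ^ 2 + eg y (x - z) ^ 2)) ≤ (w j x - G j x) * pd η j x := by
      intro j
      rw [h4 j]
      refine le_trans ?_ (young_pointwise (w j x) (G j x) (pd φ j x) (v x) (φ x))
      have h7 := mul_le_mul_of_nonneg_right (bp j x) (sq_nonneg (v x))
      have h8 : φ x ^ 2 * G j x ^ 2 ≤ G j x ^ 2 := mul_le_of_le_one_left (sq_nonneg _) h5
      linarith [bG j x]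
    have h7 := Finset.sum_le_sum fun j (_ : j ∈ Finset.univ) => h6 j
    rw [Finset.sum_sub_distrib, Finset.sum_sub_distrib] at h7
    have h8 : φ x ^ 2 * w j₀ x ^ 2 / 2 ≤ ∑ j, φ x ^ 2 * w j x ^ 2 / 2 :=
      Finset.single_le_sum (f := fun j => φ x ^ 2 * w j x ^ 2 / 2) (fun j _ => by positivity)
        (Finset.mem_univ j₀)
    simp only [Finset.sum_const, Finset.card_univ, Fintype.card_fin, nsmul_eq_mul] at h7
    have e1 : (d : ℝ) * (5 * ((2 / κ) ^ 2 * v x ^ 2)) = A * v x ^ 2 := by rw [hA]; ring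
    have e2 : (d : ℝ) * (2 * (2 * Ce ^ 2 * (eg y x ^ 2 + eg y (x - z) ^ 2)))
      = B * (eg y x ^ 2 + eg y (x - z) ^ 2) := by rw [hB]; ring
    rw [e1, e2] at h7
    linarith
  have iE : IntegrableOn (fun x => eg y x ^ 2 + eg y (x - z) ^ 2) S := ie.add iez
  have iR1 : IntegrableOn (fun x => A * v x ^ 2 + B * (eg y x ^ 2 + eg y (x - z) ^ 2)) S :=
    (iv.const_mul A).add (iE.const_mul B)
  have iR2 : IntegrableOn (fun x => A * v x ^ 2 + B * (eg y x ^ 2 + eg y (x - z) ^ 2)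
      + ∑ j, (w j x - G j x) * pd η j x) S := iR1.add iW
  have main : ∫ x in S, φ x ^ 2 * w j₀ x ^ 2 / 2 ≤ A * (∫ x in S, v x ^ 2)
      + B * ((∫ x in S, eg y x ^ 2) + ∫ x in S, eg y (x - z) ^ 2) := by
    calc ∫ x in S, φ x ^ 2 * w j₀ x ^ 2 / 2
        ≤ ∫ x in S, (A * v x ^ 2 + B * (eg y x ^ 2 + eg y (x - z) ^ 2)
            + ∑ j, (w j x - G j x) * pd η j x) :=
          integral_mono_ae iL iR2 (ae_restrict_of_ae pt)
      _ = _ := by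
          rw [integral_add iR1 iW, P3, add_zero,
            integral_add (iv.const_mul A) (iE.const_mul B), integral_const_mul,
            integral_const_mul, integral_add ie iez]
  have e1 : ∫ x in S, eg y x ^ 2 ≤ ∫ x in Q, eg y x ^ 2 :=
    setIntegral_mono_set ieQ (Filter.Eventually.of_forall fun x => sq_nonneg _)
      (Filter.Eventually.of_forall hSQ)
  have e2 : ∫ x in S, eg y (x - z) ^ 2 ≤ ∫ x in Q, eg y x ^ 2 :=
    setIntegral_shift_le (h := fun x => eg y x ^ 2) (fun x => sq_nonneg _) ieQ z hSQz
  have e3 : ∫ x in S, v x ^ 2 ≤ d * ‖z‖ ^ 2 * (d * ∫ x in Q, ‖grad y x - c‖ ^ 2) := by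
    refine le_trans ?_ (translate_affine hy c i (convex_ball 0 1) measurableSet_ball fQ z)
    refine setIntegral_mono_set ?_ (Filter.Eventually.of_forall fun x => sq_nonneg _)
      (Filter.Eventually.of_forall fun x hx => ⟨hSQ x hx, hSQz x hx⟩)
    refine integrableOn_of_bounded' (M := (L * ‖z‖ + |a|) ^ 2)
      (measure_ne_top_of_subset inter_subset_left fQ)
      (measurableSet_ball.inter ((measurable_id.sub_const z) measurableSet_ball))
      (lipv.continuous.measurable.pow_const 2) fun x _ => ?_
    rw [abs_pow]
    exact pow_le_pow_left₀ (abs_nonneg _) (bv x) 2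
  have e4 : (∫ x in Metric.ball 0 (1 - κ), w j₀ x ^ 2) / 2 ≤ ∫ x in S,
      φ x ^ 2 * w j₀ x ^ 2 / 2 := by
    rw [← integral_div]
    have hsub : Metric.ball (0 : Fin d → ℝ) (1 - κ) ⊆ S := fun x hx => by
      rw [mem_ball_zero_iff] at hx
      rw [hS, mem_closedBall_zero_iff]
      linarith
    calc ∫ x in Metric.ball 0 (1 - κ), w j₀ x ^ 2 / 2
        = ∫ x in Metric.ball 0 (1 - κ), φ x ^ 2 * w j₀ x ^ 2 / 2 := by
          refine setIntegral_congr_fun measurableSet_ball fun x hx => ?_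
          rw [mem_ball_zero_iff] at hx
          simp only [hφ, cutoff_eq_one hκ hx.le, one_pow, one_mul]
      _ ≤ _ := setIntegral_mono_set iL (Filter.Eventually.of_forall fun x => by
            change 0 ≤ φ x ^ 2 * w j₀ x ^ 2 / 2
            positivity)
          (Filter.Eventually.of_forall hsub)
  have e0 : 0 ≤ ∫ x in Q, ‖grad y x - c‖ ^ 2 := integral_nonneg fun x => sq_nonneg _
  have e00 : 0 ≤ ∫ x in Q, eg y x ^ 2 := integral_nonneg fun x => sq_nonneg _
  change ∫ x in Metric.ball 0 (1 - κ), w j₀ x ^ 2 ≤ _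
  have f1 := mul_le_mul_of_nonneg_left e3 hA0
  have f2 := mul_le_mul_of_nonneg_left (add_le_add e1 e2) hB0
  have f3 : 0 ≤ A * (d * d) * ∫ x in Q, eg y x ^ 2 := by positivity
  have f4 : 0 ≤ 2 * B * (‖z‖ ^ 2 * ∫ x in Q, ‖grad y x - c‖ ^ 2) := by positivity
  nlinarith

lemma moll_sub_sq_le {d : ℕ} {ψ g : (Fin d → ℝ) → ℝ} {M b : ℝ} {B : Set (Fin d → ℝ)}
    (hψ : Continuous ψ) (hc : HasCompactSupport ψ) (h0 : ∀ z, 0 ≤ ψ z) (h1 : ∫ z, ψ z = 1)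
    (hg : Measurable g) (hM : ∀ x, |g x| ≤ M) (fB : volume B ≠ ⊤)
    (hb : ∀ z, ψ z ≠ 0 → ∫ x in B, (g x - g (x - z)) ^ 2 ≤ b) :
    ∫ x in B, (g x - moll ψ g x) ^ 2 ≤ b := by
  have hM0 : 0 ≤ M := (abs_nonneg _).trans (hM 0)
  have iψ : Integrable ψ := hψ.integrable_of_hasCompactSupport hc
  have bd : ∀ x z, |g x - g (x - z)| ≤ 2 * M := fun x z =>
    (abs_sub _ _).trans (by linarith [hM x, hM (x - z)])
  have bd2 : ∀ x z, |(g x - g (x - z)) ^ 2| ≤ (2 * M) ^ 2 := fun x z => by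
    rw [abs_pow]; exact pow_le_pow_left₀ (abs_nonneg _) (bd x z) 2
  have mgz : ∀ x, Measurable fun z => g (x - z) := fun x =>
    hg.comp (measurable_const.sub measurable_id)
  have ij : ∀ x, Integrable fun z => ψ z * (g x - g (x - z)) := fun x =>
    iψ.mul_bdd (c := 2 * M) (measurable_const.sub (mgz x)).aestronglyMeasurable
      (Filter.Eventually.of_forall fun z => bd x z)
  have ij2 : ∀ x, Integrable fun z => ψ z * (g x - g (x - z)) ^ 2 := fun x =>
    iψ.mul_bdd (c := (2 * M) ^ 2)
      ((measurable_const.sub (mgz x)).pow_const 2).aestronglyMeasurable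
      (Filter.Eventually.of_forall fun z => bd2 x z)
  have ig : ∀ x, Integrable fun z => ψ z * g (x - z) := fun x =>
    iψ.mul_bdd (c := M) (mgz x).aestronglyMeasurable (Filter.Eventually.of_forall fun z => hM _)
  have pt : ∀ x, (g x - moll ψ g x) ^ 2 ≤ ∫ z, ψ z * (g x - g (x - z)) ^ 2 := fun x => by
    have : g x - moll ψ g x = ∫ z, ψ z * (g x - g (x - z)) := by
      simp only [mul_sub]
      rw [integral_sub (iψ.mul_const _) (ig x), integral_mul_const, h1, one_mul, moll]
    rw [this]
    exact sq_integral_le h0 iψ h1 (ij x) (ij2 x)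
  have iprod : Integrable (fun p : (Fin d → ℝ) × (Fin d → ℝ) => ψ p.2 * (g p.1 - g (p.1 - p.2)) ^ 2)
      ((volume.restrict B).prod volume) := by
    have i0 : Integrable (fun p : (Fin d → ℝ) × (Fin d → ℝ) => (1 : ℝ) * ψ p.2)
        ((volume.restrict B).prod volume) :=
      Integrable.mul_prod (integrableOn_const (C := (1:ℝ)) fB) iψ
    simp only [one_mul] at i0
    refine i0.mul_bdd (c := (2 * M) ^ 2) ?_ (Filter.Eventually.of_forall fun p => bd2 p.1 p.2)
    exact (((hg.comp measurable_fst).sub (hg.comp (measurable_fst.sub measurable_snd))).pow_const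
      2).aestronglyMeasurable
  calc ∫ x in B, (g x - moll ψ g x) ^ 2
      ≤ ∫ x in B, ∫ z, ψ z * (g x - g (x - z)) ^ 2 :=
        integral_mono_of_nonneg (Filter.Eventually.of_forall fun x => sq_nonneg _)
          iprod.integral_prod_left (Filter.Eventually.of_forall pt)
    _ = ∫ z, ∫ x in B, ψ z * (g x - g (x - z)) ^ 2 := integral_integral_swap iprod
    _ ≤ ∫ z, ψ z * b := by
        refine integral_mono iprod.integral_prod_right (iψ.mul_const b) fun z => ?_
        change ∫ x in B, ψ z * (g x - g (x - z)) ^ 2 ≤ ψ z * b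
        rw [integral_const_mul]
        by_cases hz : ψ z = 0
        · simp [hz]
        · exact mul_le_mul_of_nonneg_left (hb z hz) (h0 z)
    _ = b := by rw [integral_mul_const, h1, one_mul]

/-- A bundled mollifier supported in the ball of radius `t`. -/
structure IsMollifier {d : ℕ} (t : ℝ) (ψ : (Fin d → ℝ) → ℝ) : Prop where
  smooth : ContDiff ℝ (⊤ : ℕ∞) ψ
  compact : HasCompactSupport ψ
  nonneg : ∀ z, 0 ≤ ψ z
  integral_eq : ∫ z, ψ z = 1
  support : ∀ z, ψ z ≠ 0 → ‖z‖ < t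

/-- Interior mollification estimate for the gradient of a Lipschitz map. -/
lemma exists_moll_grad (d : ℕ) (L : NNReal) {κ : ℝ} (hκ : 0 < κ) :
    ∃ C, 0 ≤ C ∧ ∀ y : Fin d → (Fin d → ℝ) → ℝ, (∀ i, LipschitzWith L (y i)) →
      ∀ (c : Fin d → Fin d → ℝ) (t : ℝ) (ψ : (Fin d → ℝ) → ℝ), t ≤ κ / 4 → IsMollifier t ψ →
      ∀ i j,
      ∫ x in Metric.ball 0 (1 - κ), (grad y x i j - moll ψ (pd (y i) j) x) ^ 2 ≤
        C * (t ^ 2 * (∫ x in Metric.ball 0 1, ‖grad y x - c‖ ^ 2)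
          + ∫ x in Metric.ball 0 1, eg y x ^ 2) := by
  obtain ⟨C, hC0, hC⟩ := exists_translate_grad d L hκ
  refine ⟨C, hC0, fun y hy c t ψ ht hψ i j => ?_⟩
  refine moll_sub_sq_le hψ.smooth.continuous hψ.compact hψ.nonneg hψ.integral_eq (measurable_pd _ j)
    (abs_pd_le (hy i) j) measure_ball_lt_top.ne fun z hz => ?_
  have hzt := hψ.support z hz
  refine (hC y hy c z (by linarith) i j).trans (mul_le_mul_of_nonneg_left ?_ hC0)
  gcongr

lemma le_top_smooth (n : ℕ) : (n : WithTop ℕ∞) ≤ ((⊤ : ℕ∞) : WithTop ℕ∞) := by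
  rw [show (n : WithTop ℕ∞) = ((n : ℕ∞) : WithTop ℕ∞) from rfl]
  exact_mod_cast (le_top : (n : ℕ∞) ≤ ⊤)

lemma exists_bound_of_compact {d : ℕ} {u : (Fin d → ℝ) → ℝ} (hu : Continuous u)
    (hc : HasCompactSupport u) : ∃ M, 0 ≤ M ∧ ∀ x, |u x| ≤ M := by
  obtain ⟨M, hM⟩ := hc.exists_bound_of_continuous hu
  exact ⟨M, (norm_nonneg _).trans (hM 0), hM⟩

lemma pd_comp_const_sub {d : ℕ} {u : (Fin d → ℝ) → ℝ} (x w : Fin d → ℝ)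
    (hu : Differentiable ℝ u) (j : Fin d) : pd (fun w => u (x - w)) j w = - pd u j (x - w) := by
  have h : HasFDerivAt (fun w => u (x - w))
      ((fderiv ℝ u (x - w)).comp (-ContinuousLinearMap.id ℝ (Fin d → ℝ))) w :=
    (hu (x - w)).hasFDerivAt.comp w ((hasFDerivAt_id w).const_sub x)
  unfold pd
  rw [h.fderiv]
  simp

lemma moll_eq_integral_sub {d : ℕ} (ψ g : (Fin d → ℝ) → ℝ) (x : Fin d → ℝ) :
    moll ψ g x = ∫ w, ψ (x - w) * g w := by
  rw [moll, ← integral_sub_left_eq_self _ volume x]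
  simp

/-- Interchanging the derivatives of the mollified gradient. -/
lemma pd_moll_grad {d : ℕ} {u ψ : (Fin d → ℝ) → ℝ} {L : NNReal} (hu : LipschitzWith L u)
    (hψ : ContDiff ℝ (⊤ : ℕ∞) ψ) (hc : HasCompactSupport ψ) (j k : Fin d) :
    pd (moll ψ (pd u k)) j = moll (pd ψ k) (pd u j) := by
  have h2 : ContDiff ℝ 2 (moll ψ u) :=
    (contDiff_moll hu.continuous.locallyIntegrable hψ hc).of_le (le_top_smooth 2)
  rw [← pd_moll_left (measurable_pd u j) (abs_pd_le hu j) (hψ.of_le (le_top_smooth 1)) hc k,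
    ← pd_moll hu hψ.continuous hc k, ← pd_moll hu hψ.continuous hc j]
  funext x
  exact pd_comm h2 j k x

/-- The mollified gradient is nearly harmonic. -/
lemma exists_laplacian_moll_le (d : ℕ) (L : NNReal) {t : ℝ} {ψ : (Fin d → ℝ) → ℝ}
    (hψ : IsMollifier t ψ) :
    ∃ C, 0 ≤ C ∧ ∀ y : Fin d → (Fin d → ℝ) → ℝ, (∀ i, LipschitzWith L (y i)) →
      ∀ x, ‖x‖ + t < 1 → ∀ i k,
      |∑ j, pd (pd (moll ψ (pd (y i) k)) j) j x| ≤ C * ∫ x in Metric.ball 0 1, eg y x := by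
  obtain ⟨Ce, hCe0, hCe⟩ := exists_abs_sub_cof_le d L
  obtain ⟨Mc, hMc0, hMc⟩ := exists_abs_cof_le d L
  have s1 : ∀ k, ContDiff ℝ 1 (pd ψ k) := fun k =>
    contDiff_pd (n := 2) (hψ.smooth.of_le (le_top_smooth 2)) (by norm_num) k
  have c1 : ∀ k, HasCompactSupport (pd ψ k) := fun k => hasCompactSupport_pd hψ.compact k
  have s2 : ∀ k j, Continuous (pd (pd ψ k) j) := fun k j =>
    (contDiff_pd (m := 0) (s1 k) (by norm_num) j).continuous
  have c2 : ∀ k j, HasCompactSupport (pd (pd ψ k) j) := fun k j => hasCompactSupport_pd (c1 k) j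
  choose M hM0 hM using fun k j => exists_bound_of_compact (s2 k j) (c2 k j)
  have z1 : ∀ k j w, w ∉ Metric.closedBall (0 : Fin d → ℝ) t → pd (pd ψ k) j w = 0 := by
    intro k j w hw
    refine pd_eq_zero_of_support Metric.isClosed_closedBall (fun x hx => ?_) j hw
    refine pd_eq_zero_of_support Metric.isClosed_closedBall (fun x hx => ?_) k hx
    by_contra h
    exact hx (by simpa using (hψ.support x h).le)
  refine ⟨∑ k, ∑ j, M k j * Ce, Finset.sum_nonneg fun k _ => Finset.sum_nonneg fun j _ =>
    mul_nonneg (hM0 k j) hCe0, fun y hy x hx i k => ?_⟩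
  have h1 : ∀ j, pd (pd (moll ψ (pd (y i) k)) j) j x = ∫ w, pd (pd ψ k) j (x - w) * pd (y i) j w :=
    fun j => by
      rw [pd_moll_grad (hy i) hψ.smooth hψ.compact,
        pd_moll_left (measurable_pd _ j) (abs_pd_le (hy i) j) (s1 k) (c1 k), moll_eq_integral_sub]
  have lipη : ∃ K, LipschitzWith K fun w => pd ψ k (x - w) := by
    obtain ⟨K, hK⟩ := (s1 k).lipschitzWith_of_hasCompactSupport (c1 k) (by norm_num)
    have h1 : LipschitzWith 1 fun w : Fin d → ℝ => x - w :=
      LipschitzWith.of_dist_le_mul fun a b => by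
        rw [dist_sub_left, NNReal.coe_one, one_mul]
    exact ⟨K * 1, hK.comp h1⟩
  obtain ⟨K, hK⟩ := lipη
  have cη : HasCompactSupport fun w => pd ψ k (x - w) :=
    (c1 k).comp_homeomorph (Homeomorph.subLeft x)
  have P := piola hy hK cη i
  have hη : ∀ j w, pd (fun w => pd ψ k (x - w)) j w = - pd (pd ψ k) j (x - w) := fun j w =>
    pd_comp_const_sub x w ((s1 k).differentiable (by norm_num)) j
  simp only [hη] at P
  have iD : ∀ j, Integrable fun w => pd (pd ψ k) j (x - w) := fun j =>
    (((s2 k j).comp (by fun_prop : Continuous fun w => x - w)).integrable_of_hasCompactSupport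
      ((c2 k j).comp_homeomorph (Homeomorph.subLeft x)))
  have i1 : ∀ j, Integrable fun w => pd (pd ψ k) j (x - w) * pd (y i) j w := fun j =>
    (iD j).mul_bdd (c := L) (measurable_pd _ j).aestronglyMeasurable
      (Filter.Eventually.of_forall fun w => abs_pd_le (hy i) j w)
  have i2 : ∀ j, Integrable fun w => cof (grad y w) i j * - pd (pd ψ k) j (x - w) := fun j =>
    (iD j).neg.bdd_mul (c := Mc) ((measurable_cof i j).comp
      (measurable_grad y)).aestronglyMeasurable
      (Filter.Eventually.of_forall fun w => hMc _ (norm_grad_le hy w) i j)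
  have h2 : ∑ j, pd (pd (moll ψ (pd (y i) k)) j) j x
      = ∫ w, ∑ j, pd (pd ψ k) j (x - w) * (pd (y i) j w - cof (grad y w) i j) := by
    simp only [h1]
    rw [← integral_finsetSum _ fun j _ => i1 j, ← add_zero (∫ w, ∑ j, _), ← P,
      ← integral_add (integrable_finsetSum _ fun j _ => i1 j)
        (integrable_finsetSum _ fun j _ => i2 j)]
    refine integral_congr_ae (Filter.Eventually.of_forall fun w => ?_)
    change (∑ j, _) + (∑ j, _) = ∑ j, _
    rw [← Finset.sum_add_distrib]
    exact Finset.sum_congr rfl fun j _ => by ring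
  have ie : IntegrableOn (eg y) (Metric.ball 0 1) :=
    integrableOn_of_bounded' (M := L + 1) measure_ball_lt_top.ne measurableSet_ball
      (measurable_eg y) fun w _ => by
        rw [abs_of_nonneg (eg_nonneg y w)]; exact eg_le hy w
  rw [h2]
  have hQ : ∀ w ∉ Metric.ball (0 : Fin d → ℝ) 1, ∀ j, pd (pd ψ k) j (x - w) = 0 := by
    intro w hw j
    refine z1 k j _ fun h => hw ?_
    rw [mem_closedBall_zero_iff] at h
    rw [mem_ball_zero_iff]
    calc ‖w‖ = ‖x - (x - w)‖ := by simp
      _ ≤ ‖x‖ + ‖x - w‖ := norm_sub_le _ _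
      _ < 1 := by linarith
  rw [← setIntegral_eq_integral_of_forall_compl_eq_zero (s := Metric.ball 0 1) fun w hw =>
    Finset.sum_eq_zero fun j _ => by rw [hQ w hw j, zero_mul]]
  rw [← integral_const_mul]
  rw [← Real.norm_eq_abs]
  refine norm_integral_le_of_norm_le (g := fun w => (∑ k, ∑ j, M k j * Ce) * eg y w)
    (ie.const_mul _) (Filter.Eventually.of_forall fun w => ?_)
  refine (norm_sum_le _ _).trans ?_
  calc ∑ j, ‖pd (pd ψ k) j (x - w) * (pd (y i) j w - cof (grad y w) i j)‖
      ≤ ∑ j, M k j * (Ce * eg y w) := Finset.sum_le_sum fun j _ => by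
        rw [norm_mul]
        exact mul_le_mul (hM k j _) (hCe _ (norm_grad_le hy w) i j) (norm_nonneg _) (hM0 k j)
    _ = (∑ j, M k j * Ce) * eg y w := by
        rw [Finset.sum_mul]; exact Finset.sum_congr rfl fun j _ => by ring
    _ ≤ _ := by
        refine mul_le_mul_of_nonneg_right ?_ (eg_nonneg y w)
        exact Finset.single_le_sum (f := fun k => ∑ j, M k j * Ce)
          (fun k _ => Finset.sum_nonneg fun j _ => mul_nonneg (hM0 k j) hCe0) (Finset.mem_univ k)

/-- Poincaré inequality on a convex subset of the unit cube, with a value of the function as the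
center. -/
lemma exists_poincare {d : ℕ} {u : (Fin d → ℝ) → ℝ} {L : NNReal} (hL : LipschitzWith L u)
    {K : Set (Fin d → ℝ)} (hK : Convex ℝ K) (mK : MeasurableSet K) (hK1 : K ⊆ Metric.ball 0 1)
    (hK0 : volume K ≠ 0) :
    ∃ a ∈ K, volume.real K * ∫ x in K, (u x - u a) ^ 2 ≤
      volume.real (Metric.ball (0 : Fin d → ℝ) 2) * (d * 2 ^ 2 * ∫ x in K, ∑ j, pd u j x ^ 2) := by
  have fK : volume K ≠ ⊤ := ((measure_mono hK1).trans_lt measure_ball_lt_top).ne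
  have mu : Measurable u := hL.continuous.measurable
  have bd : ∀ x ∈ K, ∀ a ∈ K, |(u x - u a) ^ 2| ≤ (L * 2) ^ 2 := fun x hx a ha => by
    rw [abs_pow]
    refine pow_le_pow_left₀ (abs_nonneg _) ?_ 2
    have h := hL.dist_le_mul x a
    rw [Real.dist_eq] at h
    have h1 := mem_ball_zero_iff.1 (hK1 hx)
    have h2 := mem_ball_zero_iff.1 (hK1 ha)
    have : dist x a ≤ 2 := by rw [dist_eq_norm]; linarith [norm_sub_le x a]
    exact h.trans (mul_le_mul_of_nonneg_left this L.2)
  have i1 : IntegrableOn (fun p : (Fin d → ℝ) × (Fin d → ℝ) => (u p.2 - u p.1) ^ 2) (K ×ˢ K) := by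
    refine integrableOn_of_bounded' (M := (L * 2) ^ 2) ?_ (mK.prod mK) ?_ fun p hp =>
      bd _ hp.2 _ hp.1
    · rw [Measure.volume_eq_prod, Measure.prod_prod]; exact ENNReal.mul_ne_top fK fK
    · exact ((mu.comp measurable_snd).sub (mu.comp measurable_fst)).pow_const 2
  rw [IntegrableOn, Measure.volume_eq_prod, ← Measure.prod_restrict] at i1
  obtain ⟨a, ha, h⟩ := exists_le_setAverage hK0 fK
    (f := fun a => ∫ x in K, (u x - u a) ^ 2) i1.integral_prod_left
  refine ⟨a, ha, ?_⟩
  have vpos : 0 < volume.real K := ENNReal.toReal_pos hK0 fK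
  rw [setAverage_eq, smul_eq_mul, inv_mul_eq_div, le_div_iff₀ vpos, mul_comm] at h
  refine h.trans ?_
  have mS : MeasurableSet {p : (Fin d → ℝ) × (Fin d → ℝ) | p.1 ∈ K ∧ p.1 - p.2 ∈ K} :=
    (measurable_fst mK).inter ((measurable_fst.sub measurable_snd) mK)
  set S := {p : (Fin d → ℝ) × (Fin d → ℝ) | p.1 ∈ K ∧ p.1 - p.2 ∈ K} with hS
  have hz : ∀ p ∈ S, p.2 ∈ Metric.ball (0 : Fin d → ℝ) 2 := fun p hp => by
    have h1 := mem_ball_zero_iff.1 (hK1 hp.1)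
    have h2 := mem_ball_zero_iff.1 (hK1 hp.2)
    rw [mem_ball_zero_iff]
    calc ‖p.2‖ = ‖p.1 - (p.1 - p.2)‖ := by simp
      _ ≤ ‖p.1‖ + ‖p.1 - p.2‖ := norm_sub_le _ _
      _ < 2 := by linarith
  have fS : (volume : Measure ((Fin d → ℝ) × (Fin d → ℝ))) S ≠ ⊤ := by
    refine ((measure_mono (t := K ×ˢ Metric.ball 0 2) fun p hp => ⟨hp.1, hz p hp⟩).trans_lt ?_).ne
    rw [Measure.volume_eq_prod, Measure.prod_prod]
    exact ENNReal.mul_lt_top fK.lt_top measure_ball_lt_top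
  have i2 : Integrable (S.indicator fun p : (Fin d → ℝ) × (Fin d → ℝ) =>
      (u p.1 - u (p.1 - p.2)) ^ 2) := by
    rw [integrable_indicator_iff mS]
    refine integrableOn_of_bounded' (M := (L * 2) ^ 2) fS mS ?_ fun p hp => bd _ hp.1 _ hp.2
    exact ((mu.comp measurable_fst).sub (mu.comp (measurable_fst.sub measurable_snd))).pow_const 2
  rw [Measure.volume_eq_prod] at i2
  have e1 : ∀ x, K.indicator (fun x => ∫ a in K, (u x - u a) ^ 2) x
      = ∫ z, S.indicator (fun p => (u p.1 - u (p.1 - p.2)) ^ 2) (x, z) := fun x => by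
    by_cases hx : x ∈ K
    · rw [indicator_of_mem hx, ← integral_indicator mK, ← integral_sub_left_eq_self _ volume x]
      refine integral_congr_ae (Filter.Eventually.of_forall fun z => ?_)
      by_cases hxz : x - z ∈ K <;> simp [indicator, hS, hx, hxz]
    · rw [indicator_of_notMem hx]
      simp [indicator, hS, hx]
  have e2 : ∀ z, ∫ x, S.indicator (fun p => (u p.1 - u (p.1 - p.2)) ^ 2) (x, z)
      = ∫ x in K ∩ {x | x - z ∈ K}, (u x - u (x - z)) ^ 2 := fun z => by
    have m2 : MeasurableSet (K ∩ {x | x - z ∈ K}) := mK.inter ((measurable_id.sub_const z) mK)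
    rw [← integral_indicator m2]
    rfl
  calc ∫ a in K, ∫ x in K, (u x - u a) ^ 2 = ∫ x in K, ∫ a in K, (u x - u a) ^ 2 :=
        integral_integral_swap i1
    _ = ∫ x, ∫ z, S.indicator (fun p => (u p.1 - u (p.1 - p.2)) ^ 2) (x, z) := by
        rw [← integral_indicator mK]; exact integral_congr_ae (Filter.Eventually.of_forall e1)
    _ = ∫ z, ∫ x, S.indicator (fun p => (u p.1 - u (p.1 - p.2)) ^ 2) (x, z) :=
        integral_integral_swap i2
    _ = ∫ z in Metric.ball (0 : Fin d → ℝ) 2,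
          ∫ x, S.indicator (fun p => (u p.1 - u (p.1 - p.2)) ^ 2) (x, z) := by
        refine (setIntegral_eq_integral_of_forall_compl_eq_zero fun z hzz => ?_).symm
        have : ∀ x, S.indicator (fun p => (u p.1 - u (p.1 - p.2)) ^ 2) (x, z) = 0 := fun x =>
          indicator_of_notMem (fun hp => hzz (hz _ hp)) _
        simp [this]
    _ ≤ ∫ z in Metric.ball (0 : Fin d → ℝ) 2, d * 2 ^ 2 * ∫ x in K, ∑ j, pd u j x ^ 2 := by
        refine setIntegral_mono_on i2.integral_prod_right.integrableOn
          (integrableOn_const measure_ball_lt_top.ne) measurableSet_ball fun z hzz => ?_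
        rw [e2]
        refine (translate_lipschitz hL hK mK fK z).trans ?_
        have : 0 ≤ ∫ x in K, ∑ j, pd u j x ^ 2 :=
          integral_nonneg fun x => Finset.sum_nonneg fun j _ => sq_nonneg _
        have hn := (mem_ball_zero_iff.1 hzz).le
        gcongr
    _ = _ := by rw [setIntegral_const, smul_eq_mul]

/-- The energy identity behind the Caccioppoli estimate. -/
lemma integral_mul_sum_sq_pd {d : ℕ} {φ q : (Fin d → ℝ) → ℝ} (hφ : ContDiff ℝ 2 φ)
    (hc : HasCompactSupport φ) (hq : ContDiff ℝ 2 q) (j : Fin d) :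
    ∫ x, φ x * pd q j x ^ 2
      = (∫ x, pd (pd φ j) j x * q x ^ 2) / 2 - ∫ x, φ x * (q x * pd (pd q j) j x) := by
  have q1 : ContDiff ℝ 1 q := hq.of_le (by norm_num)
  have pq1 : ContDiff ℝ 1 (pd q j) := contDiff_pd hq (by norm_num) j
  have pφ1 : ContDiff ℝ 1 (pd φ j) := contDiff_pd hφ (by norm_num) j
  have cq : Continuous (pd (pd q j) j) := (contDiff_pd (m := 0) pq1 (by norm_num) j).continuous
  have d1 : ∀ x, pd (fun x => q x * q x) j x = 2 * (q x * pd q j x) := fun x => by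
    have h := (q1.differentiable (by norm_num) x).hasFDerivAt
    have := h.fun_mul h
    rw [pd, this.fderiv]
    simp [pd]; ring
  have d2 : ∀ x, pd (fun x => q x * pd q j x) j x = q x * pd (pd q j) j x + pd q j x ^ 2 :=
    fun x => by
      have h := (q1.differentiable (by norm_num) x).hasFDerivAt
      have h' := (pq1.differentiable (by norm_num) x).hasFDerivAt
      have := h.fun_mul h'
      rw [pd, this.fderiv]
      simp [pd]; ring
  have I1 := integral_mul_pd (q1.mul q1) pφ1 (hasCompactSupport_pd hc j) j
  have I2 := integral_mul_pd (q1.mul pq1) (hφ.of_le (by norm_num)) hc j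
  simp only [d1, d2] at I1 I2
  have cφ := hφ.continuous
  have i1 : Integrable fun x => φ x * (q x * pd (pd q j) j x) :=
    (cφ.mul (q1.continuous.mul cq)).integrable_of_hasCompactSupport hc.mul_right
  have i2 : Integrable fun x => φ x * pd q j x ^ 2 :=
    (cφ.mul (pq1.continuous.pow 2)).integrable_of_hasCompactSupport hc.mul_right
  have e1 : ∫ x, (q x * pd (pd q j) j x + pd q j x ^ 2) * φ x
      = (∫ x, φ x * (q x * pd (pd q j) j x)) + ∫ x, φ x * pd q j x ^ 2 := by
    rw [← integral_add i1 i2]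
    exact integral_congr_ae (Filter.Eventually.of_forall fun x => by ring)
  have e2 : ∫ x, 2 * (q x * pd q j x) * pd φ j x = 2 * ∫ x, (q x * pd q j x) * pd φ j x := by
    rw [← integral_const_mul]
    exact integral_congr_ae (Filter.Eventually.of_forall fun x => by ring)
  have e3 : ∫ x, pd (pd φ j) j x * q x ^ 2 = ∫ x, q x * q x * pd (pd φ j) j x :=
    integral_congr_ae (Filter.Eventually.of_forall fun x => by ring)
  rw [e1] at I2
  rw [e2] at I1
  linarith

lemma abs_moll_le {d : ℕ} {ψ g : (Fin d → ℝ) → ℝ} {M : ℝ} (hψ : Integrable ψ)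
    (hM : ∀ x, |g x| ≤ M) (x : Fin d → ℝ) : |moll ψ g x| ≤ M * ∫ z, |ψ z| := by
  rw [← integral_const_mul, ← Real.norm_eq_abs]
  refine norm_integral_le_of_norm_le (g := fun z => M * |ψ z|) (hψ.abs.const_mul M)
    (Filter.Eventually.of_forall fun z => ?_)
  rw [norm_mul, mul_comm]
  exact mul_le_mul_of_nonneg_right (hM _) (norm_nonneg _)

lemma norm_fderiv_le_sum_pd {d : ℕ} (u : (Fin d → ℝ) → ℝ) (x : Fin d → ℝ) :
    ‖fderiv ℝ u x‖ ≤ ∑ j, |pd u j x| := by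
  refine ContinuousLinearMap.opNorm_le_bound _ (Finset.sum_nonneg fun j _ => abs_nonneg _)
    fun z => ?_
  rw [fderiv_eq_sum_pd, Finset.sum_mul]
  refine (norm_sum_le _ _).trans (Finset.sum_le_sum fun j _ => ?_)
  rw [norm_mul, mul_comm]
  exact mul_le_mul_of_nonneg_left (norm_le_pi_norm z j) (abs_nonneg _)

lemma lipschitz_moll {d : ℕ} {g ψ : (Fin d → ℝ) → ℝ} {M : ℝ} (hg : Measurable g)
    (hM : ∀ x, |g x| ≤ M) (hψ : ContDiff ℝ 1 ψ) (hc : HasCompactSupport ψ) :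
    ∃ K, LipschitzWith K (moll ψ g) := by
  have i1 : ∀ j, Integrable (pd ψ j) := fun j =>
    (contDiff_pd (m := 0) hψ (by norm_num) j).continuous.integrable_of_hasCompactSupport
      (hasCompactSupport_pd hc j)
  refine ⟨(∑ j, M * ∫ z, |pd ψ j z|).toNNReal, lipschitzWith_of_nnnorm_fderiv_le (𝕜 := ℝ)
    ((contDiff_moll (n := 1) (locallyIntegrable_of_bound hg hM) hψ hc).differentiable
      (by norm_num)) fun x => ?_⟩
  rw [← NNReal.coe_le_coe, coe_nnnorm]
  refine (norm_fderiv_le_sum_pd _ x).trans (le_trans ?_ (Real.le_coe_toNNReal _))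
  refine Finset.sum_le_sum fun j _ => ?_
  rw [pd_moll_left hg hM hψ hc]
  exact abs_moll_le (i1 j) hM x

lemma IsMollifier.abs_moll_le {d : ℕ} {t M : ℝ} {ψ g : (Fin d → ℝ) → ℝ} (hψ : IsMollifier t ψ)
    (hM : ∀ x, |g x| ≤ M) (x : Fin d → ℝ) : |moll ψ g x| ≤ M := by
  have h := _root_.abs_moll_le (hψ.smooth.continuous.integrable_of_hasCompactSupport hψ.compact) hM
      x
  simp only [abs_of_nonneg (hψ.nonneg _), hψ.integral_eq, mul_one] at h
  exact h

lemma IsMollifier.contDiff_moll {d : ℕ} {t : ℝ} {ψ u : (Fin d → ℝ) → ℝ} {L : NNReal}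
    (hψ : IsMollifier t ψ) (hu : LipschitzWith L u) (k : Fin d) (n : ℕ) :
    ContDiff ℝ n (moll ψ (pd u k)) :=
  (_root_.contDiff_moll (locallyIntegrable_pd hu k) hψ.smooth hψ.compact).of_le (le_top_smooth n)

/-- Energy estimate for the mollified gradient. -/
lemma exists_energy (d : ℕ) (L : NNReal) {κ : ℝ} (hκ : 0 < κ) (hκ2 : κ < 1 / 2) :
    ∃ C, 0 ≤ C ∧ ∀ (t : ℝ) (ψ : (Fin d → ℝ) → ℝ), t ≤ κ / 4 → IsMollifier t ψ →
      ∃ A, 0 ≤ A ∧ ∀ y : Fin d → (Fin d → ℝ) → ℝ, (∀ i, LipschitzWith L (y i)) →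
      ∑ i, ∑ k, ∫ x in Metric.ball 0 (1 - 2 * κ), ∑ j, pd (moll ψ (pd (y i) k)) j x ^ 2 ≤
        C * (∑ i, ∑ k, ∫ x in Metric.ball 0 (1 - κ), |grad y x i k - moll ψ (pd (y i) k) x|)
          + A * ∫ x in Metric.ball 0 1, eg y x := by
  obtain ⟨C2, hC20, hC2⟩ := exists_abs_sum_sq_sub_le d L
  let φ : ContDiffBump (0 : Fin d → ℝ) := ⟨1 - 2 * κ, 1 - 3 / 2 * κ, by linarith, by linarith⟩
  have hφ : ContDiff ℝ (⊤ : ℕ∞) φ := φ.contDiff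
  have φ2 : ContDiff ℝ 2 φ := hφ.of_le (le_top_smooth 2)
  have φ1 : ∀ j, ContDiff ℝ 1 (pd φ j) := fun j => contDiff_pd φ2 (by norm_num) j
  have cφ : HasCompactSupport φ := φ.hasCompactSupport
  have s2 : ∀ j, Continuous (pd (pd φ j) j) := fun j =>
    (contDiff_pd (m := 0) (φ1 j) (by norm_num) j).continuous
  have c2 : ∀ j, HasCompactSupport (pd (pd φ j) j) := fun j =>
    hasCompactSupport_pd (hasCompactSupport_pd cφ j) j
  choose M hM0 hM using fun j => exists_bound_of_compact (s2 j) (c2 j)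
  have zφ : ∀ x, x ∉ Metric.ball (0 : Fin d → ℝ) (1 - κ) → φ x = 0 := fun x hx => by
    by_contra h
    have : x ∈ Function.support φ := h
    rw [φ.support_eq] at this
    exact hx (Metric.ball_subset_ball (by change 1 - 3 / 2 * κ ≤ 1 - κ; linarith) this)
  have zpφ : ∀ j x, x ∉ Metric.ball (0 : Fin d → ℝ) (1 - κ) → pd (pd φ j) j x = 0 :=
      fun j x hx => by
    have hx' : x ∉ Metric.closedBall (0 : Fin d → ℝ) (1 - 3 / 2 * κ) := fun h =>
      hx (Metric.closedBall_subset_ball (by linarith) h)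
    refine pd_eq_zero_of_support Metric.isClosed_closedBall (fun x hx => ?_) j hx'
    refine pd_eq_zero_of_support Metric.isClosed_closedBall (fun x hx => ?_) j hx
    by_contra h
    have : x ∈ Function.support φ := h
    rw [φ.support_eq] at this
    exact hx (Metric.ball_subset_closedBall this)
  set B := Metric.ball (0 : Fin d → ℝ) (1 - κ) with hB
  set Q := Metric.ball (0 : Fin d → ℝ) 1 with hQ
  set K := Metric.ball (0 : Fin d → ℝ) (1 - 2 * κ) with hK
  have hBQ : B ⊆ Q := Metric.ball_subset_ball (by linarith)
  have fB : volume B ≠ ⊤ := measure_ball_lt_top.ne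
  refine ⟨(∑ j, M j) * L, mul_nonneg (Finset.sum_nonneg fun j _ => hM0 j) L.2,
    fun t ψ ht hψ => ?_⟩
  obtain ⟨CΔ, hCΔ0, hCΔ⟩ := exists_laplacian_moll_le d L hψ
  refine ⟨(∑ j, M j) * C2 / 2 + ∑ i : Fin d, ∑ k : Fin d, volume.real B * (L * CΔ), ?_,
    fun y hy => ?_⟩
  · have := Finset.sum_nonneg fun j (_ : j ∈ Finset.univ) => hM0 j
    have h2 : 0 ≤ volume.real B := measureReal_nonneg
    positivity
  set q : Fin d → Fin d → (Fin d → ℝ) → ℝ := fun i k => moll ψ (pd (y i) k) with hq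
  have q2 : ∀ i k, ContDiff ℝ 2 (q i k) := fun i k => hψ.contDiff_moll (hy i) k 2
  have qL : ∀ i k x, |q i k x| ≤ L := fun i k x => hψ.abs_moll_le (abs_pd_le (hy i) k) x
  have pq1 : ∀ i k j, ContDiff ℝ 1 (pd (q i k) j) := fun i k j =>
    contDiff_pd (q2 i k) (by norm_num) j
  have cpp : ∀ i k j, Continuous (pd (pd (q i k) j) j) := fun i k j =>
    (contDiff_pd (m := 0) (pq1 i k j) (by norm_num) j).continuous
  have ie : IntegrableOn (eg y) Q :=
    integrableOn_of_bounded' (M := L + 1) measure_ball_lt_top.ne measurableSet_ball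
      (measurable_eg y) fun w _ => by
        rw [abs_of_nonneg (eg_nonneg y w)]; exact eg_le hy w
  have e0 : 0 ≤ ∫ x in Q, eg y x := integral_nonneg fun x => eg_nonneg y x
  have idiff : ∀ i k, IntegrableOn (fun x => |grad y x i k - q i k x|) B := fun i k => by
    refine integrableOn_of_bounded' (M := L + L) fB measurableSet_ball ?_ fun x _ => ?_
    · exact ((measurable_pd (y i) k).sub (q2 i k).continuous.measurable).abs
    · rw [abs_abs]
      exact (abs_sub _ _).trans (add_le_add (abs_pd_le (hy i) k x) (qL i k x))
  have key : ∀ i k, ∫ x in K, ∑ j, pd (q i k) j x ^ 2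
      ≤ ∑ j, (∫ x, pd (pd φ j) j x * q i k x ^ 2) / 2
        + volume.real B * (L * CΔ) * ∫ x in Q, eg y x := fun i k => by
    have i1 : ∀ j, Integrable fun x => φ x * pd (q i k) j x ^ 2 := fun j =>
      (φ2.continuous.mul ((pq1 i k j).continuous.pow 2)).integrable_of_hasCompactSupport
        cφ.mul_right
    have i2 : ∀ j, Integrable fun x => φ x * (q i k x * pd (pd (q i k) j) j x) := fun j =>
      (φ2.continuous.mul ((q2 i k).continuous.mul (cpp i k j))).integrable_of_hasCompactSupport
        cφ.mul_right
    have h1 : ∫ x in K, ∑ j, pd (q i k) j x ^ 2 ≤ ∫ x, ∑ j, φ x * pd (q i k) j x ^ 2 := by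
      have hK1 : ∀ x ∈ K, ∑ j, pd (q i k) j x ^ 2 = ∑ j, φ x * pd (q i k) j x ^ 2 := fun x hx => by
        have : φ x = 1 := φ.one_of_mem_closedBall (Metric.ball_subset_closedBall hx)
        simp [this]
      rw [setIntegral_congr_fun measurableSet_ball hK1]
      refine setIntegral_le_integral (integrable_finsetSum _ fun j _ => i1 j)
        (Filter.Eventually.of_forall fun x => Finset.sum_nonneg fun j _ =>
          mul_nonneg φ.nonneg (sq_nonneg _))
    refine h1.trans ?_
    rw [integral_finsetSum _ fun j _ => i1 j,
      Finset.sum_congr rfl fun j _ => integral_mul_sum_sq_pd φ2 cφ (q2 i k) j,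
      Finset.sum_sub_distrib, ← integral_finsetSum _ fun j _ => i2 j, sub_eq_add_neg]
    refine add_le_add le_rfl ?_
    refine (neg_le_abs _).trans ?_
    rw [← setIntegral_eq_integral_of_forall_compl_eq_zero (s := B) fun x hx =>
      Finset.sum_eq_zero fun j _ => by rw [zφ x hx, zero_mul], ← Real.norm_eq_abs]
    have := norm_setIntegral_le_of_norm_le_const (μ := volume) (s := B) fB.lt_top
      (f := fun x => ∑ j, φ x * (q i k x * pd (pd (q i k) j) j x))
      (C := L * CΔ * ∫ x in Q, eg y x) fun x hx => by
        rw [← Finset.mul_sum, ← Finset.mul_sum, norm_mul, norm_mul, Real.norm_eq_abs,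
          Real.norm_eq_abs, Real.norm_eq_abs, abs_of_nonneg φ.nonneg]
        have hx1 : ‖x‖ + t < 1 := by
          have := mem_ball_zero_iff.1 hx; linarith
        have hl := hCΔ y hy x hx1 i k
        calc φ x * (|q i k x| * |∑ j, pd (pd (q i k) j) j x|)
            ≤ 1 * (L * (CΔ * ∫ x in Q, eg y x)) := by
              refine mul_le_mul φ.le_one (mul_le_mul (qL i k x) hl (abs_nonneg _) L.2)
                (by positivity) zero_le_one
          _ = _ := by ring
    exact this.trans (le_of_eq (by ring))
  have i3 : ∀ j i k, Integrable fun x => pd (pd φ j) j x * q i k x ^ 2 := fun j i k =>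
    ((s2 j).mul ((q2 i k).continuous.pow 2)).integrable_of_hasCompactSupport (c2 j).mul_right
  have main : ∀ j, ∑ i, ∑ k, ∫ x, pd (pd φ j) j x * q i k x ^ 2
      ≤ M j * (2 * L * (∑ i, ∑ k, ∫ x in B, |grad y x i k - q i k x|)
        + C2 * ∫ x in Q, eg y x) := fun j => by
    have iP : Integrable (pd (pd φ j) j) := (s2 j).integrable_of_hasCompactSupport (c2 j)
    have I0 : ∫ x, pd (pd φ j) j x = 0 := by
      have := integral_mul_pd (u := fun _ => 1) contDiff_const (φ1 j) (hasCompactSupport_pd cφ j) j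
      simpa [pd] using this
    have iS : ∀ i, Integrable fun x => ∑ k, pd (pd φ j) j x * q i k x ^ 2 := fun i =>
      integrable_finsetSum _ fun k _ => i3 j i k
    have e1 : ∑ i, ∑ k, ∫ x, pd (pd φ j) j x * q i k x ^ 2
        = ∫ x in B, pd (pd φ j) j x * ((∑ i, ∑ k, q i k x ^ 2) - d) := by
      have hz : ∀ x, x ∉ B → pd (pd φ j) j x * ((∑ i, ∑ k, q i k x ^ 2) - d) = 0 := fun x hx => by
        rw [zpφ j x hx, zero_mul]
      rw [setIntegral_eq_integral_of_forall_compl_eq_zero hz]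
      have : ∀ x, pd (pd φ j) j x * ((∑ i, ∑ k, q i k x ^ 2) - d)
          = (∑ i, ∑ k, pd (pd φ j) j x * q i k x ^ 2) - pd (pd φ j) j x * d := fun x => by
        simp only [mul_sub, Finset.mul_sum]
      simp only [this]
      rw [integral_sub (integrable_finsetSum _ fun i _ => iS i) (iP.mul_const _),
        integral_mul_const, I0, zero_mul, sub_zero, integral_finsetSum _ fun i _ => iS i]
      exact Finset.sum_congr rfl fun i _ => (integral_finsetSum _ fun k _ => i3 j i k).symm
    have iR : IntegrableOn (fun x => M j * (2 * L * (∑ i, ∑ k, |grad y x i k - q i k x|)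
        + C2 * eg y x)) B :=
      (((integrable_finsetSum _ fun i _ => integrable_finsetSum _ fun k _ =>
        idiff i k).const_mul _).add ((ie.mono_set hBQ).const_mul _)).const_mul _
    have pt : ∀ x, pd (pd φ j) j x * ((∑ i, ∑ k, q i k x ^ 2) - d)
        ≤ M j * (2 * L * (∑ i, ∑ k, |grad y x i k - q i k x|) + C2 * eg y x) := fun x => by
      refine (le_abs_self _).trans ?_
      rw [abs_mul]
      refine mul_le_mul (hM j x) ?_ (abs_nonneg _) (hM0 j)
      have h1 := hC2 _ (norm_grad_le hy x)
      have h2 : |(∑ i, ∑ k, q i k x ^ 2) - ∑ i, ∑ k, grad y x i k ^ 2|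
          ≤ 2 * L * (∑ i, ∑ k, |grad y x i k - q i k x|) := by
        rw [← Finset.sum_sub_distrib, Finset.mul_sum]
        refine (Finset.abs_sum_le_sum_abs _ _).trans (Finset.sum_le_sum fun i _ => ?_)
        rw [← Finset.sum_sub_distrib, Finset.mul_sum]
        refine (Finset.abs_sum_le_sum_abs _ _).trans (Finset.sum_le_sum fun k _ => ?_)
        rw [sq_sub_sq, abs_mul, abs_sub_comm]
        refine mul_le_mul_of_nonneg_right ?_ (abs_nonneg _)
        have a1 := qL i k x
        have a2 : |grad y x i k| ≤ L := abs_pd_le (hy i) k x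
        linarith [abs_add_le (q i k x) (grad y x i k)]
      calc _ = |((∑ i, ∑ k, q i k x ^ 2) - ∑ i, ∑ k, grad y x i k ^ 2)
            + ((∑ i, ∑ k, grad y x i k ^ 2) - d)| := by ring_nf
        _ ≤ _ := (abs_add_le _ _).trans (add_le_add h2 h1)
    rw [e1]
    calc _ ≤ ∫ x in B, M j * (2 * L * (∑ i, ∑ k, |grad y x i k - q i k x|) + C2 * eg y x) := by
          refine integral_mono (Integrable.integrableOn ?_) iR pt
          refine ((s2 j).mul (Continuous.sub ?_ continuous_const)).integrable_of_hasCompactSupport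
            (c2 j).mul_right
          exact continuous_finsetSum _ fun i _ => continuous_finsetSum _ fun k _ =>
            (q2 i k).continuous.pow 2
      _ = M j * (2 * L * (∑ i, ∑ k, ∫ x in B, |grad y x i k - q i k x|)
          + C2 * ∫ x in B, eg y x) := by
          rw [integral_const_mul, integral_add ((integrable_finsetSum _ fun i _ =>
            integrable_finsetSum _ fun k _ => idiff i k).const_mul _)
            ((ie.mono_set hBQ).const_mul _), integral_const_mul, integral_const_mul,
            integral_finsetSum _ fun i _ => integrable_finsetSum _ fun k _ => idiff i k]
          simp only [integral_finsetSum _ fun k _ => idiff _ k]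
      _ ≤ _ := by
          have := setIntegral_mono_set ie (Filter.Eventually.of_forall fun x => eg_nonneg y x)
            hBQ.eventuallyLE
          have := hM0 j
          gcongr
  calc _ ≤ ∑ i, ∑ k, (∑ j, (∫ x, pd (pd φ j) j x * q i k x ^ 2) / 2
        + volume.real B * (L * CΔ) * ∫ x in Q, eg y x) :=
        Finset.sum_le_sum fun i _ => Finset.sum_le_sum fun k _ => key i k
    _ = (∑ j, ∑ i, ∑ k, ∫ x, pd (pd φ j) j x * q i k x ^ 2) / 2
        + (∑ i : Fin d, ∑ k : Fin d, volume.real B * (L * CΔ)) * ∫ x in Q, eg y x := by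
        simp only [Finset.sum_add_distrib, Finset.sum_mul, Finset.sum_div]
        congr 1
        exact (Finset.sum_congr rfl fun i _ => Finset.sum_comm).trans Finset.sum_comm
    _ ≤ (∑ j, M j * (2 * L * (∑ i, ∑ k, ∫ x in B, |grad y x i k - q i k x|)
        + C2 * ∫ x in Q, eg y x)) / 2
        + (∑ i : Fin d, ∑ k : Fin d, volume.real B * (L * CΔ)) * ∫ x in Q, eg y x := by
        gcongr with j
        exact main j
    _ = _ := by
        rw [← Finset.sum_mul]; ring

lemma IsMollifier.exists (d : ℕ) {t : ℝ} (ht : 0 < t) :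
    ∃ ψ : (Fin d → ℝ) → ℝ, IsMollifier t ψ := by
  obtain ⟨ψ, h1, h2, h3, h4, h5⟩ := exists_mollifier d ht
  exact ⟨ψ, h1, h2, h3, h4, h5⟩

lemma integral_abs_le_of_sq {α : Type*} [MeasurableSpace α] {μ : Measure α} [IsFiniteMeasure μ]
    {h : α → ℝ} (i2 : Integrable (fun x => h x ^ 2) μ) {s : ℝ} (hs : 0 < s) :
    ∫ x, |h x| ∂μ ≤ s * μ.real univ / 2 + (∫ x, h x ^ 2 ∂μ) / (2 * s) := by
  have i3 : Integrable (fun x => s / 2 + h x ^ 2 / (2 * s)) μ :=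
    (integrable_const _).add (i2.div_const _)
  calc ∫ x, |h x| ∂μ ≤ ∫ x, (s / 2 + h x ^ 2 / (2 * s)) ∂μ := by
        refine integral_mono_of_nonneg (Filter.Eventually.of_forall fun x => abs_nonneg _) i3
          (Filter.Eventually.of_forall fun x => ?_)
        change |h x| ≤ s / 2 + h x ^ 2 / (2 * s)
        rw [← sq_abs (h x), div_add_div _ _ two_ne_zero (by positivity),
          le_div_iff₀ (by positivity)]
        nlinarith [sq_nonneg (|h x| - s)]
    _ = _ := by
        rw [integral_add (integrable_const _) (i2.div_const _),
          integral_div (2 * s) (fun x => h x ^ 2), integral_const, smul_eq_mul]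
        ring

lemma sq_norm_le_sum {d : ℕ} (A : Fin d → Fin d → ℝ) : ‖A‖ ^ 2 ≤ ∑ i, ∑ k, A i k ^ 2 := by
  have h0 : 0 ≤ ∑ i, ∑ k, A i k ^ 2 :=
    Finset.sum_nonneg fun i _ => Finset.sum_nonneg fun k _ => sq_nonneg _
  have : ‖A‖ ≤ √(∑ i, ∑ k, A i k ^ 2) := by
    refine (pi_norm_le_iff_of_nonneg (Real.sqrt_nonneg _)).2 fun i =>
      (pi_norm_le_iff_of_nonneg (Real.sqrt_nonneg _)).2 fun k => ?_
    refine Real.le_sqrt_of_sq_le ?_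
    rw [Real.norm_eq_abs, sq_abs]
    refine (Finset.single_le_sum (f := fun k => A i k ^ 2) (fun k _ => sq_nonneg _)
      (Finset.mem_univ k)).trans ?_
    exact Finset.single_le_sum (f := fun i => ∑ k, A i k ^ 2)
      (fun i _ => Finset.sum_nonneg fun k _ => sq_nonneg _) (Finset.mem_univ i)
  calc ‖A‖ ^ 2 ≤ √(∑ i, ∑ k, A i k ^ 2) ^ 2 := pow_le_pow_left₀ (norm_nonneg _) this 2
    _ = _ := Real.sq_sqrt h0

lemma integrableOn_sq_norm_grad {d : ℕ} {y : Fin d → (Fin d → ℝ) → ℝ} {L : NNReal}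
    (hy : ∀ i, LipschitzWith L (y i)) (c : Fin d → Fin d → ℝ) {s : Set (Fin d → ℝ)}
    (hs : volume s ≠ ⊤) (ms : MeasurableSet s) :
    IntegrableOn (fun x => ‖grad y x - c‖ ^ 2) s := by
  refine integrableOn_of_bounded' (M := (L + ‖c‖) ^ 2) hs ms
    (((measurable_grad y).sub_const c).norm.pow_const 2) fun x _ => ?_
  rw [abs_of_nonneg (sq_nonneg _)]
  exact pow_le_pow_left₀ (norm_nonneg _)
    ((norm_sub_le _ _).trans (add_le_add (norm_grad_le hy x) le_rfl)) 2

lemma integrableOn_sq_eg {d : ℕ} {y : Fin d → (Fin d → ℝ) → ℝ} {L : NNReal}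
    (hy : ∀ i, LipschitzWith L (y i)) {s : Set (Fin d → ℝ)}
    (hs : volume s ≠ ⊤) (ms : MeasurableSet s) : IntegrableOn (fun x => eg y x ^ 2) s := by
  refine integrableOn_of_bounded' (M := (L + 1) ^ 2) hs ms ((measurable_eg y).pow_const 2)
    fun x _ => ?_
  rw [abs_of_nonneg (sq_nonneg _)]
  exact pow_le_pow_left₀ (eg_nonneg y x) (eg_le hy x) 2

set_option maxHeartbeats 800000 in
/-- Interior version of the qualitative closeness of the gradient to a constant. -/
lemma exists_interior_close (d : ℕ) (L : NNReal) {κ : ℝ} (hκ : 0 < κ) (hκ2 : κ < 1 / 2) :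
    ∃ C, 0 ≤ C ∧ ∀ t, 0 < t → t ≤ κ / 4 → ∃ A, 0 ≤ A ∧ ∀ s, 0 < s →
      ∀ y : Fin d → (Fin d → ℝ) → ℝ, (∀ i, LipschitzWith L (y i)) →
      ∃ c : Fin d → Fin d → ℝ, ‖c‖ ≤ L ∧
        ∫ x in Metric.ball 0 (1 - 2 * κ), ‖grad y x - c‖ ^ 2 ≤
          C * t + A * (s + (∫ x in Metric.ball 0 1, eg y x ^ 2) / s
            + ∫ x in Metric.ball 0 1, eg y x ^ 2) := by
  obtain ⟨C1, hC10, hC1⟩ := exists_energy d L hκ hκ2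
  obtain ⟨C2, hC20, hC2⟩ := exists_moll_grad d L hκ
  set B := Metric.ball (0 : Fin d → ℝ) (1 - κ) with hB
  set Q := Metric.ball (0 : Fin d → ℝ) 1 with hQ
  set K := Metric.ball (0 : Fin d → ℝ) (1 - 2 * κ) with hK
  have hBQ : B ⊆ Q := Metric.ball_subset_ball (by linarith)
  have hKB : K ⊆ B := Metric.ball_subset_ball (by linarith)
  have fB : volume B ≠ ⊤ := measure_ball_lt_top.ne
  have fQ : volume Q ≠ ⊤ := measure_ball_lt_top.ne
  have fK : volume K ≠ ⊤ := measure_ball_lt_top.ne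
  have vK : 0 < volume K := Metric.measure_ball_pos _ _ (by linarith)
  have rK : 0 < volume.real K := ENNReal.toReal_pos vK.ne' fK
  set P := volume.real (Metric.ball (0 : Fin d → ℝ) 2) * (d * 2 ^ 2) / volume.real K with hP
  have hP0 : 0 ≤ P := by
    have := measureReal_nonneg (μ := volume) (s := Metric.ball (0 : Fin d → ℝ) 2)
    positivity
  set V := volume.real Q with hV
  set W := volume.real B with hW
  have hV0 : 0 ≤ V := measureReal_nonneg
  have hW0 : 0 ≤ W := measureReal_nonneg
  set D : ℝ := (d : ℝ) * d with hD
  have hD0 : 0 ≤ D := by positivity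
  set m := (L : ℝ) ^ 2 * V with hm
  have hm0 : 0 ≤ m := by positivity
  refine ⟨2 * P * C1 * D * (W / 2 + C2 * m / 2) + 2 * D * C2 * m, by positivity,
    fun t ht0 ht => ?_⟩
  obtain ⟨ψ, hψ⟩ := IsMollifier.exists d ht0
  obtain ⟨A, hA0, hA⟩ := hC1 t ψ ht hψ
  refine ⟨2 * P * C1 * D * C2 / (2 * t) + 2 * P * A * (V + 1) + 2 * D * C2, by positivity,
    fun s hs y hy => ?_⟩
  set ε2 := ∫ x in Q, eg y x ^ 2 with hε2
  have hε0 : 0 ≤ ε2 := integral_nonneg fun x => sq_nonneg _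
  set q : Fin d → Fin d → (Fin d → ℝ) → ℝ := fun i k => moll ψ (pd (y i) k) with hq
  have qm : ∀ i k, Measurable (q i k) := fun i k => (hψ.contDiff_moll (hy i) k
      0).continuous.measurable
  have qL : ∀ i k x, |q i k x| ≤ L := fun i k x => hψ.abs_moll_le (abs_pd_le (hy i) k) x
  have e1 : ∫ x in Q, eg y x ≤ s * V / 2 + ε2 / (2 * s) := by
    have : IsFiniteMeasure (volume.restrict Q) := ⟨by simpa using fQ.lt_top⟩
    have := integral_abs_le_of_sq (integrableOn_sq_eg hy fQ measurableSet_ball) hs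
    simp only [abs_of_nonneg (eg_nonneg y _)] at this
    simpa using this
  have hm1 : ∫ x in Q, ‖grad y x - 0‖ ^ 2 ≤ m := by
    have := setIntegral_mono_on (integrableOn_sq_norm_grad hy 0 fQ measurableSet_ball)
      (integrableOn_const (C := (L : ℝ) ^ 2) fQ) measurableSet_ball fun x _ => by
        rw [sub_zero]; exact pow_le_pow_left₀ (norm_nonneg _) (norm_grad_le hy x) 2
    rwa [setIntegral_const, smul_eq_mul, mul_comm] at this
  have mdiff : ∀ i k, Measurable fun x => grad y x i k - q i k x := fun i k =>
    (measurable_pd (y i) k).sub (qm i k)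
  have e2 : ∀ i k, ∫ x in B, (grad y x i k - q i k x) ^ 2 ≤ C2 * (t ^ 2 * m + ε2) := fun i k =>
    (hC2 y hy 0 t ψ ht hψ i k).trans (by gcongr)
  have i2 : ∀ i k, IntegrableOn (fun x => (grad y x i k - q i k x) ^ 2) B := fun i k => by
    refine integrableOn_of_bounded' (M := (L + L) ^ 2) fB measurableSet_ball
      ((mdiff i k).pow_const 2) fun x _ => ?_
    rw [abs_pow]
    exact pow_le_pow_left₀ (abs_nonneg _)
      ((abs_sub _ _).trans (add_le_add (abs_pd_le (hy i) k x) (qL i k x))) 2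
  have e3 : ∀ i k, ∫ x in B, |grad y x i k - q i k x| ≤
      t * W / 2 + C2 * (t ^ 2 * m + ε2) / (2 * t) := fun i k => by
    have : IsFiniteMeasure (volume.restrict B) := ⟨by simpa using fB.lt_top⟩
    have := integral_abs_le_of_sq (i2 i k) ht0
    simp only [measureReal_restrict_apply MeasurableSet.univ, univ_inter] at this
    refine this.trans ?_
    gcongr
    exact e2 i k
  have en := hA y hy
  have en2 : ∑ i, ∑ k, ∫ x in K, ∑ j, pd (q i k) j x ^ 2 ≤
      C1 * (D * (t * W / 2 + C2 * (t ^ 2 * m + ε2) / (2 * t)))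
        + A * (s * V / 2 + ε2 / (2 * s)) := by
    refine en.trans ?_
    gcongr
    refine (Finset.sum_le_sum fun i _ => Finset.sum_le_sum fun k _ => e3 i k).trans (le_of_eq ?_)
    simp [hD]; ring
  choose K' hK' using fun i k => lipschitz_moll (measurable_pd (y i) k) (abs_pd_le (hy i) k)
    (hψ.smooth.of_le (le_top_smooth 1)) hψ.compact
  choose a haK ha using fun i k => exists_poincare (hK' i k) (convex_ball _ _) measurableSet_ball
    (hKB.trans hBQ) vK.ne'
  refine ⟨fun i k => q i k (a i k), (pi_norm_le_iff_of_nonneg L.2).2 fun i =>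
    (pi_norm_le_iff_of_nonneg L.2).2 fun k => qL i k _, ?_⟩
  have po : ∀ i k, ∫ x in K, (q i k x - q i k (a i k)) ^ 2
      ≤ P * ∫ x in K, ∑ j, pd (q i k) j x ^ 2 := fun i k => by
    rw [hP, div_mul_eq_mul_div, le_div_iff₀ rK, mul_comm]
    exact (ha i k).trans (le_of_eq (by ring))
  have i4 : ∀ i k, IntegrableOn (fun x => (q i k x - q i k (a i k)) ^ 2) K := fun i k => by
    refine integrableOn_of_bounded' (M := (L + L) ^ 2) fK measurableSet_ball
      (((qm i k).sub_const _).pow_const 2) fun x _ => ?_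
    rw [abs_pow]
    exact pow_le_pow_left₀ (abs_nonneg _)
      ((abs_sub _ _).trans (add_le_add (qL i k x) (qL i k _))) 2
  have i5 : ∀ i k, IntegrableOn (fun x => 2 * (grad y x i k - q i k x) ^ 2
      + 2 * (q i k x - q i k (a i k)) ^ 2) K := fun i k =>
    (((i2 i k).mono_set hKB).const_mul 2).add ((i4 i k).const_mul 2)
  have iall : IntegrableOn (fun x => ∑ i, ∑ k, (2 * (grad y x i k - q i k x) ^ 2
      + 2 * (q i k x - q i k (a i k)) ^ 2)) K :=
    integrable_finsetSum _ fun i _ => integrable_finsetSum _ fun k _ => i5 i k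
  calc ∫ x in K, ‖grad y x - fun i k => q i k (a i k)‖ ^ 2
      ≤ ∫ x in K, ∑ i, ∑ k, (2 * (grad y x i k - q i k x) ^ 2
        + 2 * (q i k x - q i k (a i k)) ^ 2) := by
        refine integral_mono_of_nonneg (Filter.Eventually.of_forall fun x => sq_nonneg _) iall
          (Filter.Eventually.of_forall fun x => (sq_norm_le_sum _).trans ?_)
        refine Finset.sum_le_sum fun i _ => Finset.sum_le_sum fun k _ => ?_
        simp only [Pi.sub_apply]
        nlinarith [sq_nonneg ((grad y x i k - q i k x) - (q i k x - q i k (a i k)))]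
    _ = ∑ i, ∑ k, (2 * (∫ x in K, (grad y x i k - q i k x) ^ 2)
        + 2 * ∫ x in K, (q i k x - q i k (a i k)) ^ 2) := by
        rw [integral_finsetSum _ fun i _ => integrable_finsetSum _ fun k _ => i5 i k]
        refine Finset.sum_congr rfl fun i _ => ?_
        rw [integral_finsetSum _ fun k _ => i5 i k]
        refine Finset.sum_congr rfl fun k _ => ?_
        rw [integral_add (((i2 i k).mono_set hKB).const_mul 2) ((i4 i k).const_mul 2),
          integral_const_mul, integral_const_mul]
    _ ≤ ∑ i, ∑ k, (2 * (C2 * (t ^ 2 * m + ε2))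
        + 2 * (P * ∫ x in K, ∑ j, pd (q i k) j x ^ 2)) := by
        refine Finset.sum_le_sum fun i _ => Finset.sum_le_sum fun k _ => ?_
        have h1 := setIntegral_mono_set (i2 i k) (Filter.Eventually.of_forall fun x => sq_nonneg _)
          hKB.eventuallyLE
        have h2 := e2 i k
        have h3 := po i k
        linarith
    _ = 2 * D * (C2 * (t ^ 2 * m + ε2)) + 2 * P * ∑ i, ∑ k, ∫ x in K, ∑ j, pd (q i k) j x ^ 2 := by
        simp only [Finset.sum_add_distrib, Finset.mul_sum, hD]
        simp; ring_nf
    _ ≤ 2 * D * (C2 * (t ^ 2 * m + ε2)) + 2 * P * (C1 * (D * (t * W / 2 + C2 * (t ^ 2 * m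
        + ε2) / (2 * t)))
        + A * (s * V / 2 + ε2 / (2 * s))) := by gcongr
    _ ≤ _ := by
        have t1 : t ^ 2 ≤ t := by nlinarith
        have r1 : C2 * (t ^ 2 * m + ε2) / (2 * t) = C2 * m * t / 2 + C2 * ε2 * (1 / (2 * t)) := by
          field_simp
        have r2 : ε2 / (2 * s) = ε2 / s / 2 := by field_simp
        have r3 : 2 * P * C1 * D * C2 / (2 * t) = 2 * P * C1 * D * C2 * (1 / (2 * t)) := by ring
        rw [r1, r2, r3]
        have T0 : 0 ≤ 1 / (2 * t) := by positivity
        have E0 : 0 ≤ ε2 / s := by positivity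
        generalize 1 / (2 * t) = T at *
        generalize ε2 / s = E at *
        have n1 : 0 ≤ 2 * D * C2 * m * (t - t ^ 2) :=
          mul_nonneg (by positivity) (by linarith)
        have n2 : 0 ≤ 2 * P * C1 * D * C2 * T * (s + E) := by positivity
        have n3 : 0 ≤ P * A * (V * s + 2 * V * E + 2 * (V + 1) * ε2 + E + 2 * s) := by positivity
        have n4 : 0 ≤ 2 * D * C2 * (s + E) := by positivity
        linarith [n1, n2, n3, n4]

lemma volume_real_ball {d : ℕ} (a : Fin d → ℝ) {r : ℝ} (hr : 0 < r) :
    volume.real (Metric.ball a r) = (2 * r) ^ d := by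
  rw [measureReal_def, Real.volume_pi_ball a hr, ENNReal.toReal_ofReal (by positivity),
    Fintype.card_fin]

lemma volume_real_layer_le (d : ℕ) {s : ℝ} (hs : 0 < s) (hs1 : s < 1) :
    volume.real (Metric.ball (0 : Fin d → ℝ) 1 \ Metric.ball 0 (1 - s)) ≤ 2 ^ d * (d * s) := by
  rw [measureReal_sdiff (Metric.ball_subset_ball (by linarith)) measurableSet_ball,
    volume_real_ball _ one_pos, volume_real_ball _ (by linarith), mul_pow, mul_pow, one_pow]
  have := one_add_mul_le_pow (a := -s) (by linarith) d
  rw [← sub_eq_add_neg] at this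
  have h2 : (0 : ℝ) < 2 ^ d := by positivity
  nlinarith

/-- Small energy forces the gradient to be close to a constant on the whole cube. -/
lemma exists_close_of_small (d : ℕ) (L : NNReal) {η : ℝ} (hη : 0 < η) :
    ∃ δ > 0, ∀ y : Fin d → (Fin d → ℝ) → ℝ, (∀ i, LipschitzWith L (y i)) →
      ∫ x in Metric.ball 0 1, eg y x ^ 2 ≤ δ →
      ∃ c : Fin d → Fin d → ℝ, ∫ x in Metric.ball 0 1, ‖grad y x - c‖ ^ 2 ≤ η := by
  set Q := Metric.ball (0 : Fin d → ℝ) 1 with hQ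
  have fQ : volume Q ≠ ⊤ := measure_ball_lt_top.ne
  obtain ⟨κ, hκ, hκ2, hlayer⟩ : ∃ κ : ℝ, 0 < κ ∧ κ < 1 / 2 ∧
      (2 * L) ^ 2 * volume.real (Q \ Metric.ball 0 (1 - 2 * κ)) ≤ η / 2 := by
    set M : ℝ := (2 * L) ^ 2 * (2 ^ d * (d * 2)) with hM
    have hM0 : 0 ≤ M := by positivity
    have h4 : η / (2 * (M + 1)) * (M + 1) = η / 2 := by field_simp
    have h5 : 0 < η / (2 * (M + 1)) := by positivity
    refine ⟨min (1 / 4) (η / (2 * (M + 1))), lt_min (by norm_num) h5,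
      (min_le_left _ _).trans_lt (by norm_num), ?_⟩
    have k0 : 0 < min (1 / 4) (η / (2 * (M + 1))) := lt_min (by norm_num) h5
    have k1 := min_le_left (1 / 4) (η / (2 * (M + 1)))
    have k2 := min_le_right (1 / 4) (η / (2 * (M + 1)))
    generalize min (1 / 4) (η / (2 * (M + 1))) = κ at *
    have h3 := volume_real_layer_le d (s := 2 * κ) (by linarith) (by linarith)
    calc (2 * (L : ℝ)) ^ 2 * volume.real (Q \ Metric.ball 0 (1 - 2 * κ))
        ≤ (2 * L) ^ 2 * (2 ^ d * (d * (2 * κ))) := by gcongr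
      _ = M * κ := by rw [hM]; ring
      _ ≤ (M + 1) * (η / (2 * (M + 1))) := by
          refine mul_le_mul (by linarith) k2 k0.le (by linarith)
      _ = η / 2 := by rw [mul_comm]; exact h4
  set K := Metric.ball (0 : Fin d → ℝ) (1 - 2 * κ) with hK
  have hKQ : K ⊆ Q := Metric.ball_subset_ball (by linarith)
  obtain ⟨C, hC0, hC⟩ := exists_interior_close d L hκ hκ2
  set t := min (κ / 4) (η / (8 * (C + 1))) with ht
  have t0 : 0 < t := lt_min (by positivity) (by positivity)
  have Ct : C * t ≤ η / 8 := by
    calc C * t ≤ (C + 1) * (η / (8 * (C + 1))) :=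
          mul_le_mul (by linarith) (min_le_right _ _) t0.le (by linarith)
      _ = η / 8 := by field_simp
  obtain ⟨A, hA0, hA⟩ := hC t t0 (min_le_left _ _)
  set s := η / (8 * (A + 1)) with hs
  have s0 : 0 < s := by positivity
  have As : A * s ≤ η / 8 := by
    calc A * s ≤ (A + 1) * (η / (8 * (A + 1))) :=
          mul_le_mul (by linarith) le_rfl s0.le (by linarith)
      _ = η / 8 := by field_simp
  refine ⟨η / (8 * (A + 1) * (1 / s + 1)), by positivity, fun y hy he => ?_⟩
  obtain ⟨c, hcL, hc⟩ := hA s s0 y hy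
  refine ⟨c, ?_⟩
  have h_int : ∫ x in K, ‖grad y x - c‖ ^ 2 ≤ η / 2 := by
    refine hc.trans ?_
    have hε0 : 0 ≤ ∫ x in Q, eg y x ^ 2 := integral_nonneg fun x => sq_nonneg _
    have : A * ((∫ x in Q, eg y x ^ 2) / s + ∫ x in Q, eg y x ^ 2) ≤ η / 8 := by
      calc A * ((∫ x in Q, eg y x ^ 2) / s + ∫ x in Q, eg y x ^ 2)
          = A * (1 / s + 1) * (∫ x in Q, eg y x ^ 2) := by ring
        _ ≤ (A + 1) * (1 / s + 1) * (η / (8 * (A + 1) * (1 / s + 1))) := by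
            gcongr
            linarith
        _ = η / 8 := by field_simp
    linarith
  have i0 := integrableOn_sq_norm_grad hy c fQ measurableSet_ball
  have hsplit : ∫ x in Q, ‖grad y x - c‖ ^ 2
      = (∫ x in K, ‖grad y x - c‖ ^ 2) + ∫ x in Q \ K, ‖grad y x - c‖ ^ 2 := by
    rw [← setIntegral_union disjoint_sdiff_right (measurableSet_ball.diff measurableSet_ball)
      (i0.mono_set hKQ) (i0.mono_set sdiff_subset), union_sdiff_cancel hKQ]
  have hlay : ∫ x in Q \ K, ‖grad y x - c‖ ^ 2 ≤ (2 * L) ^ 2 * volume.real (Q \ K) := by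
    have fD : volume (Q \ K) ≠ ⊤ := ((measure_mono sdiff_subset).trans_lt fQ.lt_top).ne
    have := setIntegral_mono_on (i0.mono_set sdiff_subset)
      (integrableOn_const (C := (2 * (L : ℝ)) ^ 2) fD)
      (measurableSet_ball.diff measurableSet_ball) fun x _ => by
        refine pow_le_pow_left₀ (norm_nonneg _) ((norm_sub_le _ _).trans ?_) 2
        linarith [norm_grad_le hy x]
    rwa [setIntegral_const, smul_eq_mul, mul_comm] at this
  linarith

lemma sq_integral_le_measure_mul {α : Type*} [MeasurableSpace α] {μ : Measure α}
    [IsFiniteMeasure μ] {h : α → ℝ} (i1 : Integrable h μ) (i2 : Integrable (fun x => h x ^ 2) μ) :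
    (∫ x, h x ∂μ) ^ 2 ≤ μ.real univ * ∫ x, h x ^ 2 ∂μ := by
  rcases eq_or_ne (μ.real univ) 0 with hμ | hμ
  · have : μ = 0 := by
      rwa [measureReal_eq_zero_iff, Measure.measure_univ_eq_zero] at hμ
    simp [this]
  have pos : 0 < μ.real univ := lt_of_le_of_ne measureReal_nonneg hμ.symm
  have := sq_integral_le (μ := μ) (ψ := fun _ => (μ.real univ)⁻¹) (h := h)
    (fun _ => by positivity) (integrable_const _)
    (by rw [integral_const, smul_eq_mul, mul_inv_cancel₀ hμ]) (i1.const_mul _) (i2.const_mul _)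
  rw [integral_const_mul, integral_const_mul, mul_pow, inv_pow, inv_mul_eq_div, inv_mul_eq_div,
    div_le_div_iff₀ (by positivity) pos] at this
  have h2 : (∫ x, h x ∂μ) ^ 2 * μ.real univ ≤ (μ.real univ * ∫ x, h x ^ 2 ∂μ) * μ.real univ := by
    linarith
  exact le_of_mul_le_mul_right h2 pos

lemma integral_pd_eq_zero {d : ℕ} {ψ : (Fin d → ℝ) → ℝ} (hψ : ContDiff ℝ 1 ψ)
    (hc : HasCompactSupport ψ) (k : Fin d) : ∫ x, pd ψ k x = 0 := by
  have := integral_mul_pd (u := fun _ => 1) contDiff_const hψ hc k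
  simpa [pd] using this

/-- Interior bound for the convolution with the derivative of a mollifier. -/
lemma abs_moll_pd_le {d : ℕ} {ψ s g : (Fin d → ℝ) → ℝ} {M t : ℝ} {k : Fin d}
    (hψ : IsMollifier t ψ) (hM : ∀ x, |pd ψ k x| ≤ M) (hM0 : 0 ≤ M)
    (hs : ∀ x, |s x| ≤ g x)
    (hg : IntegrableOn g (Metric.ball 0 1)) {x : Fin d → ℝ} (hx : ‖x‖ + t < 1) :
    |moll (pd ψ k) s x| ≤ M * ∫ w in Metric.ball 0 1, g w := by
  rw [moll_eq_integral_sub]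
  have hQ : ∀ w ∉ Metric.ball (0 : Fin d → ℝ) 1, pd ψ k (x - w) * s w = 0 := by
    intro w hw
    rw [pd_eq_zero_of_support (S := Metric.closedBall 0 t) Metric.isClosed_closedBall, zero_mul]
    · intro x hx
      by_contra h
      exact hx (by simpa using (hψ.support x h).le)
    · intro h
      rw [mem_closedBall_zero_iff] at h
      refine hw ?_
      rw [mem_ball_zero_iff]
      calc ‖w‖ = ‖x - (x - w)‖ := by simp
        _ ≤ ‖x‖ + ‖x - w‖ := norm_sub_le _ _
        _ < 1 := by linarith
  rw [← setIntegral_eq_integral_of_forall_compl_eq_zero hQ, ← integral_const_mul,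
    ← Real.norm_eq_abs]
  refine norm_integral_le_of_norm_le (g := fun w => M * g w) (hg.const_mul _)
    (Filter.Eventually.of_forall fun w => ?_)
  rw [norm_mul]
  exact mul_le_mul (hM _) (hs w) (norm_nonneg _) hM0

/-- Korn-type bound: second derivatives of the mollification are controlled by the symmetric part
of `Rᵀ∇y - 1`, hence by the distance to `SO(d)` up to a quadratic error. -/
lemma exists_abs_pd_moll_le (d : ℕ) (L : NNReal) {t : ℝ} {ψ : (Fin d → ℝ) → ℝ}
    (hψ : IsMollifier t ψ) : ∃ A, 0 ≤ A ∧ ∀ y : Fin d → (Fin d → ℝ) → ℝ,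
      (∀ i, LipschitzWith L (y i)) → ∀ R ∈ SOm d, ∀ x, ‖x‖ + t < 1 → ∀ l j k,
      |pd (moll ψ (pd (y l) j)) k x| ≤
        A * ∫ w in Metric.ball 0 1, (eg y w + ‖grad y w - R‖ ^ 2) := by
  obtain ⟨C, hC0, hC⟩ := exists_abs_sym_le d L
  have s1 : ContDiff ℝ 1 ψ := hψ.smooth.of_le (le_top_smooth 1)
  have cp : ∀ k, Continuous (pd ψ k) := fun k => (contDiff_pd (m :=
      0) s1 (by norm_num) k).continuous
  have hc : ∀ k, HasCompactSupport (pd ψ k) := fun k => hasCompactSupport_pd hψ.compact k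
  have ip : ∀ k, Integrable (pd ψ k) := fun k => (cp k).integrable_of_hasCompactSupport (hc k)
  choose M hM0 hM using fun k => exists_bound_of_compact (cp k) (hc k)
  set N := ∑ k, M k with hN
  have hMN : ∀ k, M k ≤ N := fun k =>
    Finset.single_le_sum (fun k _ => hM0 k) (Finset.mem_univ k)
  have hN0 : 0 ≤ N := Finset.sum_nonneg fun k _ => hM0 k
  refine ⟨d * (3 / 2 * (N * C)), by positivity, fun y hy R hR x hx l j k => ?_⟩
  set Γ := ∫ w in Metric.ball 0 1, (eg y w + ‖grad y w - R‖ ^ 2) with hΓ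
  set s : Fin d → Fin d → (Fin d → ℝ) → ℝ := fun i j w =>
    (∑ l, R l i * (grad y w l j - R l j)) + ∑ l, R l j * (grad y w l i - R l i) with hs
  set G : Fin d → Fin d → Fin d → ℝ := fun l j k => moll (pd ψ k) (pd (y l) j) x with hG
  have hGpd : ∀ l j k, pd (moll ψ (pd (y l) j)) k x = G l j k := fun l j k => by
    rw [pd_moll_left (measurable_pd (y l) j) (abs_pd_le (hy l) j) s1 hψ.compact]
  have hGsym : ∀ l j k, G l j k = G l k j := fun l j k => by
    rw [← hGpd, pd_moll_grad (hy l) hψ.smooth hψ.compact]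
  have iG : ∀ l j k, Integrable fun z => pd ψ k z * pd (y l) j (x - z) := fun l j k =>
    integrable_mul_shift (ip k) (measurable_pd _ j) (abs_pd_le (hy l) j) x
  have I0 : ∀ k, ∫ z, pd ψ k z = 0 := integral_pd_eq_zero s1 hψ.compact
  have iGc : ∀ i l j k, Integrable fun z => pd ψ k z * (R l i * (pd (y l) j (x - z) - R l j)) :=
    fun i l j k => by
      have : Integrable fun z => R l i * (pd ψ k z * pd (y l) j (x - z) - pd ψ k z * R l j) :=
        ((iG l j k).sub ((ip k).mul_const _)).const_mul _
      exact this.congr (Filter.Eventually.of_forall fun z => by ring)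
  have eGc : ∀ i l j k, ∫ z, pd ψ k z * (R l i * (pd (y l) j (x - z) - R l j))
      = R l i * G l j k := fun i l j k => by
    have : ∀ z, pd ψ k z * (R l i * (pd (y l) j (x - z) - R l j))
      = R l i * (pd ψ k z * pd (y l) j (x - z) - pd ψ k z * R l j) := fun z => by ring
    simp only [this]
    rw [integral_const_mul, integral_sub (iG l j k) ((ip k).mul_const _), integral_mul_const, I0,
      zero_mul, sub_zero]
    rfl
  have ha : ∀ i j k, moll (pd ψ k) (s i j) x
      = (∑ l, R l i * G l j k) + ∑ l, R l j * G l i k := fun i j k => by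
    have e1 : ∀ z, pd ψ k z * s i j (x - z)
        = (∑ l, pd ψ k z * (R l i * (pd (y l) j (x - z) - R l j)))
          + ∑ l, pd ψ k z * (R l j * (pd (y l) i (x - z) - R l i)) := fun z => by
      simp only [hs, mul_add, Finset.mul_sum, grad]
    unfold moll
    simp only [e1]
    rw [integral_add (integrable_finsetSum _ fun l _ => iGc i l j k)
      (integrable_finsetSum _ fun l _ => iGc j l i k),
      integral_finsetSum _ fun l _ => iGc i l j k, integral_finsetSum _ fun l _ => iGc j l i k]
    simp only [eGc]
  have fQ : volume (Metric.ball (0 : Fin d → ℝ) 1) ≠ ⊤ := measure_ball_lt_top.ne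
  have ig : IntegrableOn (fun w => eg y w + ‖grad y w - R‖ ^ 2) (Metric.ball 0 1) := by
    refine Integrable.add ?_ (integrableOn_sq_norm_grad hy R fQ measurableSet_ball)
    refine integrableOn_of_bounded' (M := L + 1) fQ measurableSet_ball (measurable_eg y)
      fun w _ => ?_
    rw [abs_of_nonneg (eg_nonneg y w)]; exact eg_le hy w
  have hΓ0 : 0 ≤ Γ := integral_nonneg fun w => add_nonneg (eg_nonneg y w) (sq_nonneg _)
  have hab : ∀ i j k, |moll (pd ψ k) (s i j) x| ≤ N * C * Γ := fun i j k => by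
    refine (abs_moll_pd_le hψ (hM k) (hM0 k) (g := fun w => C * (eg y w + ‖grad y w - R‖ ^ 2))
      (fun w => hC _ (norm_grad_le hy w) R hR i j) (ig.const_mul _) hx).trans ?_
    rw [integral_const_mul, ← mul_assoc]
    exact mul_le_mul_of_nonneg_right (mul_le_mul_of_nonneg_right (hMN k) hC0) hΓ0
  set H : Fin d → Fin d → Fin d → ℝ := fun i j k => ∑ l, R l i * G l j k with hH
  have hHsym : ∀ i j k, H i j k = H i k j := fun i j k => by
    simp only [hH]; exact Finset.sum_congr rfl fun l _ => by rw [hGsym]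
  have hHb : ∀ i j k, |H i j k| ≤ 3 / 2 * (N * C) * Γ := fun i j k => by
    have h1 := hab i j k
    have h2 := hab i k j
    have h3 := hab j k i
    rw [ha] at h1 h2 h3
    change |H i j k + H j i k| ≤ _ at h1
    change |H i k j + H k i j| ≤ _ at h2
    change |H j k i + H k j i| ≤ _ at h3
    rw [hHsym i k j] at h2
    rw [hHsym j k i, hHsym k j i] at h3
    rw [abs_le] at *
    constructor <;> linarith
  rw [hGpd]
  have hGH : G l j k = ∑ i, R l i * H i j k := by
    simp only [hH, Finset.mul_sum]
    rw [Finset.sum_comm]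
    have : ∀ m, ∑ i, R l i * (R m i * G m j k) = (if l = m then 1 else 0) * G m j k := fun m => by
      rw [← sum_mul_of_mem_SOm' hR l m, Finset.sum_mul]
      exact Finset.sum_congr rfl fun i _ => by ring
    simp [this]
  rw [hGH]
  calc |∑ i, R l i * H i j k| ≤ ∑ i, |R l i * H i j k| := Finset.abs_sum_le_sum_abs _ _
    _ ≤ ∑ i : Fin d, 1 * (3 / 2 * (N * C) * Γ) := Finset.sum_le_sum fun i _ => by
        rw [abs_mul]
        exact mul_le_mul ((abs_entry_le_norm R l i).trans (norm_le_one_of_mem_SOm hR)) (hHb i j k)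
          (abs_nonneg _) zero_le_one
    _ = _ := by simp; ring

lemma integrableOn_eg {d : ℕ} {y : Fin d → (Fin d → ℝ) → ℝ} {L : NNReal}
    (hy : ∀ i, LipschitzWith L (y i)) {s : Set (Fin d → ℝ)}
    (hs : volume s ≠ ⊤) (ms : MeasurableSet s) : IntegrableOn (eg y) s := by
  refine integrableOn_of_bounded' (M := L + 1) hs ms (measurable_eg y) fun w _ => ?_
  rw [abs_of_nonneg (eg_nonneg y w)]; exact eg_le hy w

lemma sq_integral_eg_le {d : ℕ} {y : Fin d → (Fin d → ℝ) → ℝ} {L : NNReal}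
    (hy : ∀ i, LipschitzWith L (y i)) :
    (∫ x in Metric.ball 0 1, eg y x) ^ 2
      ≤ volume.real (Metric.ball (0 : Fin d → ℝ) 1) * ∫ x in Metric.ball 0 1, eg y x ^ 2 := by
  have fQ : volume (Metric.ball (0 : Fin d → ℝ) 1) ≠ ⊤ := measure_ball_lt_top.ne
  have : IsFiniteMeasure (volume.restrict (Metric.ball (0 : Fin d → ℝ) 1)) :=
    ⟨by simp⟩
  have := sq_integral_le_measure_mul (integrableOn_eg hy fQ measurableSet_ball)
    (integrableOn_sq_eg hy fQ measurableSet_ball)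
  simpa using this

lemma sq_norm_sub_le {E : Type*} [SeminormedAddCommGroup E] (a b c : E) :
    ‖a - c‖ ^ 2 ≤ 2 * ‖a - b‖ ^ 2 + 2 * ‖b - c‖ ^ 2 := by
  have h := norm_sub_le_norm_sub_add_norm_sub a b c
  nlinarith [sq_nonneg (‖a - b‖ - ‖b - c‖), norm_nonneg (a - c)]

/-- A constant can be replaced by a rotation. -/
lemma exists_rotation_close {d : ℕ} {y : Fin d → (Fin d → ℝ) → ℝ} {L : NNReal}
    (hy : ∀ i, LipschitzWith L (y i)) (c : Fin d → Fin d → ℝ) :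
    ∃ R ∈ SOm d, ∫ x in Metric.ball 0 1, ‖grad y x - R‖ ^ 2 ≤
      6 * (∫ x in Metric.ball 0 1, ‖grad y x - c‖ ^ 2)
        + 4 * ∫ x in Metric.ball 0 1, eg y x ^ 2 := by
  obtain ⟨R, hR, hcR⟩ := exists_infDist_SOm c
  refine ⟨R, hR, ?_⟩
  set Q := Metric.ball (0 : Fin d → ℝ) 1 with hQ
  have fQ : volume Q ≠ ⊤ := measure_ball_lt_top.ne
  have ic := integrableOn_sq_norm_grad hy c fQ measurableSet_ball
  have ie := integrableOn_sq_eg hy fQ measurableSet_ball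
  have ii : IntegrableOn (fun x => 6 * ‖grad y x - c‖ ^ 2 + 4 * eg y x ^ 2) Q :=
    (ic.const_mul 6).add (ie.const_mul 4)
  calc ∫ x in Q, ‖grad y x - R‖ ^ 2 ≤ ∫ x in Q, (6 * ‖grad y x - c‖ ^ 2 + 4 * eg y x ^ 2) := by
        refine integral_mono_of_nonneg (Filter.Eventually.of_forall fun x => sq_nonneg _) ii
          (Filter.Eventually.of_forall fun x => ?_)
        change ‖grad y x - R‖ ^ 2 ≤ 6 * ‖grad y x - c‖ ^ 2 + 4 * eg y x ^ 2
        have h1 := sq_norm_sub_le (grad y x) c R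
        have h2 : ‖c - R‖ ≤ eg y x + ‖grad y x - c‖ := by
          rw [← hcR, ← dist_eq_norm, dist_comm]
          exact Metric.infDist_le_infDist_add_dist
        have h3 : ‖c - R‖ ^ 2 ≤ (eg y x + ‖grad y x - c‖) ^ 2 :=
          pow_le_pow_left₀ (norm_nonneg _) h2 2
        nlinarith [sq_nonneg (eg y x - ‖grad y x - c‖)]
    _ = _ := by
        rw [integral_add (ic.const_mul 6) (ie.const_mul 4), integral_const_mul, integral_const_mul]

set_option maxHeartbeats 1600000 in
/-- Local estimate on a smaller cube with an arbitrarily small loss. -/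
lemma exists_local_estimate (d : ℕ) (L : NNReal) {κ θ : ℝ} (hκ : 0 < κ) (hκ1 : κ < 1)
    (hθ : 0 < θ) :
    ∃ C, 0 ≤ C ∧ ∀ y : Fin d → (Fin d → ℝ) → ℝ, (∀ i, LipschitzWith L (y i)) →
      ∀ c : Fin d → Fin d → ℝ, ∃ c' : Fin d → Fin d → ℝ,
        ∫ x in Metric.ball 0 (1 - κ), ‖grad y x - c'‖ ^ 2 ≤
          C * (∫ x in Metric.ball 0 1, eg y x ^ 2)
            + θ * ∫ x in Metric.ball 0 1, ‖grad y x - c‖ ^ 2 := by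
  obtain ⟨C2, hC20, hC2⟩ := exists_moll_grad d L hκ
  set B := Metric.ball (0 : Fin d → ℝ) (1 - κ) with hB
  set Q := Metric.ball (0 : Fin d → ℝ) 1 with hQ
  have hBQ : B ⊆ Q := Metric.ball_subset_ball (by linarith)
  have fB : volume B ≠ ⊤ := measure_ball_lt_top.ne
  have fQ : volume Q ≠ ⊤ := measure_ball_lt_top.ne
  set V := volume.real Q with hV
  have hV0 : 0 ≤ V := measureReal_nonneg
  have hBV : volume.real B ≤ V := measureReal_mono hBQ fQ
  set D : ℝ := (d : ℝ) * d with hD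
  have hD0 : 0 ≤ D := by positivity
  set t := min (min 1 (κ / 4)) (θ / (4 * (D * C2 + 1))) with ht
  have t0 : 0 < t := lt_min (lt_min one_pos (by positivity)) (by positivity)
  have t1 : t ≤ 1 := (min_le_left _ _).trans (min_le_left _ _)
  have tκ : t ≤ κ / 4 := (min_le_left _ _).trans (min_le_right _ _)
  have tθ : 2 * D * C2 * t ^ 2 ≤ θ / 2 := by
    calc 2 * D * C2 * t ^ 2 ≤ 2 * (D * C2 + 1) * (θ / (4 * (D * C2 + 1))) := by
          have h1 : t ^ 2 ≤ t := by nlinarith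
          have h2 : t ≤ θ / (4 * (D * C2 + 1)) := min_le_right _ _
          refine mul_le_mul (by linarith) (h1.trans h2) (sq_nonneg _) (by positivity)
      _ = θ / 2 := by field_simp; ring
  clear_value t
  obtain ⟨ψ, hψ⟩ := IsMollifier.exists d t0
  obtain ⟨A, hA0, hA⟩ := exists_abs_pd_moll_le d L hψ
  set F := 2 * D * V * (d * A) ^ 2 with hF
  have hF0 : 0 ≤ F := by positivity
  set η := θ / (2 * (144 * F + 1)) with hη
  have η0 : 0 < η := by positivity
  have ηθ : 144 * F * η ≤ θ / 2 := by
    calc 144 * F * η ≤ (144 * F + 1) * η := by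
          refine mul_le_mul_of_nonneg_right (by linarith) η0.le
      _ = θ / 2 := by rw [hη]; field_simp
  clear_value η
  obtain ⟨δ, hδ0, hδ⟩ := exists_close_of_small d L η0
  refine ⟨max (L ^ 2 * V / δ) (2 * D * C2 + F * (2 * V + 64 * δ)),
    le_max_of_le_left (by positivity), fun y hy c => ?_⟩
  set ε2 := ∫ x in Q, eg y x ^ 2 with hε2
  have hε0 : 0 ≤ ε2 := integral_nonneg fun x => sq_nonneg _
  set m := ∫ x in Q, ‖grad y x - c‖ ^ 2 with hm
  have hm0 : 0 ≤ m := integral_nonneg fun x => sq_nonneg _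
  rcases lt_or_ge δ ε2 with hε | hε
  · refine ⟨0, ?_⟩
    have := setIntegral_mono_on (integrableOn_sq_norm_grad hy 0 fB measurableSet_ball)
      (integrableOn_const (C := (L : ℝ) ^ 2) fB) measurableSet_ball fun x _ => by
        rw [sub_zero]; exact pow_le_pow_left₀ (norm_nonneg _) (norm_grad_le hy x) 2
    rw [setIntegral_const, smul_eq_mul, mul_comm] at this
    calc _ ≤ (L : ℝ) ^ 2 * V := this.trans (by gcongr)
      _ = (L ^ 2 * V / δ) * δ := by field_simp
      _ ≤ max (L ^ 2 * V / δ) (2 * D * C2 + F * (2 * V + 64 * δ)) * ε2 :=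
          mul_le_mul (le_max_left _ _) hε.le hδ0.le (le_max_of_le_left (by positivity))
      _ ≤ _ := le_add_of_nonneg_right (by positivity)
  obtain ⟨c0, hc0⟩ := hδ y hy hε
  obtain ⟨c1, h1m, h1η⟩ : ∃ c1 : Fin d → Fin d → ℝ, ∫ x in Q, ‖grad y x - c1‖ ^ 2 ≤ m ∧
      ∫ x in Q, ‖grad y x - c1‖ ^ 2 ≤ η := by
    rcases le_total m η with h | h
    · exact ⟨c, le_rfl, h⟩
    · exact ⟨c0, hc0.trans h, hc0⟩
  obtain ⟨R, hR, hRc⟩ := exists_rotation_close hy c1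
  set J := ∫ x in Q, ‖grad y x - R‖ ^ 2 with hJ
  have hJ0 : 0 ≤ J := integral_nonneg fun x => sq_nonneg _
  set Γ := ∫ w in Q, (eg y w + ‖grad y w - R‖ ^ 2) with hΓ
  have hΓe : Γ = (∫ x in Q, eg y x) + J :=
    integral_add (integrableOn_eg hy fQ measurableSet_ball)
      (integrableOn_sq_norm_grad hy R fQ measurableSet_ball)
  have hJ2 : J ^ 2 ≤ 72 * η * m + 32 * δ * ε2 := by
    have hn : 0 ≤ ∫ x in Q, ‖grad y x - c1‖ ^ 2 := integral_nonneg fun x => sq_nonneg _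
    generalize (∫ x in Q, ‖grad y x - c1‖ ^ 2) = n at *
    have h1 : n ^ 2 ≤ η * m := by
      rw [sq]; exact mul_le_mul h1η h1m hn η0.le
    have h2 : ε2 ^ 2 ≤ δ * ε2 := by
      rw [sq]; exact mul_le_mul_of_nonneg_right hε hε0
    have h3 : J ^ 2 ≤ (6 * n + 4 * ε2) ^ 2 := pow_le_pow_left₀ hJ0 hRc 2
    nlinarith [sq_nonneg (6 * n - 4 * ε2)]
  have hΓ2 : Γ ^ 2 ≤ 2 * V * ε2 + 2 * (72 * η * m + 32 * δ * ε2) := by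
    have h1 := sq_integral_eg_le hy
    rw [hΓe]
    nlinarith [sq_nonneg ((∫ x in Q, eg y x) - J)]
  have hΓ0 : 0 ≤ Γ := integral_nonneg fun w => add_nonneg (eg_nonneg y w) (sq_nonneg _)
  set q : Fin d → Fin d → (Fin d → ℝ) → ℝ := fun i k => moll ψ (pd (y i) k) with hq
  have q1 : ∀ i k, ContDiff ℝ 1 (q i k) := fun i k => hψ.contDiff_moll (hy i) k 1
  have qL : ∀ i k x, |q i k x| ≤ L := fun i k x => hψ.abs_moll_le (abs_pd_le (hy i) k) x
  have qd : ∀ i k, ∀ x ∈ B, |q i k x - q i k 0| ≤ d * A * Γ := fun i k x hx => by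
    have hb : ∀ x ∈ B, ‖fderiv ℝ (q i k) x‖ ≤ d * A * Γ := fun x hx => by
      refine (norm_fderiv_le_sum_pd _ _).trans ?_
      have hx1 : ‖x‖ + t < 1 := by
        have := mem_ball_zero_iff.1 hx; linarith
      refine (Finset.sum_le_sum fun j _ => hA y hy R hR x hx1 i k j).trans (le_of_eq ?_)
      simp; ring
    have := (convex_ball (0 : Fin d → ℝ) (1 - κ)).norm_image_sub_le_of_norm_fderiv_le (𝕜 := ℝ)
      (f := q i k) (fun x _ => (q1 i k).differentiable (by norm_num) x) hb
      (Metric.mem_ball_self (by linarith)) hx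
    refine this.trans ?_
    have hx1 : ‖x - 0‖ ≤ 1 := by
      have := mem_ball_zero_iff.1 hx; rw [sub_zero]; linarith
    exact mul_le_of_le_one_right (by positivity) hx1
  have e2 : ∀ i k, ∫ x in B, (grad y x i k - q i k x) ^ 2 ≤ C2 * (t ^ 2 * m + ε2) := fun i k =>
    hC2 y hy c t ψ tκ hψ i k
  have i2 : ∀ i k, IntegrableOn (fun x => (grad y x i k - q i k x) ^ 2) B := fun i k => by
    refine integrableOn_of_bounded' (M := (L + L) ^ 2) fB measurableSet_ball
      (((measurable_pd (y i) k).sub (q1 i k).continuous.measurable).pow_const 2) fun x _ => ?_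
    rw [abs_pow]
    exact pow_le_pow_left₀ (abs_nonneg _)
      ((abs_sub _ _).trans (add_le_add (abs_pd_le (hy i) k x) (qL i k x))) 2
  have i5 : ∀ i k, IntegrableOn (fun x => 2 * (grad y x i k - q i k x) ^ 2
      + 2 * (d * A * Γ) ^ 2) B := fun i k =>
    ((i2 i k).const_mul 2).add (integrableOn_const fB)
  refine ⟨fun i k => q i k 0, ?_⟩
  calc ∫ x in B, ‖grad y x - fun i k => q i k 0‖ ^ 2
      ≤ ∫ x in B, ∑ i, ∑ k, (2 * (grad y x i k - q i k x) ^ 2 + 2 * (d * A * Γ) ^ 2) := by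
        refine setIntegral_mono_on (integrableOn_sq_norm_grad hy _ fB measurableSet_ball)
          (integrable_finsetSum _ fun i _ => integrable_finsetSum _ fun k _ => i5 i k)
          measurableSet_ball fun x hx => (sq_norm_le_sum _).trans ?_
        refine Finset.sum_le_sum fun i _ => Finset.sum_le_sum fun k _ => ?_
        simp only [Pi.sub_apply]
        have := pow_le_pow_left₀ (abs_nonneg _) (qd i k x hx) 2
        rw [sq_abs] at this
        nlinarith [sq_nonneg ((grad y x i k - q i k x) - (q i k x - q i k 0))]
    _ = ∑ i, ∑ k, (2 * (∫ x in B, (grad y x i k - q i k x) ^ 2)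
        + volume.real B * (2 * (d * A * Γ) ^ 2)) := by
        rw [integral_finsetSum _ fun i _ => integrable_finsetSum _ fun k _ => i5 i k]
        refine Finset.sum_congr rfl fun i _ => ?_
        rw [integral_finsetSum _ fun k _ => i5 i k]
        refine Finset.sum_congr rfl fun k _ => ?_
        rw [integral_add ((i2 i k).const_mul 2) (integrableOn_const fB), integral_const_mul,
          setIntegral_const, smul_eq_mul]
    _ ≤ ∑ i : Fin d, ∑ k : Fin d, (2 * (C2 * (t ^ 2 * m + ε2)) + V * (2 * (d * A * Γ) ^ 2)) := by
        gcongr with i _ k _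
        exact e2 i k
    _ = 2 * D * (C2 * (t ^ 2 * m + ε2)) + F * Γ ^ 2 := by
        simp [hD, hF]; ring
    _ ≤ 2 * D * (C2 * (t ^ 2 * m + ε2))
        + F * (2 * V * ε2 + 2 * (72 * η * m + 32 * δ * ε2)) := by gcongr
    _ = (2 * D * C2 + F * (2 * V + 64 * δ)) * ε2 + (2 * D * C2 * t ^ 2 + 144 * F * η) * m := by
        ring
    _ ≤ _ := by
        gcongr
        · exact le_max_right _ _
        · linarith

lemma sq_enorm_sub_le {V : Type*} [NormedAddCommGroup V] (a b c : V) :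
    ‖a - c‖ₑ ^ 2 ≤ 2 * ‖a - b‖ₑ ^ 2 + 2 * ‖b - c‖ₑ ^ 2 := by
  have h := sq_norm_sub_le a b c
  simp only [← ofReal_norm, ← ENNReal.ofReal_pow (norm_nonneg _)]
  rw [← ENNReal.ofReal_ofNat 2, ← ENNReal.ofReal_mul (by norm_num),
    ← ENNReal.ofReal_mul (by norm_num), ← ENNReal.ofReal_add (by positivity) (by positivity)]
  exact ENNReal.ofReal_le_ofReal h

lemma volume_ball_pi {d : ℕ} (a : Fin d → ℝ) {r : ℝ} (hr : 0 < r) :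
    volume (Metric.ball a r) = ENNReal.ofReal ((2 * r) ^ d) := by
  rw [Real.volume_pi_ball a hr, Fintype.card_fin]

/-- The part of a cube of radius `r` close to a face of the unit cube has small volume. -/
lemma volume_slab_le {d : ℕ} (hd : 0 < d) (z : Fin d → ℝ) {r s : ℝ} (hr : 0 < r) (hs : 0 ≤ s) :
    volume {x : Fin d → ℝ | x ∈ Metric.ball z r ∧ x ∈ Metric.ball 0 1 ∧ 1 - ‖x‖ ≤ s}
      ≤ ENNReal.ofReal (2 * d * (s * (2 * r) ^ (d - 1))) := by
  have : Nonempty (Fin d) := ⟨⟨0, hd⟩⟩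
  set S : Fin d → Set (Fin d → ℝ) := fun i =>
    univ.pi (Function.update (fun j => Icc (z j - r) (z j + r)) i (Icc (1 - s) 1)) with hS
  set T : Fin d → Set (Fin d → ℝ) := fun i =>
    univ.pi (Function.update (fun j => Icc (z j - r) (z j + r)) i (Icc (-1) (-1 + s))) with hT
  have vol : ∀ (i : Fin d) (a b : ℝ), b - a = s →
      volume (univ.pi (Function.update (fun j => Icc (z j - r) (z j + r)) i (Icc a b)))
        = ENNReal.ofReal (s * (2 * r) ^ (d - 1)) := fun i a b hab => by
    rw [volume_pi_pi, ← Finset.mul_prod_erase _ _ (Finset.mem_univ i)]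
    rw [Finset.prod_congr rfl (g := fun _ => ENNReal.ofReal (2 * r)) fun j hj => by
      rw [Function.update_of_ne (Finset.ne_of_mem_erase hj), Real.volume_Icc]; congr 1; ring]
    rw [Function.update_self, Real.volume_Icc, hab, Finset.prod_const,
      Finset.card_erase_of_mem (Finset.mem_univ i), Finset.card_univ, Fintype.card_fin,
      ENNReal.ofReal_mul hs, ENNReal.ofReal_pow (by positivity)]
  have sub : {x : Fin d → ℝ | x ∈ Metric.ball z r ∧ x ∈ Metric.ball 0 1 ∧ 1 - ‖x‖ ≤ s}
      ⊆ ⋃ i, (S i ∪ T i) := by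
    rintro x ⟨h1, h2, h3⟩
    have h4 : ∃ i, ‖x‖ = |x i| := by
      obtain ⟨i, hi⟩ := Finite.exists_max fun i => ‖x i‖
      exact ⟨i, le_antisymm ((pi_norm_le_iff_of_nonneg (norm_nonneg _)).2 hi) (norm_le_pi_norm x i)⟩
    obtain ⟨i, hi⟩ := h4
    have h5 : ‖x‖ < 1 := mem_ball_zero_iff.1 h2
    have h6 : ∀ j, x j ∈ Icc (z j - r) (z j + r) := fun j => by
      have := (dist_le_pi_dist x z j).trans_lt (Metric.mem_ball.1 h1)
      rw [Real.dist_eq, abs_lt] at this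
      constructor <;> linarith
    rw [hi] at h3 h5
    rw [abs_lt] at h5
    refine mem_iUnion.2 ⟨i, ?_⟩
    rcases le_abs.1 (show 1 - s ≤ |x i| by linarith) with h | h
    · refine Or.inl fun j _ => ?_
      rcases eq_or_ne j i with rfl | hj
      · rw [Function.update_self]; exact ⟨h, h5.2.le⟩
      · rw [Function.update_of_ne hj]; exact h6 j
    · refine Or.inr fun j _ => ?_
      rcases eq_or_ne j i with rfl | hj
      · rw [Function.update_self]; exact ⟨h5.1.le, by linarith⟩
      · rw [Function.update_of_ne hj]; exact h6 j
  calc _ ≤ volume (⋃ i, (S i ∪ T i)) := measure_mono sub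
    _ ≤ ∑ i, volume (S i ∪ T i) := measure_iUnion_fintype_le _ _
    _ ≤ ∑ i : Fin d, (ENNReal.ofReal (s * (2 * r) ^ (d - 1))
          + ENNReal.ofReal (s * (2 * r) ^ (d - 1))) := by
        refine Finset.sum_le_sum fun i _ => (measure_union_le _ _).trans ?_
        rw [hS, hT]
        exact add_le_add (vol i _ _ (by ring)).le (vol i _ _ (by ring)).le
    _ = _ := by
        rw [Finset.sum_const, Finset.card_univ, Fintype.card_fin,
          ← ENNReal.ofReal_add (by positivity) (by positivity), ← ENNReal.ofReal_nsmul]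
        congr 1
        rw [nsmul_eq_mul]; ring

/-- Geometry of the reflected cubes: the radial contraction of a point near the boundary. -/
lemma contraction_geometry {d : ℕ} {N : ℝ} (hN : 2 ≤ N) {x : Fin d → ℝ} {a : ℝ} (ha0 : 0 < a)
    (ha : a * (4 * N) ≤ 1) (hx : ‖x‖ = 1 - a) :
    ‖x - (1 - N * a) • x‖ = N * a * (1 - a) ∧ ‖(1 - N * a) • x‖ = (1 - N * a) * (1 - a) := by
  constructor
  · rw [show x - (1 - N * a) • x = (N * a) • x by module, norm_smul, hx,
        Real.norm_of_nonneg (by positivity)]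
  · rw [norm_smul, hx, Real.norm_of_nonneg (by nlinarith)]

/-- Sum over all cubes well inside the unit cube of the local oscillations. -/
lemma lintegral_cubes_le {d : ℕ} {κ : ℝ} (hκ : 0 < κ) (hκ1 : κ < 1) {h : (Fin d → ℝ) → ENNReal}
    (hh : Measurable h) :
    ∫⁻ p in Metric.ball 0 1, ENNReal.ofReal (((1 - ‖p‖) ^ d)⁻¹) *
        ∫⁻ x in Metric.ball p ((1 - κ) * (1 - ‖p‖)), h x
      ≤ ENNReal.ofReal ((4 / κ) ^ d) * ∫⁻ x in Metric.ball (0 : Fin d → ℝ) 1, h x := by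
  set Q := Metric.ball (0 : Fin d → ℝ) 1 with hQ
  have mS : MeasurableSet {q : (Fin d → ℝ) × (Fin d → ℝ) | dist q.2 q.1 < (1 - κ) * (1 - ‖q.1‖)} :=
    measurableSet_lt (by fun_prop) (by fun_prop)
  set Ψ : (Fin d → ℝ) → (Fin d → ℝ) → ENNReal := fun p x =>
    ENNReal.ofReal (((1 - ‖p‖) ^ d)⁻¹) *
      {q : (Fin d → ℝ) × (Fin d → ℝ) | dist q.2 q.1 < (1 - κ) * (1 - ‖q.1‖)}.indicator
        (fun q => h q.2) (p, x) with hΨ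
  have mΨ : Measurable (Function.uncurry Ψ) := by
    refine Measurable.mul (by fun_prop) ?_
    exact (hh.comp measurable_snd).indicator mS
  have e1 : ∀ p, ENNReal.ofReal (((1 - ‖p‖) ^ d)⁻¹) *
      ∫⁻ x in Metric.ball p ((1 - κ) * (1 - ‖p‖)), h x = ∫⁻ x, Ψ p x := fun p => by
    rw [← lintegral_indicator measurableSet_ball, ← lintegral_const_mul' _ _ ENNReal.ofReal_ne_top]
    rfl
  simp_rw [e1]
  rw [lintegral_lintegral_swap mΨ.aemeasurable, ← lintegral_indicator measurableSet_ball,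
    ← lintegral_const_mul _ (hh.indicator measurableSet_ball)]
  refine lintegral_mono fun x => ?_
  have key : ∀ p ∈ Q, dist x p < (1 - κ) * (1 - ‖p‖) →
      κ * (1 - ‖p‖) < 1 - ‖x‖ ∧ 1 - ‖x‖ < 2 * (1 - ‖p‖) ∧ 0 < 1 - ‖p‖ := fun p hp hx => by
    have h1 : ‖p‖ < 1 := mem_ball_zero_iff.1 hp
    have h2 : ‖x‖ ≤ ‖p‖ + dist x p := by
      rw [dist_eq_norm]; have := norm_add_le p (x - p); rwa [add_sub_cancel] at this
    have h3 : ‖p‖ ≤ ‖x‖ + dist x p := by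
      rw [dist_comm, dist_eq_norm]; have := norm_add_le x (p - x); rwa [add_sub_cancel] at this
    refine ⟨by linarith, by nlinarith, by linarith⟩
  by_cases hxQ : x ∈ Q
  · have hx1 : 0 < 1 - ‖x‖ := by have := mem_ball_zero_iff.1 hxQ; linarith
    rw [indicator_of_mem hxQ]
    calc ∫⁻ p in Q, Ψ p x ≤ ∫⁻ p in Q, (Metric.ball x ((1 - ‖x‖) / κ)).indicator
          (fun _ => ENNReal.ofReal (((1 - ‖x‖) / 2) ^ d)⁻¹ * h x) p := by
          refine setLIntegral_mono' measurableSet_ball fun p hp => ?_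
          simp only [hΨ, indicator_apply, mem_ofPred_eq]
          by_cases h1 : dist x p < (1 - κ) * (1 - ‖p‖)
          · obtain ⟨k1, k2, k3⟩ := key p hp h1
            have h2 : p ∈ Metric.ball x ((1 - ‖x‖) / κ) := by
              rw [Metric.mem_ball, dist_comm, lt_div_iff₀ hκ]
              nlinarith
            rw [if_pos h1, indicator_of_mem h2]
            gcongr
            linarith
          · rw [if_neg h1, mul_zero]; exact zero_le
      _ ≤ ∫⁻ p, (Metric.ball x ((1 - ‖x‖) / κ)).indicator
          (fun _ => ENNReal.ofReal (((1 - ‖x‖) / 2) ^ d)⁻¹ * h x) p :=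
          setLIntegral_le_lintegral _ _
      _ = ENNReal.ofReal ((4 / κ) ^ d) * h x := by
          rw [lintegral_indicator measurableSet_ball, setLIntegral_const,
            volume_ball_pi x (by positivity), mul_right_comm,
            ← ENNReal.ofReal_mul (by positivity)]
          congr 2
          rw [← inv_pow, ← mul_pow]
          congr 1
          field_simp; norm_num
  · rw [indicator_of_notMem hxQ, mul_zero, nonpos_iff_eq_zero]
    refine (lintegral_congr_ae ?_).trans lintegral_zero
    refine (ae_restrict_iff' measurableSet_ball).2 (Filter.Eventually.of_forall fun p hp => ?_)
    simp only [hΨ, indicator_apply, mem_ofPred_eq]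
    split_ifs with h1
    · obtain ⟨k1, k2, k3⟩ := key p hp h1
      exact absurd (mem_ball_zero_iff.2 (by nlinarith)) hxQ
    · simp

/-- Oscillation between a point near the boundary and the reflected cubes. -/
lemma exists_lintegral_layer_le (d : ℕ) {N κ : ℝ} (hN : 2 ≤ N) (hκ0 : 0 < κ)
    (hκ : κ * (8 * (N + 1)) = 1) :
    ∃ C : NNReal, ∀ {V : Type} [NormedAddCommGroup V] [MeasurableSpace V] [BorelSpace V]
      [SecondCountableTopology V] (f : (Fin d → ℝ) → V) (h : (Fin d → ℝ) → ENNReal),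
      Measurable f → Measurable h →
      (∀ p ρ, 0 < ρ → Metric.ball p ρ ⊆ Metric.ball 0 1 →
        ∫⁻ x in Metric.ball p ((1 - κ) * ρ), ∫⁻ z in Metric.ball p ((1 - κ) * ρ), ‖f x - f z‖ₑ ^ 2
          ≤ volume (Metric.ball p ρ) * ∫⁻ x in Metric.ball p ρ, h x) →
      ∫⁻ x in {x | x ∈ Metric.ball 0 1 ∧ (1 - ‖x‖) * (4 * N) ≤ 1},
          ENNReal.ofReal (((N * (1 - ‖x‖)) ^ d)⁻¹) *
            ∫⁻ z in Metric.ball ((1 - N * (1 - ‖x‖)) • x) (N * (1 - ‖x‖) / 2), ‖f x - f z‖ₑ ^ 2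
        ≤ C * ∫⁻ x in Metric.ball 0 1, h x := by
  have hκ1 : κ < 1 := by nlinarith
  set C1 : ℝ := 2 ^ d * (N + 2) ^ (2 * d) / N ^ d with hC1
  have hC10 : 0 ≤ C1 := by positivity
  refine ⟨Real.toNNReal (C1 * (2 ^ d * (4 / κ) ^ d)), fun f h hf hh H => ?_⟩
  set Q := Metric.ball (0 : Fin d → ℝ) 1 with hQ
  set W := {x : Fin d → ℝ | x ∈ Metric.ball 0 1 ∧ (1 - ‖x‖) * (4 * N) ≤ 1} with hW
  have mW : MeasurableSet W := by
    have : MeasurableSet {x : Fin d → ℝ | (1 - ‖x‖) * (4 * N) ≤ 1} :=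
      measurableSet_le (by fun_prop) (by fun_prop)
    exact measurableSet_ball.inter this
  set R : (Fin d → ℝ) → Set (Fin d → ℝ) := fun p =>
    Metric.ball p ((1 - κ) * ((1 - κ) * (1 - ‖p‖))) with hR
  set w : (Fin d → ℝ) → ENNReal := fun p => ENNReal.ofReal (((1 - ‖p‖) ^ (2 * d))⁻¹) with hw
  have mG : Measurable fun q : (Fin d → ℝ) × (Fin d → ℝ) => ‖f q.1 - f q.2‖ₑ ^ 2 :=
    (((hf.comp measurable_fst).sub (hf.comp measurable_snd)).enorm).pow_const 2
  set S2 := {q : (Fin d → ℝ) × (Fin d → ℝ) | dist q.1 q.2 < (1 - κ) * ((1 - κ) * (1 - ‖q.2‖))}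
    with hS2
  have mS2 : MeasurableSet S2 := measurableSet_lt (by fun_prop) (by fun_prop)
  have mI : Measurable fun q : (Fin d → ℝ) × (Fin d → ℝ) =>
      ∫⁻ z in R q.2, ‖f q.1 - f z‖ₑ ^ 2 := by
    have : ∀ q : (Fin d → ℝ) × (Fin d → ℝ), ∫⁻ z in R q.2, ‖f q.1 - f z‖ₑ ^ 2 =
        ∫⁻ z, (((fun t : ((Fin d → ℝ) × (Fin d → ℝ)) × (Fin d → ℝ) => (t.2,
            t.1.2)) ⁻¹' S2).indicator
          (fun t => ‖f t.1.1 - f t.2‖ₑ ^ 2)) (q, z) := fun q => by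
      rw [← lintegral_indicator measurableSet_ball]; rfl
    simp_rw [this]
    refine Measurable.lintegral_prod_right' (f := fun t => _) (Measurable.indicator ?_ ?_)
    · exact mG.comp (f := fun t : ((Fin d → ℝ) × (Fin d → ℝ)) × (Fin d → ℝ) => (t.1.1, t.2))
        (by fun_prop)
    · exact mS2.preimage (by fun_prop)
  set Φ : (Fin d → ℝ) → (Fin d → ℝ) → ENNReal := fun x p =>
    w p * S2.indicator (fun q => ∫⁻ z in R q.2, ‖f q.1 - f z‖ₑ ^ 2) (x, p) with hΦ
  have mΦ : Measurable (Function.uncurry Φ) := by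
    refine Measurable.mul (by fun_prop) (mI.indicator mS2)
  have step : ∀ x ∈ W, ENNReal.ofReal (((N * (1 - ‖x‖)) ^ d)⁻¹) *
      ∫⁻ z in Metric.ball ((1 - N * (1 - ‖x‖)) • x) (N * (1 - ‖x‖) / 2), ‖f x - f z‖ₑ ^ 2
      ≤ ENNReal.ofReal C1 * ∫⁻ p in Q, Φ x p := fun x hx => by
    have hx1 : ‖x‖ < 1 := mem_ball_zero_iff.1 hx.1
    obtain ⟨a, ha⟩ : ∃ a, a = 1 - ‖x‖ := ⟨_, rfl⟩
    have ha0 : 0 < a := by linarith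
    have ha1 : a * (4 * N) ≤ 1 := ha ▸ hx.2
    obtain ⟨g1, g2⟩ := contraction_geometry hN ha0 ha1 (x := x) (by linarith)
    rw [← ha]
    set b := (1 - N * a) • x with hb
    set B := Metric.ball b (N * a / 2) with hB
    have ha4 : a ≤ 1 / 8 := by nlinarith
    have hp : ∀ p ∈ Metric.ball b (a / 4), p ∈ Q ∧ x ∈ R p ∧ B ⊆ R p ∧ 0 < 1 - ‖p‖ ∧
        1 - ‖p‖ ≤ (N + 2) * a := fun p hp => by
      have hp1 : ‖p - b‖ < a / 4 := by rwa [← dist_eq_norm]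
      have h1 : ‖p‖ ≤ ‖b‖ + ‖p - b‖ := by
        have := norm_add_le b (p - b); rwa [add_sub_cancel] at this
      have h2 : ‖b‖ ≤ ‖p‖ + ‖p - b‖ := by
        rw [norm_sub_rev]; have := norm_add_le p (b - p); rwa [add_sub_cancel] at this
      rw [g2] at h1 h2
      have lo : 3 / 4 * a + N * a * (1 - a) < 1 - ‖p‖ := by nlinarith
      have hi : 1 - ‖p‖ ≤ (N + 2) * a := by nlinarith [mul_pos ha0 ha0]
      have hNa : 7 / 8 * (N * a) ≤ N * a * (1 - a) := by
        have : 0 < N * a := by positivity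
        nlinarith
      have pos : 0 < 1 - ‖p‖ := by nlinarith
      have lo2 : a / 4 + N * a * (1 - a) < (1 - κ) * ((1 - κ) * (1 - ‖p‖)) := by
        have e1 : κ * (1 - ‖p‖) ≤ κ * ((N + 2) * a) := mul_le_mul_of_nonneg_left hi hκ0.le
        have e2 : κ * ((N + 2) * a) ≤ a * (1 / 4) := by
          have : κ * (N + 2) ≤ 1 / 4 := by nlinarith
          nlinarith
        nlinarith [mul_pos (mul_pos hκ0 hκ0) pos]
      refine ⟨mem_ball_zero_iff.2 (by linarith), ?_, ?_, pos, hi⟩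
      · refine Metric.mem_ball.2 ?_
        have : dist x p ≤ ‖x - b‖ + ‖p - b‖ := by
          rw [dist_eq_norm, norm_sub_rev p b]; exact norm_sub_le_norm_sub_add_norm_sub x b p
        rw [g1] at this
        linarith
      · refine Metric.ball_subset_ball' ?_
        rw [dist_comm, dist_eq_norm]
        nlinarith
    calc _ = ENNReal.ofReal C1 * ∫⁻ p in Metric.ball b (a / 4),
          (ENNReal.ofReal ((((N + 2) * a) ^ (2 * d))⁻¹) * ∫⁻ z in B, ‖f x - f z‖ₑ ^ 2) := by
          rw [setLIntegral_const, volume_ball_pi b (by positivity), mul_right_comm,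
            ← ENNReal.ofReal_mul (by positivity), ← mul_assoc,
            ← ENNReal.ofReal_mul (by positivity)]
          congr 2
          rw [hC1]
          simp only [mul_pow, div_pow, two_mul d, pow_add]
          field_simp
          rw [← pow_mul, mul_comm d, pow_mul]; norm_num
      _ ≤ ENNReal.ofReal C1 * ∫⁻ p in Metric.ball b (a / 4), Φ x p := by
          refine mul_le_mul' le_rfl ?_
          refine setLIntegral_mono' measurableSet_ball fun p hpb => ?_
          obtain ⟨k1, k2, k3, k4, k5⟩ := hp p hpb
          simp only [hΦ]
          rw [indicator_of_mem (show (x, p) ∈ S2 from k2)]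
          refine mul_le_mul' ?_ ?_
          · refine ENNReal.ofReal_le_ofReal ?_
            gcongr
          · exact lintegral_mono_set k3
      _ ≤ _ := by
          refine mul_le_mul' le_rfl ?_
          exact lintegral_mono_set fun p hpb => (hp p hpb).1
  calc _ ≤ ∫⁻ x in W, ENNReal.ofReal C1 * ∫⁻ p in Q, Φ x p := setLIntegral_mono' mW step
    _ ≤ ∫⁻ x, ENNReal.ofReal C1 * ∫⁻ p in Q, Φ x p := setLIntegral_le_lintegral _ _
    _ = ENNReal.ofReal C1 * ∫⁻ p in Q, ∫⁻ x, Φ x p := by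
        rw [lintegral_const_mul' _ _ ENNReal.ofReal_ne_top,
            lintegral_lintegral_swap mΦ.aemeasurable]
    _ ≤ ENNReal.ofReal C1 * ∫⁻ p in Q, ENNReal.ofReal (2 ^ d) *
          (ENNReal.ofReal (((1 - ‖p‖) ^ d)⁻¹) *
            ∫⁻ x in Metric.ball p ((1 - κ) * (1 - ‖p‖)), h x) := by
        refine mul_le_mul' le_rfl ?_
        refine setLIntegral_mono' measurableSet_ball fun p hp => ?_
        have hp1 : 0 < 1 - ‖p‖ := by have := mem_ball_zero_iff.1 hp; linarith
        have hP := H p ((1 - κ) * (1 - ‖p‖)) (mul_pos (by linarith) hp1)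
          (Metric.ball_subset_ball' (by rw [dist_zero_right]; nlinarith))
        calc ∫⁻ x, Φ x p = w p * ∫⁻ x in R p, ∫⁻ z in R p, ‖f x - f z‖ₑ ^ 2 := by
              rw [hΦ, lintegral_const_mul' _ _ ENNReal.ofReal_ne_top,
                ← lintegral_indicator measurableSet_ball]
              rfl
          _ ≤ w p * (volume (Metric.ball p ((1 - κ) * (1 - ‖p‖))) *
                ∫⁻ x in Metric.ball p ((1 - κ) * (1 - ‖p‖)), h x) := by gcongr
          _ ≤ _ := by
              rw [volume_ball_pi p (mul_pos (by linarith) hp1), hw, ← mul_assoc, ← mul_assoc,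
                ← ENNReal.ofReal_mul (by positivity), ← mul_assoc,
                ← ENNReal.ofReal_mul (by positivity)]
              refine mul_le_mul' ?_ le_rfl
              refine ENNReal.ofReal_le_ofReal ?_
              rw [mul_pow, mul_pow, two_mul d, pow_add]
              field_simp
              exact pow_le_one₀ (by linarith) (by linarith)
    _ ≤ ENNReal.ofReal C1 * (ENNReal.ofReal (2 ^ d) * (ENNReal.ofReal ((4 / κ) ^ d) *
          ∫⁻ x in Q, h x)) := by
        rw [lintegral_const_mul' _ _ ENNReal.ofReal_ne_top]
        gcongr
        exact lintegral_cubes_le hκ0 hκ1 hh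
    _ = _ := by
        rw [← mul_assoc, ← mul_assoc, ← ENNReal.ofReal_mul hC10,
            ← ENNReal.ofReal_mul (by positivity),
          ENNReal.ofReal, mul_assoc]

/-- The reflected cubes overlap little when the reflection is strong. -/
lemma lintegral_layer_weight_le {d : ℕ} (hd : 0 < d) {N : ℝ} (hN : N = 8 * d * 24 ^ d)
    {g : (Fin d → ℝ) → ENNReal} (hg : Measurable g) :
    ∫⁻ x in {x | x ∈ Metric.ball 0 1 ∧ (1 - ‖x‖) * (4 * N) ≤ 1},
          ENNReal.ofReal (((N * (1 - ‖x‖)) ^ d)⁻¹) *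
            ∫⁻ z in Metric.ball ((1 - N * (1 - ‖x‖)) • x) (N * (1 - ‖x‖) / 2), g z
        ≤ ENNReal.ofReal (1 / 4) * ∫⁻ x in Metric.ball (0 : Fin d → ℝ) 1, g x := by
  have hd1 : (1 : ℝ) ≤ d := by exact_mod_cast hd
  have hN2 : 2 ≤ N := by
    have : (1 : ℝ) ≤ 24 ^ d := one_le_pow₀ (by norm_num)
    rw [hN]; nlinarith
  set Q := Metric.ball (0 : Fin d → ℝ) 1 with hQ
  set W := {x : Fin d → ℝ | x ∈ Q ∧ (1 - ‖x‖) * (4 * N) ≤ 1} with hW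
  have mW : MeasurableSet W := by
    have : MeasurableSet {x : Fin d → ℝ | (1 - ‖x‖) * (4 * N) ≤ 1} :=
      measurableSet_le (by fun_prop) (by fun_prop)
    exact measurableSet_ball.inter this
  set S := {q : (Fin d → ℝ) × (Fin d → ℝ) |
    dist q.2 ((1 - N * (1 - ‖q.1‖)) • q.1) < N * (1 - ‖q.1‖) / 2} with hS
  have mS : MeasurableSet S := measurableSet_lt (by fun_prop) (by fun_prop)
  set Ψ : (Fin d → ℝ) → (Fin d → ℝ) → ENNReal := fun x z =>
    ENNReal.ofReal (((N * (1 - ‖x‖)) ^ d)⁻¹) * S.indicator (fun q => g q.2) (x, z) with hΨ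
  have mΨ : Measurable (Function.uncurry Ψ) := by
    refine Measurable.mul (by fun_prop) ?_
    exact (hg.comp measurable_snd).indicator mS
  have e1 : ∀ x, ENNReal.ofReal (((N * (1 - ‖x‖)) ^ d)⁻¹) *
      ∫⁻ z in Metric.ball ((1 - N * (1 - ‖x‖)) • x) (N * (1 - ‖x‖) / 2), g z = ∫⁻ z, Ψ x z :=
    fun x => by
      rw [← lintegral_indicator measurableSet_ball, ← lintegral_const_mul' _ _
          ENNReal.ofReal_ne_top]
      rfl
  simp_rw [e1]
  rw [lintegral_lintegral_swap mΨ.aemeasurable, ← lintegral_indicator measurableSet_ball,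
    ← lintegral_const_mul _ (hg.indicator measurableSet_ball)]
  refine lintegral_mono fun z => ?_
  have key : ∀ x ∈ W, dist z ((1 - N * (1 - ‖x‖)) • x) < N * (1 - ‖x‖) / 2 →
      N * (1 - ‖x‖) ≤ 4 * (1 - ‖z‖) ∧ 1 - ‖z‖ ≤ 2 * (N * (1 - ‖x‖)) ∧ 0 < 1 - ‖z‖ ∧
        dist x z < 6 * (1 - ‖z‖) := fun x hx hz => by
    have hx1 : ‖x‖ < 1 := mem_ball_zero_iff.1 hx.1
    obtain ⟨a, ha⟩ : ∃ a, a = 1 - ‖x‖ := ⟨_, rfl⟩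
    have ha0 : 0 < a := by linarith
    have ha1 : a * (4 * N) ≤ 1 := ha ▸ hx.2
    obtain ⟨g1, g2⟩ := contraction_geometry hN2 ha0 ha1 (x := x) (by linarith)
    rw [← ha] at hz ⊢
    set b := (1 - N * a) • x with hb
    have ha4 : a ≤ 1 / 8 := by nlinarith
    rw [dist_eq_norm] at hz
    have h1 : ‖z‖ ≤ ‖b‖ + ‖z - b‖ := by
      have := norm_add_le b (z - b); rwa [add_sub_cancel] at this
    have h2 : ‖b‖ ≤ ‖z‖ + ‖z - b‖ := by
      rw [norm_sub_rev]; have := norm_add_le z (b - z); rwa [add_sub_cancel] at this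
    rw [g2] at h1 h2
    have hNa0 : 0 < N * a := by positivity
    have hNa : 7 / 8 * (N * a) ≤ N * a * (1 - a) := by nlinarith
    have hNa1 : N * a * (1 - a) ≤ N * a := by nlinarith
    have ha2 : 2 * a ≤ N * a := by nlinarith
    have h3 : N * a / 4 < 1 - ‖z‖ := by linarith
    refine ⟨by linarith, by linarith, by linarith, ?_⟩
    have : dist x z ≤ ‖x - b‖ + ‖z - b‖ := by
      rw [dist_eq_norm, norm_sub_rev z b]; exact norm_sub_le_norm_sub_add_norm_sub x b z
    rw [g1] at this
    linarith
  by_cases hzQ : z ∈ Q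
  · rw [indicator_of_mem hzQ]
    have hz0 : 0 < 1 - ‖z‖ := by have := mem_ball_zero_iff.1 hzQ; linarith
    obtain ⟨D, hD⟩ : ∃ D, D = 1 - ‖z‖ := ⟨_, rfl⟩
    have hD0 : 0 < D := hD ▸ hz0
    set T := {x : Fin d → ℝ | x ∈ Metric.ball z (6 * D) ∧ x ∈ Q ∧ 1 - ‖x‖ ≤ 4 * D / N} with hT
    have mT : MeasurableSet T := by
      have : MeasurableSet {x : Fin d → ℝ | 1 - ‖x‖ ≤ 4 * D / N} :=
        measurableSet_le (by fun_prop) (by fun_prop)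
      exact measurableSet_ball.inter (measurableSet_ball.inter this)
    calc ∫⁻ x in W, Ψ x z ≤ ∫⁻ x in W, T.indicator
          (fun _ => ENNReal.ofReal ((D / 2) ^ d)⁻¹ * g z) x := by
          refine setLIntegral_mono' mW fun x hx => ?_
          simp only [hΨ, indicator_apply, hS, mem_ofPred_eq]
          by_cases h1 : dist z ((1 - N * (1 - ‖x‖)) • x) < N * (1 - ‖x‖) / 2
          · obtain ⟨k1, k2, k3, k4⟩ := key x hx h1
            rw [← hD] at k1 k2 k3 k4
            have h2 : x ∈ T := ⟨k4, hx.1, by rw [le_div_iff₀ (by linarith)]; linarith⟩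
            rw [if_pos h1, indicator_of_mem h2]
            gcongr
            linarith
          · rw [if_neg h1, mul_zero]; exact zero_le
      _ ≤ ∫⁻ x, T.indicator (fun _ => ENNReal.ofReal ((D / 2) ^ d)⁻¹ * g z) x :=
          setLIntegral_le_lintegral _ _
      _ = ENNReal.ofReal ((D / 2) ^ d)⁻¹ * g z * volume T := by
          rw [lintegral_indicator mT, setLIntegral_const]
      _ ≤ ENNReal.ofReal ((D / 2) ^ d)⁻¹ * g z *
          ENNReal.ofReal (2 * d * (4 * D / N * (2 * (6 * D)) ^ (d - 1))) := by
          gcongr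
          exact volume_slab_le hd z (by positivity) (by positivity)
      _ ≤ ENNReal.ofReal (1 / 4) * g z := by
          rw [mul_right_comm, ← ENNReal.ofReal_mul (by positivity)]
          refine mul_le_mul' (ENNReal.ofReal_le_ofReal ?_) le_rfl
          obtain ⟨m, rfl⟩ : ∃ m, d = m + 1 := ⟨d - 1, by omega⟩
          rw [hN, Nat.add_sub_cancel, show 2 * (6 * D) = 24 * (D / 2) by ring, mul_pow,
            pow_succ (D / 2), pow_succ (24 : ℝ)]
          have : (0 : ℝ) < ((m + 1 : ℕ) : ℝ) := by positivity
          field_simp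
          norm_num
  · rw [indicator_of_notMem hzQ, mul_zero, nonpos_iff_eq_zero]
    refine (lintegral_congr_ae ?_).trans lintegral_zero
    refine (ae_restrict_iff' mW).2 (Filter.Eventually.of_forall fun x hx => ?_)
    simp only [hΨ, indicator_apply, hS, mem_ofPred_eq]
    split_ifs with h1
    · obtain ⟨k1, k2, k3, k4⟩ := key x hx h1
      exact absurd (mem_ball_zero_iff.2 (by linarith)) hzQ
    · simp

/-- Local oscillation bounds on all interior cubes give a global bound on the unit cube. -/
lemma exists_oscillation_le {d : ℕ} (hd : 0 < d) : ∃ κ : ℝ, 0 < κ ∧ κ < 1 ∧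
    ∃ C : NNReal, ∀ {V : Type} [NormedAddCommGroup V] [MeasurableSpace V] [BorelSpace V]
      [SecondCountableTopology V] (f : (Fin d → ℝ) → V) (h : (Fin d → ℝ) → ENNReal),
      Measurable f → Measurable h →
      (∀ p ρ, 0 < ρ → Metric.ball p ρ ⊆ Metric.ball 0 1 →
        ∫⁻ x in Metric.ball p ((1 - κ) * ρ), ∫⁻ z in Metric.ball p ((1 - κ) * ρ), ‖f x - f z‖ₑ ^ 2
          ≤ volume (Metric.ball p ρ) * ∫⁻ x in Metric.ball p ρ, h x) →
      (∀ c, ∫⁻ x in Metric.ball 0 1, ‖f x - c‖ₑ ^ 2 ≠ ⊤) →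
      ∃ c, ∫⁻ x in Metric.ball 0 1, ‖f x - c‖ₑ ^ 2 ≤ C * ∫⁻ x in Metric.ball 0 1, h x := by
  set N : ℝ := 8 * d * 24 ^ d with hN
  have hd1 : (1 : ℝ) ≤ d := by exact_mod_cast hd
  have hN2 : 2 ≤ N := by
    have : (1 : ℝ) ≤ 24 ^ d := one_le_pow₀ (by norm_num)
    rw [hN]; nlinarith
  set κ := 1 / (8 * (N + 1)) with hκ
  have hκ0 : 0 < κ := by positivity
  have hκe : κ * (8 * (N + 1)) = 1 := by rw [hκ]; field_simp
  have hκ1 : κ ≤ 1 / 2 := by nlinarith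
  obtain ⟨C, hC⟩ := exists_lintegral_layer_le d hN2 hκ0 hκe
  refine ⟨κ, hκ0, by linarith, 2 * (2 ^ d + 2 * C), fun {V} _ _ _ _ f h hf hh H hfin => ?_⟩
  have hCf := hC f h hf hh H
  set Q := Metric.ball (0 : Fin d → ℝ) 1 with hQ
  set W := {x : Fin d → ℝ | x ∈ Q ∧ (1 - ‖x‖) * (4 * N) ≤ 1} with hW
  have mW : MeasurableSet W := by
    have : MeasurableSet {x : Fin d → ℝ | (1 - ‖x‖) * (4 * N) ≤ 1} :=
      measurableSet_le (by fun_prop) (by fun_prop)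
    exact measurableSet_ball.inter this
  set B := Metric.ball (0 : Fin d → ℝ) ((1 - κ) * 1) with hB
  have hBpos : 0 < (1 - κ) * 1 := by linarith
  have mG : Measurable fun q : (Fin d → ℝ) × (Fin d → ℝ) => ‖f q.1 - f q.2‖ₑ ^ 2 :=
    (((hf.comp measurable_fst).sub (hf.comp measurable_snd)).enorm).pow_const 2
  have mc : ∀ c : V, Measurable fun z => ‖f z - c‖ₑ ^ 2 := fun c =>
    ((hf.sub_const c).enorm).pow_const 2
  have h_int : ∃ c, ∫⁻ x in B, ‖f x - c‖ₑ ^ 2 ≤ 2 ^ d * ∫⁻ x in Q, h x := by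
    obtain ⟨z, -, hz⟩ := exists_le_setLAverage (μ := volume) (s := B)
      (f := fun z => ∫⁻ x in B, ‖f x - f z‖ₑ ^ 2)
      (Metric.measure_ball_pos volume _ hBpos).ne' measure_ball_lt_top.ne
      (Measurable.aemeasurable (mG.lintegral_prod_left' (f := fun q => ‖f q.1 - f q.2‖ₑ ^ 2)))
    refine ⟨f z, hz.trans ?_⟩
    rw [setLAverage_eq, lintegral_lintegral_swap (by exact (mG.comp measurable_swap).aemeasurable)]
    refine ENNReal.div_le_of_le_mul ((H 0 1 one_pos le_rfl).trans ?_)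
    rw [mul_right_comm]
    refine mul_le_mul' ?_ le_rfl
    rw [volume_ball_pi _ one_pos, hB, volume_ball_pi _ hBpos, ← ENNReal.ofReal_ofNat 2,
      ← ENNReal.ofReal_pow (by norm_num), ← ENNReal.ofReal_mul (by positivity), ← mul_pow]
    gcongr
    linarith
  obtain ⟨c, hc⟩ := h_int
  refine ⟨c, ?_⟩
  have hcov : Q ⊆ B ∪ W := fun x hx => by
    by_cases h : (1 - ‖x‖) * (4 * N) ≤ 1
    · exact Or.inr ⟨hx, h⟩
    · refine Or.inl (mem_ball_zero_iff.2 ?_)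
      have : κ * (4 * N) < 1 := by nlinarith
      nlinarith
  have hwgt := lintegral_layer_weight_le hd hN (mc c)
  rw [← hQ, ← hW] at hwgt
  set F := ∫⁻ x in Q, ‖f x - c‖ₑ ^ 2 with hF
  have hlayer : ∫⁻ x in W, ‖f x - c‖ₑ ^ 2 ≤ 2 * (C * ∫⁻ x in Q, h x)
      + 2 * (ENNReal.ofReal (1 / 4) * F) := by
    refine le_trans ?_ (add_le_add (mul_le_mul' le_rfl hCf) (mul_le_mul' le_rfl hwgt))
    rw [← lintegral_const_mul' _ _ (by norm_num), ← lintegral_const_mul' _ _ (by norm_num)]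
    have mA : Measurable fun x : Fin d → ℝ => 2 * (ENNReal.ofReal (((N * (1 - ‖x‖)) ^ d)⁻¹) *
        ∫⁻ z in Metric.ball ((1 - N * (1 - ‖x‖)) • x) (N * (1 - ‖x‖) / 2), ‖f z - c‖ₑ ^ 2) := by
      refine Measurable.const_mul (Measurable.mul (by fun_prop) ?_) _
      have mS : MeasurableSet {q : (Fin d → ℝ) × (Fin d → ℝ) |
          dist q.2 ((1 - N * (1 - ‖q.1‖)) • q.1) < N * (1 - ‖q.1‖) / 2} :=
        measurableSet_lt (by fun_prop) (by fun_prop)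
      simp_rw [← lintegral_indicator measurableSet_ball]
      exact (((mc c).comp measurable_snd).indicator mS).lintegral_prod_right'
    rw [← lintegral_add_right _ mA]
    refine setLIntegral_mono' mW fun x hx => ?_
    have ha : 0 < 1 - ‖x‖ := by have := mem_ball_zero_iff.1 hx.1; linarith
    set b := (1 - N * (1 - ‖x‖)) • x with hb
    have hr : 0 < N * (1 - ‖x‖) / 2 := by positivity
    have hk : ENNReal.ofReal (((N * (1 - ‖x‖)) ^ d)⁻¹) * volume (Metric.ball b (N * (1 - ‖x‖) / 2))
        = 1 := by
      rw [volume_ball_pi _ hr, ← ENNReal.ofReal_mul (by positivity), mul_div_cancel₀ _ two_ne_zero,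
        inv_mul_cancel₀ (by positivity), ENNReal.ofReal_one]
    calc ‖f x - c‖ₑ ^ 2 = ENNReal.ofReal (((N * (1 - ‖x‖)) ^ d)⁻¹) *
          ∫⁻ z in Metric.ball b (N * (1 - ‖x‖) / 2), ‖f x - c‖ₑ ^ 2 := by
          rw [setLIntegral_const, mul_left_comm, hk, mul_one]
      _ ≤ ENNReal.ofReal (((N * (1 - ‖x‖)) ^ d)⁻¹) *
          ∫⁻ z in Metric.ball b (N * (1 - ‖x‖) / 2),
            (2 * ‖f x - f z‖ₑ ^ 2 + 2 * ‖f z - c‖ₑ ^ 2) := by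
          gcongr with z
          exact sq_enorm_sub_le _ _ _
      _ = _ := by
          rw [lintegral_add_right _ ((mc c).const_mul 2), lintegral_const_mul' _ _ (by norm_num),
            lintegral_const_mul' _ _ (by norm_num)]
          ring
  have hquarter : 2 * (ENNReal.ofReal (1 / 4) * F) = F / 2 := by
    rw [← mul_assoc, ← ENNReal.ofReal_ofNat 2, ← ENNReal.ofReal_mul (by norm_num),
      ENNReal.div_eq_inv_mul, ← ENNReal.ofReal_inv_of_pos (by norm_num)]
    norm_num
  have htot : F ≤ (2 ^ d + 2 * C) * (∫⁻ x in Q, h x) + F / 2 := by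
    calc F ≤ ∫⁻ x in B ∪ W, ‖f x - c‖ₑ ^ 2 := lintegral_mono_set hcov
      _ ≤ (∫⁻ x in B, ‖f x - c‖ₑ ^ 2) + ∫⁻ x in W, ‖f x - c‖ₑ ^ 2 := lintegral_union_le _ _ _
      _ ≤ 2 ^ d * (∫⁻ x in Q, h x) + (2 * (C * ∫⁻ x in Q, h x) + F / 2) :=
          add_le_add hc (hquarter ▸ hlayer)
      _ = _ := by ring
  have hF2 : F / 2 ≠ ⊤ := ENNReal.div_ne_top (hfin c) (by norm_num)
  have h3 : F / 2 ≤ (2 ^ d + 2 * C) * (∫⁻ x in Q, h x) := by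
    rw [← ENNReal.add_halves F] at htot
    nth_rewrite 3 [← ENNReal.add_halves F] at htot
    exact (ENNReal.add_le_add_iff_right hF2).1 (by simpa using htot)
  calc F = 2 * (F / 2) := by rw [two_mul, ENNReal.add_halves]
    _ ≤ 2 * ((2 ^ d + 2 * C) * (∫⁻ x in Q, h x)) := by gcongr
    _ = _ := by push_cast; ring

lemma lintegral_comp_affine {d : ℕ} (p : Fin d → ℝ) {ρ : ℝ} (hρ : 0 < ρ)
    {g : (Fin d → ℝ) → ENNReal} (hg : Measurable g) :
    ENNReal.ofReal (ρ ^ d) * ∫⁻ x, g (p + ρ • x) = ∫⁻ x, g x := by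
  have h1 : ∫⁻ x, g (p + ρ • x) = ∫⁻ w, g (p + w) ∂(Measure.map (ρ • ·) volume) := by
    rw [lintegral_map (by fun_prop) (by fun_prop)]
  rw [h1, Measure.map_addHaar_smul _ hρ.ne', lintegral_smul_measure, smul_eq_mul, ← mul_assoc,
    lintegral_add_left_eq_self (fun w => g w) p, ← ENNReal.ofReal_mul (by positivity)]
  rw [Module.finrank_fin_fun, abs_of_pos (by positivity), mul_inv_cancel₀ (by positivity),
    ENNReal.ofReal_one, one_mul]

lemma setLIntegral_comp_affine {d : ℕ} (p : Fin d → ℝ) {ρ : ℝ} (hρ : 0 < ρ) (r : ℝ)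
    {g : (Fin d → ℝ) → ENNReal} (hg : Measurable g) :
    ENNReal.ofReal (ρ ^ d) * ∫⁻ x in Metric.ball 0 r, g (p + ρ • x)
      = ∫⁻ x in Metric.ball p (r * ρ), g x := by
  rw [← lintegral_indicator measurableSet_ball, ← lintegral_indicator measurableSet_ball,
    ← lintegral_comp_affine p hρ (hg.indicator measurableSet_ball)]
  congr 1
  refine lintegral_congr fun x => ?_
  have : p + ρ • x ∈ Metric.ball p (r * ρ) ↔ x ∈ Metric.ball (0 : Fin d → ℝ) r := by
    rw [Metric.mem_ball, dist_eq_norm, add_sub_cancel_left, norm_smul, mem_ball_zero_iff,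
      Real.norm_of_nonneg hρ.le, mul_comm r, mul_lt_mul_iff_right₀ hρ]
  by_cases hx : x ∈ Metric.ball (0 : Fin d → ℝ) r
  · rw [indicator_of_mem hx, indicator_of_mem (this.2 hx)]
  · rw [indicator_of_notMem hx, indicator_of_notMem fun h => hx (this.1 h)]

lemma lintegral_lintegral_sub_le {α V : Type*} [MeasurableSpace α] {μ : Measure α}
    [NormedAddCommGroup V] [MeasurableSpace V] [BorelSpace V] [SecondCountableTopology V]
    {f : α → V} (hf : Measurable f) (c : V) :
    ∫⁻ z, ∫⁻ x, ‖f x - f z‖ₑ ^ 2 ∂μ ∂μ ≤ μ univ * (4 * ∫⁻ x, ‖f x - c‖ₑ ^ 2 ∂μ) := by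
  have mc : Measurable fun z => ‖f z - c‖ₑ ^ 2 := ((hf.sub_const c).enorm).pow_const 2
  calc ∫⁻ z, ∫⁻ x, ‖f x - f z‖ₑ ^ 2 ∂μ ∂μ
      ≤ ∫⁻ z, ∫⁻ x, (2 * ‖f x - c‖ₑ ^ 2 + 2 * ‖f z - c‖ₑ ^ 2) ∂μ ∂μ := by
        gcongr with z x
        refine (sq_enorm_sub_le _ c _).trans ?_
        rw [← enorm_neg (f z - c), neg_sub]
    _ = ∫⁻ z, (2 * (∫⁻ x, ‖f x - c‖ₑ ^ 2 ∂μ) + μ univ * (2 * ‖f z - c‖ₑ ^ 2)) ∂μ := by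
        refine lintegral_congr fun z => ?_
        rw [lintegral_add_right _ measurable_const, lintegral_const_mul' _ _ (by norm_num),
          lintegral_const, mul_comm (μ univ)]
    _ = _ := by
        rw [lintegral_add_left measurable_const, lintegral_const,
          lintegral_const_mul _ (mc.const_mul 2), lintegral_const_mul' _ _ (by norm_num)]
        ring

lemma exists_near_average {α V : Type*} [MeasurableSpace α] {μ : Measure α} [IsFiniteMeasure μ]
    [NormedAddCommGroup V] [MeasurableSpace V] [BorelSpace V] [SecondCountableTopology V]
    {f : α → V} (hf : Measurable f) :
    ∃ c : V, ∀ c' : V, ∫⁻ x, ‖f x - c‖ₑ ^ 2 ∂μ ≤ 4 * ∫⁻ x, ‖f x - c'‖ₑ ^ 2 ∂μ := by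
  rcases eq_or_ne μ 0 with rfl | h0
  · exact ⟨0, fun _ => by simp⟩
  have mG : Measurable fun q : α × α => ‖f q.1 - f q.2‖ₑ ^ 2 :=
    (((hf.comp measurable_fst).sub (hf.comp measurable_snd)).enorm).pow_const 2
  have mI : AEMeasurable (fun z => ∫⁻ x, ‖f x - f z‖ₑ ^ 2 ∂μ) μ :=
    (mG.lintegral_prod_left' (μ := μ)).aemeasurable
  obtain ⟨z, hz⟩ := exists_le_laverage h0 mI
  refine ⟨f z, fun c' => hz.trans ?_⟩
  rw [laverage_eq]
  exact ENNReal.div_le_of_le_mul ((lintegral_lintegral_sub_le hf c').trans_eq (mul_comm _ _))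

lemma sq_enorm_eq_ofReal {V : Type*} [NormedAddCommGroup V] (v : V) :
    ‖v‖ₑ ^ 2 = ENNReal.ofReal (‖v‖ ^ 2) := by
  rw [← ofReal_norm, ENNReal.ofReal_pow (norm_nonneg _)]

lemma grad_comp_affine {d : ℕ} {y : Fin d → (Fin d → ℝ) → ℝ} (p : Fin d → ℝ) {ρ : ℝ} (hρ : ρ ≠ 0)
    (x : Fin d → ℝ) : grad (fun i x => ρ⁻¹ * y i (p + ρ • x)) x = grad y (p + ρ • x) := by
  funext i j
  simp only [grad, pd]
  have h1 : fderiv ℝ (fun x : Fin d → ℝ => ρ⁻¹ * y i (p + ρ • x)) x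
      = ρ⁻¹ • fderiv ℝ (fun x : Fin d → ℝ => y i (p + ρ • x)) x :=
    congrFun (fderiv_const_smul_field (f := fun x : Fin d → ℝ => y i (p + ρ • x)) ρ⁻¹) x
  have h2 : fderiv ℝ (fun x : Fin d → ℝ => y i (p + ρ • x)) x
      = ρ • fderiv ℝ (y i) (p + ρ • x) := by
    have := fderiv_comp_smul (f := fun w => y i (p + w)) (x := x) ρ
    rw [this, fderiv_comp_add_left]
  rw [h1, h2, smul_smul, inv_mul_cancel₀ hρ, one_smul]

lemma lipschitz_comp_affine {d : ℕ} {u : (Fin d → ℝ) → ℝ} {L : NNReal} (hu : LipschitzWith L u)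
    (p : Fin d → ℝ) {ρ : ℝ} (hρ : 0 < ρ) : LipschitzWith L fun x => ρ⁻¹ * u (p + ρ • x) := by
  refine LipschitzWith.of_dist_le_mul fun x z => ?_
  have h := hu.dist_le_mul (p + ρ • x) (p + ρ • z)
  rw [dist_add_left, dist_smul₀, Real.norm_of_nonneg hρ.le] at h
  rw [Real.dist_eq, ← mul_sub, abs_mul, abs_of_pos (inv_pos.2 hρ), ← Real.dist_eq,
    inv_mul_le_iff₀ hρ]
  linarith

/-- The local estimate on an arbitrary cube. -/
lemma exists_local_lintegral (d : ℕ) (L : NNReal) {κ θ : ℝ} (hκ : 0 < κ) (hκ1 : κ < 1)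
    (hθ : 0 < θ) :
    ∃ C, 0 ≤ C ∧ ∀ y : Fin d → (Fin d → ℝ) → ℝ, (∀ i, LipschitzWith L (y i)) →
      ∀ c : Fin d → Fin d → ℝ, ∀ p ρ, 0 < ρ → ∃ c' : Fin d → Fin d → ℝ,
        ∫⁻ x in Metric.ball p ((1 - κ) * ρ), ‖grad y x - c'‖ₑ ^ 2 ≤
          ∫⁻ x in Metric.ball p ρ, ENNReal.ofReal (C * eg y x ^ 2 + θ * ‖grad y x - c‖ ^ 2) := by
  obtain ⟨C, hC0, hC⟩ := exists_local_estimate d L hκ hκ1 hθ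
  refine ⟨C, hC0, fun y hy c p ρ hρ => ?_⟩
  set y' : Fin d → (Fin d → ℝ) → ℝ := fun i x => ρ⁻¹ * y i (p + ρ • x) with hy'
  have hgy : ∀ x, grad y' x = grad y (p + ρ • x) := grad_comp_affine p hρ.ne'
  have Ly : ∀ i, LipschitzWith L (y' i) := fun i => lipschitz_comp_affine (hy i) p hρ
  obtain ⟨c', hc'⟩ := hC y' Ly c
  refine ⟨c', ?_⟩
  have fin : ∀ r, volume (Metric.ball (0 : Fin d → ℝ) r) ≠ ⊤ := fun r => measure_ball_lt_top.ne
  have i1 := integrableOn_sq_norm_grad Ly c' (fin (1 - κ)) measurableSet_ball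
  have i2 := integrableOn_sq_norm_grad Ly c (fin 1) measurableSet_ball
  have i3 := integrableOn_sq_eg Ly (fin 1) measurableSet_ball
  have i4 : IntegrableOn (fun x => C * eg y' x ^ 2 + θ * ‖grad y' x - c‖ ^ 2) (Metric.ball 0 1) :=
    (i3.const_mul C).add (i2.const_mul θ)
  have e4 : ∫ x in Metric.ball 0 1, (C * eg y' x ^ 2 + θ * ‖grad y' x - c‖ ^ 2) =
      C * (∫ x in Metric.ball 0 1, eg y' x ^ 2) + θ * ∫ x in Metric.ball 0 1,
          ‖grad y' x - c‖ ^ 2 := by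
    rw [integral_add (i3.const_mul C) (i2.const_mul θ), integral_const_mul, integral_const_mul]
  rw [← e4] at hc'
  have hc'' := ENNReal.ofReal_le_ofReal hc'
  rw [ofReal_integral_eq_lintegral_ofReal i1 (ae_of_all _ fun x => sq_nonneg _),
    ofReal_integral_eq_lintegral_ofReal i4 (ae_of_all _ fun x =>
      add_nonneg (mul_nonneg hC0 (sq_nonneg _)) (mul_nonneg hθ.le (sq_nonneg _)))] at hc''
  have m1 : Measurable fun x => ‖grad y x - c'‖ₑ ^ 2 :=
    (((measurable_grad y).sub_const c').enorm).pow_const 2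
  have m2 : Measurable fun x => ENNReal.ofReal (C * eg y x ^ 2 + θ * ‖grad y x - c‖ ^ 2) :=
    ((((measurable_eg y).pow_const 2).const_mul C).add
      ((((measurable_grad y).sub_const c).norm.pow_const 2).const_mul θ)).ennreal_ofReal
  have s2 := setLIntegral_comp_affine p hρ 1 m2
  rw [one_mul] at s2
  rw [← setLIntegral_comp_affine p hρ (1 - κ) m1, ← s2]
  refine mul_le_mul' le_rfl ?_
  simp only [eg, hgy, ← sq_enorm_eq_ofReal] at hc''
  exact hc''

/-- Geometric rigidity on the unit cube for Lipschitz maps. -/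
lemma exists_rigidity_lipschitz {d : ℕ} (hd : 0 < d) (L : NNReal) :
    ∃ C, 0 ≤ C ∧ ∀ y : Fin d → (Fin d → ℝ) → ℝ, (∀ i, LipschitzWith L (y i)) →
      ∃ R ∈ SOm d, ∫ x in Metric.ball 0 1, ‖grad y x - R‖ ^ 2
        ≤ C * ∫ x in Metric.ball 0 1, eg y x ^ 2 := by
  obtain ⟨κ, hκ, hκ1, W, hW⟩ := exists_oscillation_le hd
  set θ : ℝ := 1 / (32 * (W + 1)) with hθ
  have θ0 : 0 < θ := by positivity
  obtain ⟨C, hC0, hC⟩ := exists_local_lintegral d L hκ hκ1 θ0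
  refine ⟨6 * (8 * (4 * W * C)) + 4, by positivity, fun y hy => ?_⟩
  set Q := Metric.ball (0 : Fin d → ℝ) 1 with hQ
  have fQ : volume Q ≠ ⊤ := measure_ball_lt_top.ne
  have : IsFiniteMeasure (volume.restrict Q) := ⟨by simpa using fQ.lt_top⟩
  have mf := measurable_grad y
  obtain ⟨c, hc⟩ := exists_near_average (μ := volume.restrict Q) mf
  have iE := integrableOn_sq_eg hy fQ measurableSet_ball
  have iF : ∀ c, IntegrableOn (fun x => ‖grad y x - c‖ ^ 2) Q := fun c =>
    integrableOn_sq_norm_grad hy c fQ measurableSet_ball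
  have eF : ∀ c, ∫⁻ x in Q, ‖grad y x - c‖ₑ ^ 2 = ENNReal.ofReal (∫ x in Q, ‖grad y x - c‖ ^ 2) :=
    fun c => by
      rw [ofReal_integral_eq_lintegral_ofReal (iF c) (ae_of_all _ fun x => sq_nonneg _)]
      simp only [← sq_enorm_eq_ofReal]
  have iH : IntegrableOn (fun x => C * eg y x ^ 2 + θ * ‖grad y x - c‖ ^ 2) Q :=
    (iE.const_mul C).add ((iF c).const_mul θ)
  set h : (Fin d → ℝ) → ENNReal := fun x =>
    4 * ENNReal.ofReal (C * eg y x ^ 2 + θ * ‖grad y x - c‖ ^ 2) with hh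
  have mh : Measurable h :=
    ((((measurable_eg y).pow_const 2).const_mul C).add
      ((((measurable_grad y).sub_const c).norm.pow_const 2).const_mul θ)).ennreal_ofReal.const_mul 4
  obtain ⟨c', hc'⟩ := hW (grad y) h mf mh (fun p ρ hρ _ => by
    obtain ⟨c', hc'⟩ := hC y hy c p ρ hρ
    calc _ = ∫⁻ z in Metric.ball p ((1 - κ) * ρ), ∫⁻ x in Metric.ball p ((1 - κ) * ρ),
          ‖grad y x - grad y z‖ₑ ^ 2 := by
          refine lintegral_congr fun x => lintegral_congr fun z => ?_
          rw [← enorm_neg, neg_sub]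
      _ ≤ _ := lintegral_lintegral_sub_le mf c'
      _ ≤ _ := by
          rw [Measure.restrict_apply_univ, hh, lintegral_const_mul' _ _ (by norm_num)]
          refine mul_le_mul' (measure_mono (Metric.ball_subset_ball (by nlinarith)))
            (mul_le_mul' le_rfl hc')) (fun c => by rw [eF]; exact ENNReal.ofReal_ne_top)
  have hcc := hc c'
  rw [hh, lintegral_const_mul' _ _ (by norm_num), ← ofReal_integral_eq_lintegral_ofReal iH
    (ae_of_all _ fun x => add_nonneg (mul_nonneg hC0 (sq_nonneg _)) (mul_nonneg θ0.le (sq_nonneg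
        _))),
    eF, integral_add (iE.const_mul C) ((iF c).const_mul θ), integral_const_mul,
    integral_const_mul] at hc'
  rw [eF, eF] at hcc
  set m := ∫ x in Q, ‖grad y x - c‖ ^ 2 with hm
  set m' := ∫ x in Q, ‖grad y x - c'‖ ^ 2 with hm'
  set E := ∫ x in Q, eg y x ^ 2 with hE
  have m0 : 0 ≤ m := integral_nonneg fun x => sq_nonneg _
  have m0' : 0 ≤ m' := integral_nonneg fun x => sq_nonneg _
  have E0 : 0 ≤ E := integral_nonneg fun x => sq_nonneg _
  have r1 : m ≤ 4 * m' := by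
    rw [← ENNReal.ofReal_ofNat 4, ← ENNReal.ofReal_mul (by norm_num)] at hcc
    exact (ENNReal.ofReal_le_ofReal_iff (by positivity)).1 hcc
  have r2 : m' ≤ W * (4 * (C * E + θ * m)) := by
    rw [← ENNReal.ofReal_ofNat 4, ← ENNReal.ofReal_mul (by norm_num), ← ENNReal.ofReal_coe_nnreal,
      ← ENNReal.ofReal_mul (by positivity)] at hc'
    exact (ENNReal.ofReal_le_ofReal_iff (by positivity)).1 hc'
  obtain ⟨R, hR, hRc⟩ := exists_rotation_close hy c
  refine ⟨R, hR, hRc.trans ?_⟩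
  have r3 : 32 * W * θ ≤ 1 := by
    rw [hθ]; field_simp; linarith
  have r4 : m ≤ 8 * (4 * W * C) * E := by
    have : 32 * W * θ * m' ≤ 1 * m' := mul_le_mul_of_nonneg_right r3 m0'
    have h5 : W * θ * m ≤ W * θ * (4 * m') := by gcongr
    nlinarith
  nlinarith

/-- The weak type estimate for the maximal function, at level one. -/
lemma exists_maximal_bound {d : ℕ} (hd : 0 < d) {f : (Fin d → ℝ) → ENNReal}
    (hf : ∫⁻ x, f x ≠ ⊤) :
    ∃ B : Set (Fin d → ℝ), MeasurableSet B ∧ volume B ≤ 5 ^ d * ∫⁻ x, f x ∧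
      ∀ x ∉ B, ∀ ℓ > 0, ∫⁻ y in Metric.closedBall x ℓ, f y ≤ ENNReal.ofReal ((2 * ℓ) ^ d) := by
  set t : Set ((Fin d → ℝ) × ℝ) := {p | 0 < p.2 ∧
    ENNReal.ofReal ((2 * p.2) ^ d) < ∫⁻ y in Metric.closedBall p.1 p.2, f y} with ht
  set M := (∫⁻ x, f x).toReal with hM
  have hr : ∀ a ∈ t, a.2 ≤ (1 + M) / 2 := by
    rintro ⟨x, ℓ⟩ ⟨h0, h1⟩
    simp only at h0 h1 ⊢
    have h2 : (2 * ℓ) ^ d < M := by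
      have := h1.trans_le (setLIntegral_le_lintegral _ f)
      rwa [ENNReal.ofReal_lt_iff_lt_toReal (by positivity) hf] at this
    have M0 : 0 ≤ M := ENNReal.toReal_nonneg
    by_contra! h3
    have h4 : 1 ≤ 2 * ℓ := by linarith
    have h5 := le_self_pow₀ h4 hd.ne'
    linarith
  obtain ⟨u, hut, hdis, hcov⟩ := Vitali.exists_disjoint_subfamily_covering_enlargement_closedBall t
    (fun p => p.1) (fun p => p.2) _ hr 5 (by norm_num)
  have hu : u.Countable := hdis.countable_of_nonempty_interior fun a ha =>
    ⟨a.1, Metric.ball_subset_interior_closedBall (Metric.mem_ball_self (hut ha).1)⟩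
  refine ⟨⋃ a ∈ u, Metric.closedBall a.1 (5 * a.2),
    MeasurableSet.biUnion hu fun a _ => Metric.isClosed_closedBall.measurableSet, ?_, ?_⟩
  · calc volume (⋃ a ∈ u, Metric.closedBall a.1 (5 * a.2))
        ≤ ∑' a : u, volume (Metric.closedBall a.1.1 (5 * a.1.2)) := measure_biUnion_le _ hu _
      _ ≤ ∑' a : u, 5 ^ d * ∫⁻ y in Metric.closedBall a.1.1 a.1.2, f y := by
          refine ENNReal.tsum_le_tsum fun a => ?_
          have h0 := (hut a.2).1
          rw [Real.volume_pi_closedBall _ (by positivity), Fintype.card_fin,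
            show 2 * (5 * a.1.2) = 5 * (2 * a.1.2) by ring, mul_pow,
            ENNReal.ofReal_mul (by positivity), ENNReal.ofReal_pow (by norm_num),
            ENNReal.ofReal_ofNat]
          exact mul_le_mul' le_rfl (hut a.2).2.le
      _ = 5 ^ d * ∫⁻ y in ⋃ a ∈ u, Metric.closedBall a.1 a.2, f y := by
          rw [ENNReal.tsum_mul_left, lintegral_biUnion hu
            (fun a _ => Metric.isClosed_closedBall.measurableSet) hdis]
      _ ≤ _ := mul_le_mul' le_rfl (setLIntegral_le_lintegral _ f)
  · intro x hx ℓ hℓ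
    by_contra! h
    obtain ⟨b, hb, hsub⟩ := hcov (x, ℓ) ⟨hℓ, h⟩
    exact hx (mem_biUnion hb (hsub (Metric.mem_closedBall_self hℓ.le)))

/-- The fundamental theorem of calculus as an inequality, without integrability assumptions. -/
lemma enorm_sub_le_lintegral_fderiv {E : Type*} [NormedAddCommGroup E] [NormedSpace ℝ E]
    {u : E → ℝ} {a p : E} (hu : ∀ t ∈ Icc (0 : ℝ) 1, DifferentiableAt ℝ u (a + t • (p - a)))
    (hm : Measurable fun t : ℝ => fderiv ℝ u (a + t • (p - a)) (p - a)) :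
    ‖u p - u a‖ₑ ≤ ∫⁻ t in Ioc (0 : ℝ) 1, ‖fderiv ℝ u (a + t • (p - a)) (p - a)‖ₑ := by
  set φ := fun t : ℝ => fderiv ℝ u (a + t • (p - a)) (p - a) with hφ
  by_cases h : ∫⁻ t in Ioc (0 : ℝ) 1, ‖φ t‖ₑ = ⊤
  · rw [h]; exact le_top
  have h_int : IntegrableOn φ (Ioc 0 1) := ⟨hm.aestronglyMeasurable, lt_top_iff_ne_top.2 h⟩
  have key := intervalIntegral.integral_eq_sub_of_hasDerivAt (a := 0) (b := 1)
    (f := fun t : ℝ => u (a + t • (p - a))) (f' := φ) (fun t ht => by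
      rw [uIcc_of_le zero_le_one] at ht
      have h2 : HasDerivAt (fun t : ℝ => a + t • (p - a)) (p - a) t := by
        simpa using ((hasDerivAt_id t).smul_const (p - a)).const_add a
      exact (hu t ht).hasFDerivAt.comp_hasDerivAt t h2)
    ((intervalIntegrable_iff_integrableOn_Ioc_of_le zero_le_one).2 h_int)
  have e : u p - u a = ∫ t in (0 : ℝ)..1, φ t := by simpa using key.symm
  rw [e, intervalIntegral.integral_of_le zero_le_one]
  exact enorm_integral_le_lintegral_enorm _

lemma lintegral_enorm_sub_le {d : ℕ} {u : (Fin d → ℝ) → ℝ} {G : (Fin d → ℝ) → ENNReal}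
    (hG : Measurable G) {Q : Set (Fin d → ℝ)} (hQ : IsOpen Q) (hQc : Convex ℝ Q)
    (hu : DifferentiableOn ℝ u Q)
    (hGu : ∀ x z, ‖fderiv ℝ u x z‖ₑ ≤ G x * ‖z‖ₑ) {K : ENNReal} {a m : Fin d → ℝ} {s : ℝ}
    (hs : 0 < s) (ha : a ∈ Q)
    (hK : ∀ ℓ > 0, ∫⁻ x in Metric.closedBall a ℓ ∩ Q, G x ≤ K * ENNReal.ofReal (ℓ ^ d))
    (hmQ : Metric.ball m s ⊆ Q) (hma : Metric.ball m s ⊆ Metric.closedBall a (4 * s)) :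
    ∫⁻ q in Metric.ball 0 1, ‖u (m + s • q) - u a‖ₑ
      ≤ ENNReal.ofReal (4 * s) * (K * 4 ^ d) := by
  have hb : ∀ q ∈ Metric.ball (0 : Fin d → ℝ) 1, m + s • q ∈ Metric.ball m s := by
    intro q hq
    rw [mem_ball_zero_iff] at hq
    rw [mem_ball_iff_norm, add_sub_cancel_left, norm_smul, Real.norm_eq_abs, abs_of_pos hs]
    nlinarith
  have hmeas : Measurable fun p : (Fin d → ℝ) × ℝ => G (a + p.2 • (m + s • p.1 - a)) :=
    hG.comp (by fun_prop)
  calc ∫⁻ q in Metric.ball 0 1, ‖u (m + s • q) - u a‖ₑ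
      ≤ ∫⁻ q in Metric.ball 0 1, ∫⁻ t in Ioc (0 : ℝ) 1,
          ENNReal.ofReal (4 * s) * G (a + t • (m + s • q - a)) := by
        refine setLIntegral_mono' measurableSet_ball fun q hq => ?_
        have hp := hmQ (hb q hq)
        have hpa := hma (hb q hq)
        refine (enorm_sub_le_lintegral_fderiv (a := a) (p :=
            m + s • q) (fun t ht => ?_) ?_).trans ?_
        · refine hu.differentiableAt (hQ.mem_nhds ?_)
          exact hQc.add_smul_sub_mem ha hp ht
        · exact (measurable_fderiv_apply_const ℝ u _).comp (by fun_prop)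
        · refine lintegral_mono fun t => ?_
          rw [mul_comm]
          refine (hGu _ _).trans (mul_le_mul' le_rfl ?_)
          rw [mem_closedBall_iff_norm] at hpa
          rw [← ofReal_norm]
          exact ENNReal.ofReal_le_ofReal hpa
    _ = ∫⁻ t in Ioc (0 : ℝ) 1, ∫⁻ q in Metric.ball 0 1,
          ENNReal.ofReal (4 * s) * G (a + t • (m + s • q - a)) :=
        lintegral_lintegral_swap (hmeas.const_mul _).aemeasurable
    _ ≤ ∫⁻ t in Ioc (0 : ℝ) 1, ENNReal.ofReal (4 * s) * (K * 4 ^ d) := by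
        refine setLIntegral_mono' measurableSet_Ioc fun t ht => ?_
        rw [lintegral_const_mul' _ _ ENNReal.ofReal_ne_top]
        refine mul_le_mul' le_rfl ?_
        have hts : 0 < t * s := mul_pos ht.1 hs
        have e := setLIntegral_comp_affine (a + t • (m - a)) hts 1 hG
        have e2 : ∀ q : Fin d → ℝ, a + t • (m + s • q - a) = a + t • (m - a) + (t * s) • q := by
          intro q; module
        simp_rw [e2]
        have hsub : Metric.ball (a + t • (m - a)) (1 * (t * s))
            ⊆ Metric.closedBall a (4 * (t * s)) ∩ Q := by
          intro x hx
          rw [mem_ball_iff_norm, one_mul] at hx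
          set q := t⁻¹ • (x - (a + t • (m - a))) with hq
          have hx2 : x = a + t • (m + q - a) := by
            have : t • q = x - (a + t • (m - a)) := by
              rw [hq, smul_smul, mul_inv_cancel₀ ht.1.ne', one_smul]
            rw [show a + t • (m + q - a) = a + t • (m - a) + t • q by module, this]
            abel
          have hqb : m + q ∈ Metric.ball m s := by
            rw [mem_ball_iff_norm, add_sub_cancel_left, hq, norm_smul, norm_inv, Real.norm_eq_abs,
              abs_of_pos ht.1, inv_mul_lt_iff₀ ht.1]
            exact hx
          constructor
          · have := hma hqb
            rw [mem_closedBall_iff_norm] at this ⊢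
            rw [hx2, add_sub_cancel_left, norm_smul, Real.norm_eq_abs, abs_of_pos ht.1]
            nlinarith [ht.1]
          · rw [hx2]
            exact hQc.add_smul_sub_mem ha (hmQ hqb) ⟨ht.1.le, ht.2⟩
        have h3 := (lintegral_mono_set hsub).trans (hK (4 * (t * s)) (by positivity))
        rw [← e, mul_pow 4, ENNReal.ofReal_mul (by positivity),
            ENNReal.ofReal_pow (p := 4) (by norm_num),
          ENNReal.ofReal_ofNat, ← mul_assoc, mul_comm] at h3
        have hpos : ENNReal.ofReal ((t * s) ^ d) ≠ 0 := by
          rw [Ne, ENNReal.ofReal_eq_zero, not_le]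
          exact pow_pos hts d
        exact (ENNReal.mul_le_mul_iff_left hpos ENNReal.ofReal_ne_top).1 h3
    _ = _ := by simp

lemma enorm_sub_le_of_maximal_bound {d : ℕ} {u : (Fin d → ℝ) → ℝ} {G : (Fin d → ℝ) → ENNReal}
    (hG : Measurable G) (hu : DifferentiableOn ℝ u (Metric.ball 0 1))
    (hGu : ∀ x z, ‖fderiv ℝ u x z‖ₑ ≤ G x * ‖z‖ₑ) {K : ENNReal} {x z : Fin d → ℝ}
    (hx : x ∈ Metric.ball (0 : Fin d → ℝ) 1) (hz : z ∈ Metric.ball (0 : Fin d → ℝ) 1)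
    (hKx : ∀ ℓ > 0, ∫⁻ w in Metric.closedBall x ℓ ∩ Metric.ball 0 1, G w
      ≤ K * ENNReal.ofReal (ℓ ^ d))
    (hKz : ∀ ℓ > 0, ∫⁻ w in Metric.closedBall z ℓ ∩ Metric.ball 0 1, G w
      ≤ K * ENNReal.ofReal (ℓ ^ d)) :
    ‖u x - u z‖ₑ ≤ 4 * 4 ^ d * K * ‖x - z‖ₑ := by
  rcases eq_or_ne x z with rfl | hxz
  · simp
  have hx' := mem_ball_zero_iff.1 hx
  have hz' := mem_ball_zero_iff.1 hz
  set s := ‖x - z‖ / 2 with hs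
  have s0 : 0 < s := half_pos (norm_pos_iff.2 (sub_ne_zero.2 hxz))
  have s1 : s < 1 := by
    have := norm_sub_le x z
    rw [hs]; linarith
  set m := (1 - s) • x with hm
  have hnorm : ∀ w ∈ Metric.ball m s, w ∈ Metric.ball (0 : Fin d → ℝ) 1 ∧ ‖w - x‖ ≤ 2 * s := by
    intro w hw
    rw [mem_ball_iff_norm] at hw
    have h1 : ‖m‖ = (1 - s) * ‖x‖ := by
      rw [hm, norm_smul, Real.norm_eq_abs, abs_of_pos (by linarith)]
    have h2 : ‖m - x‖ = s * ‖x‖ := by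
      rw [hm, show (1 - s) • x - x = (-s) • x by module, norm_smul, Real.norm_eq_abs, abs_neg,
        abs_of_pos s0]
    constructor
    · rw [mem_ball_zero_iff]
      have := norm_add_le (w - m) m
      rw [sub_add_cancel, h1] at this
      nlinarith
    · have := norm_add_le (w - m) (m - x)
      rw [sub_add_sub_cancel, h2] at this
      nlinarith
  have hax : Metric.ball m s ⊆ Metric.closedBall x (4 * s) := fun w hw => by
    rw [mem_closedBall_iff_norm]
    linarith [(hnorm w hw).2]
  have haz : Metric.ball m s ⊆ Metric.closedBall z (4 * s) := fun w hw => by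
    rw [mem_closedBall_iff_norm]
    have := norm_add_le (w - x) (x - z)
    rw [sub_add_sub_cancel] at this
    have : ‖x - z‖ = 2 * s := by rw [hs]; ring
    linarith [(hnorm w hw).2]
  have i1 := lintegral_enorm_sub_le hG Metric.isOpen_ball (convex_ball _ _) hu hGu s0 hx hKx
    (fun w hw => (hnorm w hw).1) hax
  have i2 := lintegral_enorm_sub_le hG Metric.isOpen_ball (convex_ball _ _) hu hGu s0 hz hKz
    (fun w hw => (hnorm w hw).1) haz
  have hvol : 1 ≤ volume (Metric.ball (0 : Fin d → ℝ) 1) := by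
    rw [volume_ball_pi _ one_pos, mul_one, ENNReal.one_le_ofReal]
    exact one_le_pow₀ (by norm_num)
  have i3 : ‖u x - u z‖ₑ ≤ ∫⁻ q in Metric.ball (0 : Fin d → ℝ) 1,
      (‖u (m + s • q) - u x‖ₑ + ‖u (m + s • q) - u z‖ₑ) := by
    calc ‖u x - u z‖ₑ = ‖u x - u z‖ₑ * 1 := (mul_one _).symm
      _ ≤ ‖u x - u z‖ₑ * volume (Metric.ball (0 : Fin d → ℝ) 1) := mul_le_mul' le_rfl hvol
      _ = ∫⁻ q in Metric.ball (0 : Fin d → ℝ) 1, ‖u x - u z‖ₑ := by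
          rw [setLIntegral_const]
      _ ≤ _ := by
          refine lintegral_mono fun q => ?_
          rw [show u x - u z = (u (m + s • q) - u z) - (u (m + s • q) - u x) by ring]
          exact (enorm_sub_le).trans (add_comm _ _).le
  have hmq : ContinuousOn (fun q : Fin d → ℝ => u (m + s • q)) (Metric.ball 0 1) := by
    refine hu.continuousOn.comp (by fun_prop) fun q hq => (hnorm _ ?_).1
    rw [mem_ball_zero_iff] at hq
    rw [mem_ball_iff_norm, add_sub_cancel_left, norm_smul, Real.norm_eq_abs, abs_of_pos s0]
    nlinarith
  rw [lintegral_add_left' ((hmq.aemeasurable measurableSet_ball).sub_const _).enorm] at i3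
  refine (i3.trans (add_le_add i1 i2)).trans (le_of_eq ?_)
  have e : ‖x - z‖ₑ = ENNReal.ofReal (2 * s) := by
    rw [← ofReal_norm, hs]; congr 1; ring
  rw [e, show 4 * s = 2 * (2 * s) by ring, ENNReal.ofReal_mul (p := 2) (by norm_num),
    ENNReal.ofReal_ofNat]
  ring

lemma ae_grad_eq_of_eqOn {d : ℕ} {y w : Fin d → (Fin d → ℝ) → ℝ} {L : NNReal}
    {S : Set (Fin d → ℝ)} (hS : MeasurableSet S)
    (hy : ∀ i, ∀ x ∈ S, DifferentiableAt ℝ (y i) x) (hw : ∀ i, LipschitzWith L (w i))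
    (h : ∀ i, EqOn (y i) (w i) S) : ∀ᵐ x, x ∈ S → grad y x = grad w x := by
  set T := {x | ∀ i, DifferentiableAt ℝ (w i) x} with hT
  have hTm : MeasurableSet T := by
    have : T = ⋂ i, {x | DifferentiableAt ℝ (w i) x} := by ext; simp [hT]
    rw [this]
    exact MeasurableSet.iInter fun i => measurableSet_of_differentiableAt ℝ (w i)
  have hTae : ∀ᵐ x, x ∈ T := ae_all_iff.2 fun i => (hw i).ae_differentiableAt
  have key := ApproximatesLinearOn.norm_fderiv_sub_le (volume : Measure (Fin d → ℝ))
    (f := fun x i => y i x - w i x) (A := 0) (δ := 0) (s := S ∩ T)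
    (fun a ha b hb => by
      have e1 : (fun i => y i a - w i a) = 0 := funext fun i => sub_eq_zero.2 (h i ha.1)
      have e2 : (fun i => y i b - w i b) = 0 := funext fun i => sub_eq_zero.2 (h i hb.1)
      simp [e1, e2]) (hS.inter hTm)
    (fun x => ContinuousLinearMap.pi fun i => fderiv ℝ (y i) x - fderiv ℝ (w i) x)
    (fun x hx => (hasFDerivAt_pi.2 fun i =>
      (hy i x hx.1).hasFDerivAt.fun_sub (hx.2 i).hasFDerivAt).hasFDerivWithinAt)
  rw [ae_restrict_iff' (hS.inter hTm)] at key
  filter_upwards [key, hTae] with x hx hxT hxS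
  have := hx ⟨hxS, hxT⟩
  rw [sub_zero, nonpos_iff_eq_zero, nnnorm_eq_zero] at this
  funext i j
  have h2 := congrFun (congrArg (fun A => A (Pi.single j 1)) this) i
  simpa [sub_eq_zero, grad, pd] using h2

lemma norm_grad_le_eg {d : ℕ} (y : Fin d → (Fin d → ℝ) → ℝ) (x : Fin d → ℝ) :
    ‖grad y x‖ ≤ eg y x + 1 := by
  obtain ⟨P, hP, h⟩ := exists_infDist_SOm (grad y x)
  have h1 := norm_le_one_of_mem_SOm hP
  have h2 := norm_add_le (grad y x - P) P
  rw [sub_add_cancel, ← h] at h2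
  exact h2.trans (by gcongr; exact le_rfl)

lemma enorm_fderiv_le {d : ℕ} (y : Fin d → (Fin d → ℝ) → ℝ) (i : Fin d) (x z : Fin d → ℝ) :
    ‖fderiv ℝ (y i) x z‖ₑ ≤ d * ‖grad y x‖ₑ * ‖z‖ₑ := by
  have h : ‖fderiv ℝ (y i) x z‖ ≤ d * ‖grad y x‖ * ‖z‖ := by
    rw [fderiv_eq_sum_pd, Real.norm_eq_abs]
    refine (Finset.abs_sum_le_sum_abs _ _).trans ?_
    calc ∑ j, |z j * pd (y i) j x| ≤ ∑ j : Fin d, ‖z‖ * ‖grad y x‖ := by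
          refine Finset.sum_le_sum fun j _ => ?_
          rw [abs_mul]
          exact mul_le_mul (norm_le_pi_norm z j) (abs_entry_le_norm (grad y x) i j) (abs_nonneg _)
            (norm_nonneg _)
      _ = _ := by simp; ring
  have := ENNReal.ofReal_le_ofReal h
  rwa [ENNReal.ofReal_mul (by positivity), ENNReal.ofReal_mul (by positivity),
    ENNReal.ofReal_natCast, ofReal_norm, ofReal_norm, ofReal_norm] at this

/-- The geometric rigidity estimate on the unit cube for differentiable maps. -/
lemma exists_rigidity_unit {d : ℕ} (hd : 0 < d) : ∃ C : NNReal,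
    ∀ y : Fin d → (Fin d → ℝ) → ℝ, (∀ i, DifferentiableOn ℝ (y i) (Metric.ball 0 1)) →
      ∃ R ∈ SOm d, ∫⁻ x in Metric.ball 0 1, ‖grad y x - R‖ₑ ^ 2
        ≤ C * ∫⁻ x in Metric.ball 0 1, ENNReal.ofReal (eg y x ^ 2) := by
  set L : NNReal := 4 * 4 ^ d * (d * 3 * 2 ^ d) with hL
  obtain ⟨C₀, hC₀, hLip⟩ := exists_rigidity_lipschitz hd L
  set C₁ : NNReal := C₀.toNNReal with hC₁
  refine ⟨C₁ * (1 + (L + 1) ^ 2 * 5 ^ d) + (2 + 8 * 5 ^ d), fun y hy => ?_⟩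
  set Q := Metric.ball (0 : Fin d → ℝ) 1 with hQ
  set E := ∫⁻ x in Q, ENNReal.ofReal (eg y x ^ 2) with hE
  by_cases hEt : E = ⊤
  · refine ⟨_, one_mem_SOm d, ?_⟩
    rw [hEt, ENNReal.mul_top]
    · exact le_top
    · positivity
  have hmE : Measurable fun x => ENNReal.ofReal (eg y x ^ 2) :=
    ((measurable_eg y).pow_const 2).ennreal_ofReal
  set f := Q.indicator fun x => ENNReal.ofReal (eg y x ^ 2) with hf
  have hfE : ∫⁻ x, f x = E := lintegral_indicator measurableSet_ball _
  obtain ⟨B, hBm, hB, hmax⟩ := exists_maximal_bound hd (f := f) (by rwa [hfE])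
  rw [hfE] at hB
  set G := fun x => (d : ENNReal) * ‖grad y x‖ₑ with hG
  have hGm : Measurable G := (measurable_grad y).enorm.const_mul _
  have hGK : ∀ x ∉ B, ∀ ℓ > 0, ∫⁻ w in Metric.closedBall x ℓ ∩ Q, G w
      ≤ (d * 3 * 2 ^ d) * ENNReal.ofReal (ℓ ^ d) := by
    intro x hx ℓ hℓ
    calc ∫⁻ w in Metric.closedBall x ℓ ∩ Q, G w
        ≤ ∫⁻ w in Metric.closedBall x ℓ ∩ Q, d * (2 + f w) := by
          refine setLIntegral_mono' (Metric.isClosed_closedBall.measurableSet.inter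
            measurableSet_ball) fun w hw => mul_le_mul' le_rfl ?_
          rw [hf, indicator_of_mem hw.2, ← ofReal_norm, ← ENNReal.ofReal_ofNat 2,
            ← ENNReal.ofReal_add (by norm_num) (by positivity)]
          refine ENNReal.ofReal_le_ofReal ((norm_grad_le_eg y w).trans ?_)
          nlinarith [sq_nonneg (eg y w - 1)]
      _ ≤ ∫⁻ w in Metric.closedBall x ℓ, d * (2 + f w) := lintegral_mono_set inter_subset_left
      _ ≤ d * (2 * ENNReal.ofReal ((2 * ℓ) ^ d) + ENNReal.ofReal ((2 * ℓ) ^ d)) := by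
          rw [lintegral_const_mul' _ _ (ENNReal.natCast_ne_top d),
            lintegral_add_left measurable_const, setLIntegral_const,
            Real.volume_pi_closedBall _ hℓ.le, Fintype.card_fin]
          gcongr
          exact hmax x hx ℓ hℓ
      _ = _ := by
          rw [mul_pow, ENNReal.ofReal_mul (by positivity),
              ENNReal.ofReal_pow (p := 2) (by norm_num),
            ENNReal.ofReal_ofNat]
          ring
  have hlip : ∀ i, LipschitzOnWith L (y i) (Q \ B) := by
    intro i x hx z hz
    rw [edist_eq_enorm_sub, edist_eq_enorm_sub]
    refine (enorm_sub_le_of_maximal_bound hGm (hy i) (enorm_fderiv_le y i) hx.1 hz.1 (hGK x hx.2)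
      (hGK z hz.2)).trans (le_of_eq ?_)
    rw [hL]
    push_cast
    ring
  choose w hw hyw using fun i => (hlip i).extend_real
  obtain ⟨R, hR, hRw⟩ := hLip w hw
  refine ⟨R, hR, ?_⟩
  have hae := ae_grad_eq_of_eqOn (measurableSet_ball.diff hBm)
    (fun i x hx => (hy i).differentiableAt (Metric.isOpen_ball.mem_nhds hx.1)) hw hyw
  have hQfin : volume Q ≠ ⊤ := measure_ball_lt_top.ne
  have iE := integrableOn_sq_eg hw (s := Q) hQfin measurableSet_ball
  have iF := integrableOn_sq_norm_grad hw R (s := Q) hQfin measurableSet_ball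
  have hRw' : ∫⁻ x in Q, ‖grad w x - R‖ₑ ^ 2 ≤ C₁ * ∫⁻ x in Q, ENNReal.ofReal (eg w x ^ 2) := by
    have := ENNReal.ofReal_le_ofReal hRw
    rw [ENNReal.ofReal_mul hC₀, ofReal_integral_eq_lintegral_ofReal iF
      (ae_of_all _ fun x => sq_nonneg _), ofReal_integral_eq_lintegral_ofReal iE
      (ae_of_all _ fun x => sq_nonneg _)] at this
    simp only [sq_enorm_eq_ofReal]
    exact this
  have h1 : ∫⁻ x in Q, ENNReal.ofReal (eg w x ^ 2) ≤ (1 + (L + 1) ^ 2 * 5 ^ d) * E := by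
    rw [← lintegral_inter_add_sdiff _ Q hBm, add_comm, add_mul, one_mul]
    refine add_le_add ?_ ?_
    · calc ∫⁻ x in Q \ B, ENNReal.ofReal (eg w x ^ 2) = ∫⁻ x in Q \ B,
          ENNReal.ofReal (eg y x ^ 2) := by
            refine setLIntegral_congr_fun_ae (measurableSet_ball.diff hBm) ?_
            filter_upwards [hae] with x hx hxS
            simp only [eg, hx hxS]
        _ ≤ E := lintegral_mono_set sdiff_subset
    · calc ∫⁻ x in Q ∩ B, ENNReal.ofReal (eg w x ^ 2) ≤ ∫⁻ x in Q ∩ B, ((L : ENNReal) + 1) ^ 2 := by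
            refine lintegral_mono fun x => ?_
            have : ENNReal.ofReal (eg w x ^ 2) ≤ ENNReal.ofReal ((L + 1) ^ 2) :=
              ENNReal.ofReal_le_ofReal (pow_le_pow_left₀ (eg_nonneg w x) (eg_le hw x) 2)
            rwa [ENNReal.ofReal_pow (p := L + 1) (by positivity),
                ENNReal.ofReal_add (by positivity) (by norm_num),
              ENNReal.ofReal_one, ENNReal.ofReal_coe_nnreal] at this
        _ ≤ _ := by
            rw [setLIntegral_const, mul_assoc]
            exact mul_le_mul' le_rfl ((measure_mono inter_subset_right).trans hB)
  have h2 : ∫⁻ x in Q, ‖grad y x - R‖ₑ ^ 2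
      ≤ (∫⁻ x in Q, ‖grad w x - R‖ₑ ^ 2) + (2 + 8 * 5 ^ d) * E := by
    rw [← lintegral_inter_add_sdiff (fun x => ‖grad y x - R‖ₑ ^ 2) Q hBm, add_comm]
    refine add_le_add ?_ ?_
    · calc ∫⁻ x in Q \ B, ‖grad y x - R‖ₑ ^ 2 = ∫⁻ x in Q \ B, ‖grad w x - R‖ₑ ^ 2 := by
            refine setLIntegral_congr_fun_ae (measurableSet_ball.diff hBm) ?_
            filter_upwards [hae] with x hx hxS
            rw [hx hxS]
        _ ≤ _ := lintegral_mono_set sdiff_subset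
    · calc ∫⁻ x in Q ∩ B, ‖grad y x - R‖ₑ ^ 2
          ≤ ∫⁻ x in Q ∩ B, (2 * ENNReal.ofReal (eg y x ^ 2) + 8) := by
            refine lintegral_mono fun x => ?_
            rw [sq_enorm_eq_ofReal, ← ENNReal.ofReal_ofNat 2, ← ENNReal.ofReal_ofNat 8,
              ← ENNReal.ofReal_mul (by norm_num), ← ENNReal.ofReal_add (by positivity) (by
                  norm_num)]
            refine ENNReal.ofReal_le_ofReal ?_
            have h3 := norm_sub_le (grad y x) R
            have h4 := norm_grad_le_eg y x
            have h5 := norm_le_one_of_mem_SOm hR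
            have h6 : ‖grad y x - R‖ ≤ eg y x + 2 := by linarith
            have := pow_le_pow_left₀ (norm_nonneg _) h6 2
            nlinarith [sq_nonneg (eg y x - 2)]
        _ ≤ 2 * E + 8 * (5 ^ d * E) := by
            rw [lintegral_add_left (hmE.const_mul _), lintegral_const_mul' _ _ (by norm_num),
              setLIntegral_const]
            refine add_le_add (mul_le_mul' le_rfl (lintegral_mono_set inter_subset_left))
              (mul_le_mul' le_rfl ((measure_mono inter_subset_right).trans hB))
        _ = _ := by ring
  refine h2.trans ((add_le_add_left (hRw'.trans (mul_le_mul' le_rfl h1)) _).trans (le_of_eq ?_))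
  push_cast
  ring

/-- The entries of a linear map in the standard basis. -/
noncomputable def entries {d : ℕ} (A : EuclideanSpace ℝ (Fin d) →L[ℝ] EuclideanSpace ℝ (Fin d)) :
    Fin d → Fin d → ℝ := fun i j => A (EuclideanSpace.single j 1) i

lemma entries_sub {d : ℕ} (A B : EuclideanSpace ℝ (Fin d) →L[ℝ] EuclideanSpace ℝ (Fin d)) :
    entries (A - B) = entries A - entries B := rfl

lemma exists_entries_eq {d : ℕ} (M : Fin d → Fin d → ℝ) :
    ∃ A : EuclideanSpace ℝ (Fin d) →L[ℝ] EuclideanSpace ℝ (Fin d), entries A = M := by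
  refine ⟨LinearMap.toContinuousLinearMap (Matrix.toEuclideanLin (Matrix.of M)), ?_⟩
  funext i j
  simp [entries]

lemma toMatrix_eq_entries {d : ℕ} (A : EuclideanSpace ℝ (Fin d) →L[ℝ] EuclideanSpace ℝ (Fin d)) :
    LinearMap.toMatrix (EuclideanSpace.basisFun (Fin d) ℝ).toBasis
      (EuclideanSpace.basisFun (Fin d) ℝ).toBasis (A : EuclideanSpace ℝ (Fin d) →ₗ[ℝ] _)
      = Matrix.of (entries A) := by
  ext i j
  simp [LinearMap.toMatrix_apply, entries]

lemma entries_mul_transpose {d : ℕ}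
    (A : EuclideanSpace ℝ (Fin d) →L[ℝ] EuclideanSpace ℝ (Fin d)) (i j : Fin d) :
    ((Matrix.of (entries A)).transpose * Matrix.of (entries A)) i j
      = inner ℝ (A (EuclideanSpace.basisFun (Fin d) ℝ i)) (A (EuclideanSpace.basisFun (Fin d) ℝ j))
          := by
  rw [PiLp.inner_apply, Matrix.mul_apply]
  refine Finset.sum_congr rfl fun k _ => ?_
  simp [entries, mul_comm]

lemma mem_SOcl_iff {d : ℕ} {A : EuclideanSpace ℝ (Fin d) →L[ℝ] EuclideanSpace ℝ (Fin d)} :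
    A ∈ SOcl d ↔ entries A ∈ SOm d := by
  have hdet : (Matrix.of (entries A)).det
      = LinearMap.det (A : EuclideanSpace ℝ (Fin d) →ₗ[ℝ] EuclideanSpace ℝ (Fin d)) := by
    rw [← toMatrix_eq_entries, LinearMap.det_toMatrix]
  constructor
  · rintro ⟨h1, h2⟩
    refine ⟨?_, hdet.trans h2⟩
    ext i j
    rw [entries_mul_transpose]
    have h3 := (LinearIsometry.mk (A : EuclideanSpace ℝ (Fin d) →ₗ[ℝ] EuclideanSpace ℝ (Fin d))
      h1).inner_map_map (EuclideanSpace.basisFun (Fin d) ℝ i) (EuclideanSpace.basisFun (Fin d) ℝ j)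
    refine h3.trans ?_
    rw [Matrix.one_apply]
    exact orthonormal_iff_ite.1 (EuclideanSpace.basisFun (Fin d) ℝ).orthonormal i j
  · rintro ⟨h1, h2⟩
    refine ⟨fun x => ?_, hdet.symm.trans h2⟩
    have ho : Orthonormal ℝ ((A : EuclideanSpace ℝ (Fin d) →ₗ[ℝ] EuclideanSpace ℝ (Fin d)) ∘
        (EuclideanSpace.basisFun (Fin d) ℝ).toBasis) := by
      rw [orthonormal_iff_ite]
      intro i j
      have := congrFun (congrFun h1 i) j
      rw [entries_mul_transpose, Matrix.one_apply] at this
      simpa using this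
    have hb : Orthonormal ℝ (EuclideanSpace.basisFun (Fin d) ℝ).toBasis := by
      simp
    exact ((A : EuclideanSpace ℝ (Fin d) →ₗ[ℝ] EuclideanSpace ℝ (Fin d)).isometryOfOrthonormal
      hb ho).norm_map x

lemma norm_entries_le {d : ℕ} (A : EuclideanSpace ℝ (Fin d) →L[ℝ] EuclideanSpace ℝ (Fin d)) :
    ‖entries A‖ ≤ ‖A‖ := by
  refine (pi_norm_le_iff_of_nonneg (norm_nonneg _)).2 fun i =>
    (pi_norm_le_iff_of_nonneg (norm_nonneg _)).2 fun j => ?_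
  refine (PiLp.norm_apply_le (A (EuclideanSpace.single j 1)) i).trans ?_
  simpa using A.le_opNorm (EuclideanSpace.single j 1)

lemma norm_le_entries {d : ℕ} (A : EuclideanSpace ℝ (Fin d) →L[ℝ] EuclideanSpace ℝ (Fin d)) :
    ‖A‖ ≤ d ^ 2 * ‖entries A‖ := by
  refine A.opNorm_le_bound (by positivity) fun x => ?_
  have hsum : ∀ v : EuclideanSpace ℝ (Fin d), v = ∑ j, v j • EuclideanSpace.single j (1 : ℝ) := by
    intro v
    conv_lhs => rw [← (EuclideanSpace.basisFun (Fin d) ℝ).sum_repr v]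
    simp
  have hcol : ∀ j, ‖A (EuclideanSpace.single j 1)‖ ≤ d * ‖entries A‖ := by
    intro j
    conv_lhs => rw [hsum (A (EuclideanSpace.single j 1))]
    refine (norm_sum_le _ _).trans ?_
    calc ∑ i, ‖(A (EuclideanSpace.single j 1)) i • EuclideanSpace.single i (1 : ℝ)‖
        ≤ ∑ i : Fin d, ‖entries A‖ := by
          refine Finset.sum_le_sum fun i _ => ?_
          rw [norm_smul, PiLp.norm_single, norm_one, mul_one]
          exact abs_entry_le_norm (entries A) i j
      _ = _ := by simp
  conv_lhs => rw [hsum x, map_sum]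
  refine (norm_sum_le _ _).trans ?_
  calc ∑ j, ‖A (x j • EuclideanSpace.single j 1)‖ ≤ ∑ j : Fin d, ‖x‖ * (d * ‖entries A‖) := by
        refine Finset.sum_le_sum fun j _ => ?_
        rw [map_smul, norm_smul]
        exact mul_le_mul (PiLp.norm_apply_le x j) (hcol j) (norm_nonneg _) (norm_nonneg _)
    _ = _ := by simp; ring

lemma infDist_entries_le {d : ℕ} (A : EuclideanSpace ℝ (Fin d) →L[ℝ] EuclideanSpace ℝ (Fin d)) :
    Metric.infDist (entries A) (SOm d) ≤ Metric.infDist A (SOcl d) := by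
  have hne : (SOcl d).Nonempty := by
    obtain ⟨A, hA⟩ := exists_entries_eq (fun i j => (1 : Matrix (Fin d) (Fin d) ℝ) i j)
    exact ⟨A, mem_SOcl_iff.2 (hA ▸ one_mem_SOm d)⟩
  refine (Metric.le_infDist hne).2 fun B hB => ?_
  refine (Metric.infDist_le_dist_of_mem (mem_SOcl_iff.1 hB)).trans ?_
  rw [dist_eq_norm, dist_eq_norm, ← entries_sub]
  exact norm_entries_le _

/-- The open cube with center `p` and half side `ρ`. -/
def openCube {d : ℕ} (p : EuclideanSpace ℝ (Fin d)) (ρ : ℝ) : Set (EuclideanSpace ℝ (Fin d)) :=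
  {x | ∀ i, |x i - p i| < ρ}

lemma preimage_openCube {d : ℕ} (p : EuclideanSpace ℝ (Fin d)) {ρ : ℝ} (hρ : 0 < ρ) :
    WithLp.toLp 2 ⁻¹' openCube p ρ = Metric.ball (WithLp.ofLp p) ρ := by
  ext x
  rw [mem_ball_iff_norm, pi_norm_lt_iff hρ]
  rfl

lemma isOpen_openCube {d : ℕ} (p : EuclideanSpace ℝ (Fin d)) (ρ : ℝ) : IsOpen (openCube p ρ) := by
  have : openCube p ρ = ⋂ i, {x | |x i - p i| < ρ} := by ext; simp [openCube]
  rw [this]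
  exact isOpen_iInter_of_finite fun i => isOpen_lt (by fun_prop) continuous_const

lemma setLIntegral_openCube {d : ℕ} (p : EuclideanSpace ℝ (Fin d)) {ρ : ℝ} (hρ : 0 < ρ)
    {g : EuclideanSpace ℝ (Fin d) → ENNReal} (hg : Measurable g) :
    ∫⁻ x in openCube p ρ, g x
      = ENNReal.ofReal (ρ ^ d) * ∫⁻ x in Metric.ball 0 1,
          g (WithLp.toLp 2 (WithLp.ofLp p + ρ • x)) := by
  rw [← (PiLp.volume_preserving_toLp (Fin d)).setLIntegral_comp_preimage
    (isOpen_openCube p ρ).measurableSet hg, preimage_openCube p hρ]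
  have := setLIntegral_comp_affine (WithLp.ofLp p) hρ 1 (g := fun x => g (WithLp.toLp 2 x))
    (hg.comp (PiLp.volume_preserving_toLp (Fin d)).measurable)
  rw [this, one_mul]

lemma grad_rescale {d : ℕ} {y : EuclideanSpace ℝ (Fin d) → EuclideanSpace ℝ (Fin d)}
    (p : Fin d → ℝ) {ρ : ℝ} (hρ : 0 < ρ) {x : Fin d → ℝ}
    (hy : DifferentiableAt ℝ y (WithLp.toLp 2 (p + ρ • x))) :
    (∀ i, DifferentiableAt ℝ (fun x => ρ⁻¹ * y (WithLp.toLp 2 (p + ρ • x)) i) x) ∧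
    grad (fun i x => ρ⁻¹ * y (WithLp.toLp 2 (p + ρ • x)) i) x
      = entries (fderiv ℝ y (WithLp.toLp 2 (p + ρ • x))) := by
  set T := (PiLp.continuousLinearEquiv 2 ℝ (fun _ : Fin d => ℝ)).symm with hT
  have h1 : HasFDerivAt (fun x : Fin d → ℝ => WithLp.toLp 2 (p + ρ • x))
      ((T : (Fin d → ℝ) →L[ℝ] EuclideanSpace ℝ (Fin d)).comp
        (ρ • ContinuousLinearMap.id ℝ (Fin d → ℝ))) x :=
    (T : (Fin d → ℝ) →L[ℝ] EuclideanSpace ℝ (Fin d)).hasFDerivAt.comp x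
      (((hasFDerivAt_id x).const_smul ρ).const_add p)
  have h2 := hy.hasFDerivAt.comp x h1
  have h3 : ∀ i, HasFDerivAt (fun x => ρ⁻¹ * y (WithLp.toLp 2 (p + ρ • x)) i)
      (ρ⁻¹ • ((EuclideanSpace.proj i).comp ((fderiv ℝ y (WithLp.toLp 2 (p + ρ • x))).comp
        ((T : (Fin d → ℝ) →L[ℝ] EuclideanSpace ℝ (Fin d)).comp
        (ρ • ContinuousLinearMap.id ℝ (Fin d → ℝ)))))) x := fun i =>
    (((EuclideanSpace.proj i : EuclideanSpace ℝ (Fin d) →L[ℝ] ℝ).hasFDerivAt).comp x h2).const_mul _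
  refine ⟨fun i => (h3 i).differentiableAt, ?_⟩
  funext i j
  rw [grad, pd, (h3 i).fderiv]
  have e : T (Pi.single j 1) = EuclideanSpace.single j 1 := rfl
  simp [e, entries, hρ.ne']

/-- The geometric rigidity estimate on cubes. -/
lemma exists_rigidity_openCube {d : ℕ} (hd : 0 < d) : ∃ C : NNReal,
    ∀ (p : EuclideanSpace ℝ (Fin d)) (ρ : ℝ), 0 < ρ →
    ∀ y : EuclideanSpace ℝ (Fin d) → EuclideanSpace ℝ (Fin d), DifferentiableOn ℝ y (openCube p ρ) →
      ∃ R ∈ SOcl d, ∫⁻ x in openCube p ρ, ‖fderiv ℝ y x - R‖ₑ ^ 2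
        ≤ C * ∫⁻ x in openCube p ρ, ENNReal.ofReal (Metric.infDist (fderiv ℝ y x) (SOcl d) ^ 2) :=
            by
  obtain ⟨C, hC⟩ := exists_rigidity_unit hd
  refine ⟨(d ^ 2) ^ 2 * C, fun p ρ hρ y hy => ?_⟩
  set Y : Fin d → (Fin d → ℝ) → ℝ := fun i x => ρ⁻¹ * y (WithLp.toLp 2 (WithLp.ofLp p + ρ • x)) i
    with hY
  have hdiff : ∀ x ∈ Metric.ball (0 : Fin d → ℝ) 1,
      DifferentiableAt ℝ y (WithLp.toLp 2 (WithLp.ofLp p + ρ • x)) := by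
    intro x hx
    refine hy.differentiableAt ((isOpen_openCube p ρ).mem_nhds ?_)
    rw [← mem_preimage, preimage_openCube p hρ, mem_ball_iff_norm, add_sub_cancel_left, norm_smul,
      Real.norm_eq_abs, abs_of_pos hρ]
    rw [mem_ball_zero_iff] at hx
    nlinarith
  obtain ⟨M, hM, hle⟩ := hC Y fun i x hx =>
    ((grad_rescale _ hρ (hdiff x hx)).1 i).differentiableWithinAt
  obtain ⟨R, rfl⟩ := exists_entries_eq M
  refine ⟨R, mem_SOcl_iff.2 hM, ?_⟩
  have hm := measurable_fderiv ℝ y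
  have hmI : Measurable fun x => Metric.infDist (fderiv ℝ y x) (SOcl d) :=
    (Metric.continuous_infDist_pt _).measurable.comp hm
  rw [setLIntegral_openCube p hρ ((hm.sub_const R).enorm.pow_const 2),
    setLIntegral_openCube p hρ (hmI.pow_const 2).ennreal_ofReal, mul_left_comm]
  refine mul_le_mul' le_rfl ?_
  calc ∫⁻ x in Metric.ball 0 1, ‖fderiv ℝ y (WithLp.toLp 2 (WithLp.ofLp p + ρ • x)) - R‖ₑ ^ 2
      ≤ ∫⁻ x in Metric.ball 0 1, ENNReal.ofReal (((d : ℝ) ^ 2) ^ 2) * ‖grad Y x - entries R‖ₑ ^ 2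
          := by
        refine setLIntegral_mono' measurableSet_ball fun x hx => ?_
        rw [(grad_rescale _ hρ (hdiff x hx)).2, ← entries_sub, sq_enorm_eq_ofReal,
          sq_enorm_eq_ofReal, ← ENNReal.ofReal_mul (by positivity), ← mul_pow]
        exact ENNReal.ofReal_le_ofReal (pow_le_pow_left₀ (norm_nonneg _) (norm_le_entries _) 2)
    _ ≤ ENNReal.ofReal (((d : ℝ) ^ 2) ^ 2) * (C * ∫⁻ x in Metric.ball 0 1,
          ENNReal.ofReal (eg Y x ^ 2)) := by
        rw [lintegral_const_mul' _ _ ENNReal.ofReal_ne_top]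
        exact mul_le_mul' le_rfl hle
    _ = ((d ^ 2) ^ 2 * C : NNReal) * ∫⁻ x in Metric.ball 0 1, ENNReal.ofReal (eg Y x ^ 2) := by
        rw [ENNReal.ofReal_pow (by positivity), ENNReal.ofReal_pow (by positivity),
          ENNReal.ofReal_natCast]
        push_cast
        ring
    _ ≤ _ := by
        refine mul_le_mul' le_rfl (setLIntegral_mono' measurableSet_ball fun x hx => ?_)
        refine ENNReal.ofReal_le_ofReal (pow_le_pow_left₀ (eg_nonneg Y x) ?_ 2)
        rw [eg, (grad_rescale _ hρ (hdiff x hx)).2]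
        exact infDist_entries_le _

/-- The closed cube with center `p` and half side `ρ`. -/
def closedCube {d : ℕ} (p : EuclideanSpace ℝ (Fin d)) (ρ : ℝ) : Set (EuclideanSpace ℝ (Fin d)) :=
  {x | ∀ i, |x i - p i| ≤ ρ}

lemma preimage_closedCube {d : ℕ} (p : EuclideanSpace ℝ (Fin d)) {ρ : ℝ} (hρ : 0 < ρ) :
    WithLp.toLp 2 ⁻¹' closedCube p ρ = Metric.closedBall (WithLp.ofLp p) ρ := by
  ext x
  rw [mem_closedBall_iff_norm, pi_norm_le_iff_of_nonneg hρ.le]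
  rfl

lemma isClosed_closedCube {d : ℕ} (p : EuclideanSpace ℝ (Fin d)) (ρ : ℝ) :
    IsClosed (closedCube p ρ) := by
  have : closedCube p ρ = ⋂ i, {x | |x i - p i| ≤ ρ} := by ext; simp [closedCube]
  rw [this]
  exact isClosed_iInter fun i => isClosed_le (by fun_prop) continuous_const

lemma openCube_subset_closedCube {d : ℕ} (p : EuclideanSpace ℝ (Fin d)) (ρ : ℝ) :
    openCube p ρ ⊆ closedCube p ρ := fun _ hx i => (hx i).le

lemma volume_openCube {d : ℕ} (p : EuclideanSpace ℝ (Fin d)) {ρ : ℝ} (hρ : 0 < ρ) :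
    volume (openCube p ρ) = ENNReal.ofReal ((2 * ρ) ^ d) := by
  rw [← (PiLp.volume_preserving_toLp (Fin d)).measure_preimage
    (isOpen_openCube p ρ).measurableSet.nullMeasurableSet, preimage_openCube p hρ,
    volume_ball_pi _ hρ]

lemma closedCube_ae_eq {d : ℕ} (p : EuclideanSpace ℝ (Fin d)) {ρ : ℝ} (hρ : 0 < ρ) :
    openCube p ρ =ᵐ[volume] closedCube p ρ := by
  have h : volume (closedCube p ρ) = ENNReal.ofReal ((2 * ρ) ^ d) := by
    rw [← (PiLp.volume_preserving_toLp (Fin d)).measure_preimage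
      (isClosed_closedCube p ρ).measurableSet.nullMeasurableSet, preimage_closedCube p hρ,
      Real.volume_pi_closedBall _ hρ.le, Fintype.card_fin]
  refine ae_eq_of_subset_of_measure_ge (openCube_subset_closedCube p ρ)
    (by rw [h, volume_openCube p hρ]) (isOpen_openCube p ρ).measurableSet.nullMeasurableSet ?_
  rw [h]
  exact ENNReal.ofReal_ne_top

lemma sq_enorm_sub_mul_volume_le {X E : Type*} [MeasureSpace X] [NormedAddCommGroup E]
    [MeasurableSpace E] [OpensMeasurableSpace E] [MeasurableSub E] {F : X → E}
    (hF : Measurable F) {S A B : Set X} (hA : S ⊆ A) (hB : S ⊆ B) (R R' : E) :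
    ‖R - R'‖ₑ ^ 2 * volume S
      ≤ 2 * (∫⁻ x in A, ‖F x - R‖ₑ ^ 2) + 2 * ∫⁻ x in B, ‖F x - R'‖ₑ ^ 2 := by
  calc ‖R - R'‖ₑ ^ 2 * volume S = ∫⁻ x in S, ‖R - R'‖ₑ ^ 2 := by rw [setLIntegral_const]
    _ ≤ ∫⁻ x in S, (2 * ‖F x - R‖ₑ ^ 2 + 2 * ‖F x - R'‖ₑ ^ 2) := by
        refine lintegral_mono fun x => ?_
        rw [enorm_sub_rev (F x) R]
        exact sq_enorm_sub_le R (F x) R'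
    _ = 2 * (∫⁻ x in S, ‖F x - R‖ₑ ^ 2) + 2 * ∫⁻ x in S, ‖F x - R'‖ₑ ^ 2 := by
        rw [lintegral_add_left (((hF.sub_const R).enorm.pow_const 2).const_mul 2),
          lintegral_const_mul' _ _ (by norm_num), lintegral_const_mul' _ _ (by norm_num)]
    _ ≤ _ := add_le_add (mul_le_mul' le_rfl (lintegral_mono_set hA))
        (mul_le_mul' le_rfl (lintegral_mono_set hB))

/-- Good rotations on two cubes sharing a face are close to each other. -/
lemma rotation_sub_le_of_adjacent {d : ℕ} {C : ENNReal}
    {e : EuclideanSpace ℝ (Fin d) → ENNReal}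
    {F : EuclideanSpace ℝ (Fin d) → EuclideanSpace ℝ (Fin d) →L[ℝ] EuclideanSpace ℝ (Fin d)}
    (hF : Measurable F) {r : ℝ} (hr : 0 < r)
    {p m p' : EuclideanSpace ℝ (Fin d)} {i : Fin d}
    (hm : m = p + EuclideanSpace.single i (r / 2)) (hp' : p' = p + EuclideanSpace.single i r)
    {R S R' : EuclideanSpace ℝ (Fin d) →L[ℝ] EuclideanSpace ℝ (Fin d)}
    (hR : ∫⁻ x in openCube p (r / 2), ‖F x - R‖ₑ ^ 2 ≤ C * ∫⁻ x in openCube p (r / 2), e x)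
    (hS : ∫⁻ x in openCube m (r / 2), ‖F x - S‖ₑ ^ 2 ≤ C * ∫⁻ x in openCube m (r / 2), e x)
    (hR' : ∫⁻ x in openCube p' (r / 2), ‖F x - R'‖ₑ ^ 2 ≤ C * ∫⁻ x in openCube p' (r / 2), e x) :
    ‖R - R'‖ₑ ^ 2 * ENNReal.ofReal ((r / 2) ^ d)
      ≤ 12 * C * ((∫⁻ x in openCube p (r / 2), e x) + ∫⁻ x in openCube p' (r / 2), e x) := by
  set a := ∫⁻ x in openCube p (r / 2), e x with ha
  set b := ∫⁻ x in openCube p' (r / 2), e x with hb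
  have hmi : ∀ j, m j = p j + if j = i then r / 2 else 0 := by
    intro j; rw [hm]; simp
  have hpi : ∀ j, p' j = p j + if j = i then r else 0 := by
    intro j; rw [hp']; simp
  have hM : ∫⁻ x in openCube m (r / 2), e x ≤ a + b := by
    rw [ha, hb, setLIntegral_congr (closedCube_ae_eq p (half_pos hr)),
      setLIntegral_congr (closedCube_ae_eq p' (half_pos hr))]
    refine (lintegral_mono_set fun x hx => ?_).trans (lintegral_union_le _ _ _)
    have hxi := hx i
    rw [hmi, if_pos rfl, abs_lt] at hxi
    rcases le_total (x i - p i) (r / 2) with h | h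
    · left
      intro j
      have hxj := hx j
      rw [hmi, abs_lt] at hxj
      rw [abs_le]
      split_ifs at hxj with hj
      · subst hj; constructor <;> linarith
      · constructor <;> linarith
    · right
      intro j
      have hxj := hx j
      rw [hmi, abs_lt] at hxj
      rw [hpi, abs_le]
      split_ifs at hxj ⊢ with hj
      · subst hj; constructor <;> linarith
      · constructor <;> linarith
  have sub : ∀ (s t : ℝ) (q w : EuclideanSpace ℝ (Fin d)),
      (∀ j, q j = p j + if j = i then s else 0) → (∀ j, w j = p j + if j = i then t else 0) →
      |s - t| ≤ r / 4 → openCube q (r / 4) ⊆ openCube w (r / 2) := by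
    intro s t q w hq hw hst x hx j
    have hxj := hx j
    rw [hq, abs_lt] at hxj
    rw [hw, abs_lt]
    rw [abs_le] at hst
    split_ifs at hxj ⊢ with hj
    · constructor <;> linarith
    · constructor <;> linarith
  have hq : ∀ s : ℝ, ∀ j, (p + EuclideanSpace.single i s) j = p j + if j = i then s else 0 := by
    intro s j; simp
  have h0 : ∀ j, p j = p j + if j = i then (0 : ℝ) else 0 := by simp
  have k1 := sq_enorm_sub_mul_volume_le hF
    (sub (r / 4) 0 _ p (hq _) h0 (by rw [sub_zero, abs_of_pos (by linarith)]))
    (sub (r / 4) (r / 2) _ m (hq _) hmi (by rw [abs_le]; constructor <;> linarith)) R S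
  have k2 := sq_enorm_sub_mul_volume_le hF
    (sub (3 * r / 4) (r / 2) _ m (hq _) hmi (by rw [abs_le]; constructor <;> linarith))
    (sub (3 * r / 4) r _ p' (hq _) hpi (by rw [abs_le]; constructor <;> linarith)) S R'
  rw [volume_openCube _ (by positivity), show 2 * (r / 4) = r / 2 by ring] at k1 k2
  have hSM := hS.trans (mul_le_mul' le_rfl hM)
  calc ‖R - R'‖ₑ ^ 2 * ENNReal.ofReal ((r / 2) ^ d)
      ≤ (2 * ‖R - S‖ₑ ^ 2 + 2 * ‖S - R'‖ₑ ^ 2) * ENNReal.ofReal ((r / 2) ^ d) :=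
        mul_le_mul' (sq_enorm_sub_le R S R') le_rfl
    _ = 2 * (‖R - S‖ₑ ^ 2 * ENNReal.ofReal ((r / 2) ^ d))
        + 2 * (‖S - R'‖ₑ ^ 2 * ENNReal.ofReal ((r / 2) ^ d)) := by ring
    _ ≤ 2 * (2 * (C * a) + 2 * (C * (a + b))) + 2 * (2 * (C * (a + b)) + 2 * (C * b)) := by
        refine add_le_add (mul_le_mul' le_rfl (k1.trans ?_)) (mul_le_mul' le_rfl (k2.trans ?_))
        · exact add_le_add (mul_le_mul' le_rfl hR) (mul_le_mul' le_rfl hSM)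
        · exact add_le_add (mul_le_mul' le_rfl hSM) (mul_le_mul' le_rfl hR')
    _ = _ := by ring

lemma closure_openCube {d : ℕ} (p : EuclideanSpace ℝ (Fin d)) {ρ : ℝ} (hρ : 0 < ρ) :
    closure (openCube p ρ) = closedCube p ρ := by
  refine Subset.antisymm (closure_minimal (openCube_subset_closedCube p ρ)
    (isClosed_closedCube p ρ)) fun x hx => ?_
  have hlim : Filter.Tendsto (fun t : ℝ => x + t • (p - x)) (nhdsWithin 0 (Ioi 0)) (nhds x) := by
    have : Continuous fun t : ℝ => x + t • (p - x) := by fun_prop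
    have h := this.tendsto 0
    simp only [zero_smul, add_zero] at h
    exact h.mono_left nhdsWithin_le_nhds
  refine mem_closure_of_tendsto hlim ?_
  filter_upwards [Ioo_mem_nhdsGT (zero_lt_one (α := ℝ))] with t ht i
  have e : (x + t • (p - x)) i - p i = (1 - t) * (x i - p i) := by simp; ring
  rw [e, abs_mul, abs_of_pos (by linarith [ht.2])]
  have := hx i
  nlinarith [ht.1, ht.2]

/-- The point `r • z`. -/
noncomputable def gridPoint {d : ℕ} (r : ℝ) (z : Fin d → ℤ) : EuclideanSpace ℝ (Fin d) :=
  WithLp.toLp 2 fun i => r * z i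

lemma closure_smallCube {d : ℕ} {r : ℝ} (hr : 0 < r) (z : Fin d → ℤ) :
    closure (smallCube d r z) = closedCube (gridPoint r z) (r / 2) := by
  refine Subset.antisymm (closure_minimal (fun x hx i => ?_) (isClosed_closedCube _ _)) ?_
  · obtain ⟨h1, h2⟩ := hx i
    rw [abs_le]
    simp only [gridPoint]
    constructor <;> linarith
  · rw [← closure_openCube _ (half_pos hr)]
    refine closure_mono fun x hx i => ?_
    have := abs_lt.1 (hx i)
    simp only [gridPoint] at this
    constructor <;> linarith [this.1, this.2]

lemma finite_setOf_smallCube_meets {d : ℕ} {r : ℝ} (hr : 0 < r) {U : Set (EuclideanSpace ℝ (Fin d))}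
    (hU : Bornology.IsBounded U) : {z : Fin d → ℤ | (smallCube d r z ∩ U).Nonempty}.Finite := by
  obtain ⟨M, hM⟩ := hU.exists_norm_le
  obtain ⟨n, hn⟩ := exists_nat_ge ((M + r) / r)
  refine (Set.finite_Icc (fun _ : Fin d => -(n : ℤ)) (fun _ => (n : ℤ))).subset ?_
  rintro z ⟨x, hx, hxU⟩
  have h1 : ∀ i, |x i| ≤ M := fun i => (PiLp.norm_apply_le x i).trans (hM x hxU)
  rw [div_le_iff₀ hr] at hn
  constructor
  · intro i
    have := (abs_le.1 (h1 i)).1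
    have h2 := (hx i).2
    have h3 : r * (-(n : ℝ)) ≤ r * z i := by linarith
    have := le_of_mul_le_mul_left h3 hr
    exact_mod_cast this
  · intro i
    have := (abs_le.1 (h1 i)).2
    have h2 := (hx i).1
    have h3 : r * z i ≤ r * n := by linarith
    have := le_of_mul_le_mul_left h3 hr
    exact_mod_cast this

/-- The interior of the union of the closed grid cubes with indices in `Z`. -/
def cubeUnion {d : ℕ} (r : ℝ) (Z : Set (Fin d → ℤ)) : Set (EuclideanSpace ℝ (Fin d)) :=
  interior (⋃ z ∈ Z, closedCube (gridPoint r z) (r / 2))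

lemma cubicSet_eq_cubeUnion {d : ℕ} {r : ℝ} (hr : 0 < r) (U : Set (EuclideanSpace ℝ (Fin d))) :
    cubicSet d r U = cubeUnion r {z | (smallCube d r z ∩ U).Nonempty} := by
  simp only [cubicSet, cubeUnion, closure_smallCube hr]

lemma eq_of_mem_cubes {d : ℕ} {r : ℝ} (hr : 0 < r) {z z' : Fin d → ℤ}
    {x : EuclideanSpace ℝ (Fin d)} (h : x ∈ openCube (gridPoint r z) (r / 2))
    (h' : x ∈ closedCube (gridPoint r z') (r / 2)) : z = z' := by
  funext i
  have h1 := abs_lt.1 (h i)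
  have h2 := abs_le.1 (h' i)
  simp only [gridPoint] at h1 h2
  have h3 : r * (z i : ℝ) < r * (z' i + 1) := by linarith
  have h4 : r * (z' i : ℝ) < r * (z i + 1) := by linarith
  have h5 := lt_of_mul_lt_mul_left h3 hr.le
  have h6 := lt_of_mul_lt_mul_left h4 hr.le
  norm_cast at h5 h6
  lia

lemma openCube_subset_cubeUnion {d : ℕ} {r : ℝ} {Z : Set (Fin d → ℤ)} {z : Fin d → ℤ} (hz : z ∈ Z) :
    openCube (gridPoint r z) (r / 2) ⊆ cubeUnion r Z :=
  interior_maximal ((openCube_subset_closedCube _ _).trans (subset_biUnion_of_mem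
    (u := fun z => closedCube (gridPoint r z) (r / 2)) hz)) (isOpen_openCube _ _)

lemma mem_of_mem_cubeUnion {d : ℕ} {r : ℝ} (hr : 0 < r) {Z : Set (Fin d → ℤ)} {z : Fin d → ℤ}
    {x : EuclideanSpace ℝ (Fin d)} (hx : x ∈ cubeUnion r Z)
    (hxz : x ∈ closedCube (gridPoint r z) (r / 2)) : z ∈ Z := by
  rw [← closure_openCube _ (half_pos hr)] at hxz
  obtain ⟨w, hw, hwz⟩ := mem_closure_iff.1 hxz _ isOpen_interior hx
  obtain ⟨z', hz', hwz'⟩ := mem_iUnion₂.1 (interior_subset hw)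
  rwa [eq_of_mem_cubes hr hwz hwz']

/-- Two indices are adjacent when they differ by one in exactly one coordinate. -/
def GridAdj {d : ℕ} (z z' : Fin d → ℤ) : Prop :=
  ∃ i, z' = z + Pi.single i 1 ∨ z = z' + Pi.single i 1

lemma GridAdj.symm {d : ℕ} {z z' : Fin d → ℤ} (h : GridAdj z z') : GridAdj z' z :=
  h.imp fun _ => Or.symm

/-- The graph of adjacent cubes. -/
def cubeGraph {d : ℕ} (Z : Set (Fin d → ℤ)) : SimpleGraph Z :=
  SimpleGraph.mk (fun z z' => GridAdj z.1 z'.1) ⟨fun _ _ => GridAdj.symm⟩ (by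
    constructor
    rintro z ⟨i, h | h⟩
    all_goals
      have := congrFun h i
      simp at this)

lemma abs_sub_le_one_of_mem_closedCube {d : ℕ} {r : ℝ} (hr : 0 < r) {z z' : Fin d → ℤ}
    {x : EuclideanSpace ℝ (Fin d)} {i : Fin d} (h : |x i - gridPoint r z i| ≤ r / 2)
    (h' : |x i - gridPoint r z' i| ≤ r / 2) : z i ≤ z' i + 1 := by
  rw [abs_le] at h h'
  simp only [gridPoint] at h h'
  have h3 : r * (z i : ℝ) ≤ r * (z' i + 1) := by linarith
  have := le_of_mul_le_mul_left h3 hr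
  exact_mod_cast this

/-- Cubes containing a common point of the cubic set are joined by chains of adjacent cubes. -/
lemma reachable_of_mem {d : ℕ} {r : ℝ} (hr : 0 < r) {Z : Set (Fin d → ℤ)}
    {x : EuclideanSpace ℝ (Fin d)} (hx : x ∈ cubeUnion r Z) {z z' : Z}
    (hz : x ∈ closedCube (gridPoint r z.1) (r / 2))
    (hz' : x ∈ closedCube (gridPoint r z'.1) (r / 2)) : (cubeGraph Z).Reachable z z' := by
  have hmem : ∀ s : Finset (Fin d),
      x ∈ closedCube (gridPoint r (s.piecewise z'.1 z.1)) (r / 2) := by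
    intro s i
    have h1 := hz i
    have h2 := hz' i
    simp only [gridPoint, Finset.piecewise] at h1 h2 ⊢
    split_ifs
    · exact h2
    · exact h1
  have key : ∀ s : Finset (Fin d), (cubeGraph Z).Reachable z
      ⟨s.piecewise z'.1 z.1, mem_of_mem_cubeUnion hr hx (hmem s)⟩ := by
    intro s
    induction s using Finset.induction_on with
    | empty =>
      simp only [Finset.piecewise_empty]
      exact SimpleGraph.Reachable.refl _
    | insert i s hi ih =>
      refine ih.trans ?_
      by_cases he : z'.1 i = z.1 i
      · have : (insert i s).piecewise z'.1 z.1 = s.piecewise z'.1 z.1 := by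
          rw [Finset.piecewise_insert]
          rw [Function.update_eq_self_iff, Finset.piecewise_eq_of_notMem _ _ _ hi, he]
        simp only [this]
        exact SimpleGraph.Reachable.refl _
      · refine SimpleGraph.Adj.reachable (show GridAdj _ _ from ⟨i, ?_⟩)
        have b1 := abs_sub_le_one_of_mem_closedCube hr (hz i) (hz' i)
        have b2 := abs_sub_le_one_of_mem_closedCube hr (hz' i) (hz i)
        rcases lt_or_gt_of_ne he with h | h
        · right
          funext j
          change s.piecewise z'.1 z.1 j = ((insert i s).piecewise z'.1 z.1
              + Pi.single i 1 : Fin d → ℤ) j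
          rw [Finset.piecewise_insert]
          by_cases hj : j = i
          · subst hj
            simp [Finset.piecewise_eq_of_notMem _ _ _ hi]
            lia
          · simp [hj]
        · left
          funext j
          change (insert i s).piecewise z'.1 z.1 j = (s.piecewise z'.1 z.1
              + Pi.single i 1 : Fin d → ℤ) j
          rw [Finset.piecewise_insert]
          by_cases hj : j = i
          · subst hj
            simp [Finset.piecewise_eq_of_notMem _ _ _ hi]
            lia
          · simp [hj]
  have := key Finset.univ
  simpa only [Finset.piecewise_univ] using this

lemma cubeGraph_preconnected {d : ℕ} {r : ℝ} (hr : 0 < r) {Z : Set (Fin d → ℤ)} (hZ : Z.Finite)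
    (hc : IsPreconnected (cubeUnion r Z)) : (cubeGraph Z).Preconnected := by
  intro z₀ z₁
  by_contra hnr
  set A : Set (EuclideanSpace ℝ (Fin d)) := ⋃ z ∈ {z : Z | (cubeGraph Z).Reachable z₀ z},
    closedCube (gridPoint r z.1) (r / 2) with hA
  set B : Set (EuclideanSpace ℝ (Fin d)) := ⋃ z ∈ {z : Z | ¬ (cubeGraph Z).Reachable z₀ z},
    closedCube (gridPoint r z.1) (r / 2) with hB
  have := hZ.to_subtype
  have hAc : IsClosed A := (Set.toFinite _).isClosed_biUnion fun _ _ => isClosed_closedCube _ _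
  have hBc : IsClosed B := (Set.toFinite _).isClosed_biUnion fun _ _ => isClosed_closedCube _ _
  have hcen : ∀ z : Fin d → ℤ, gridPoint r z ∈ openCube (gridPoint r z) (r / 2) := by
    intro z i
    rw [sub_self, abs_zero]
    exact half_pos hr
  obtain ⟨x, hx, hxA, hxB⟩ := isPreconnected_closed_iff.1 hc A B hAc hBc (fun x hx => by
      obtain ⟨z, hz, hxz⟩ := mem_iUnion₂.1 (interior_subset hx)
      by_cases h : (cubeGraph Z).Reachable z₀ ⟨z, hz⟩
      · exact Or.inl (mem_iUnion₂.2 ⟨⟨z, hz⟩, h, hxz⟩)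
      · exact Or.inr (mem_iUnion₂.2 ⟨⟨z, hz⟩, h, hxz⟩))
    ⟨gridPoint r z₀.1, openCube_subset_cubeUnion z₀.2 (hcen _),
      mem_iUnion₂.2 ⟨z₀, SimpleGraph.Reachable.refl _, openCube_subset_closedCube _ _ (hcen _)⟩⟩
    ⟨gridPoint r z₁.1, openCube_subset_cubeUnion z₁.2 (hcen _),
      mem_iUnion₂.2 ⟨z₁, hnr, openCube_subset_closedCube _ _ (hcen _)⟩⟩
  obtain ⟨z, hz, hxz⟩ := mem_iUnion₂.1 hxA
  obtain ⟨z', hz', hxz'⟩ := mem_iUnion₂.1 hxB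
  exact hz' (hz.trans (reachable_of_mem hr hx hxz hxz'))

lemma SimpleGraph.Walk.norm_sub_le {V E : Type*} [SeminormedAddCommGroup E] {G : SimpleGraph V}
    {R : V → E} {a : V → ℝ} (ha : ∀ v, 0 ≤ a v) {K : ℝ} (hK : 0 ≤ K)
    (h : ∀ u v, G.Adj u v → ‖R u - R v‖ ≤ K * (a u + a v)) {u v : V} (p : G.Walk u v) :
    ‖R u - R v‖ + K * a u ≤ 2 * K * (p.support.map a).sum := by
  induction p with
  | @nil u =>
    simp only [sub_self, norm_zero, SimpleGraph.Walk.support_nil, List.map_cons, List.map_nil,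
      List.sum_cons, List.sum_nil]
    nlinarith [mul_nonneg hK (ha u)]
  | @cons u w v huw p ih =>
    simp only [SimpleGraph.Walk.support_cons, List.map_cons, List.sum_cons]
    have h1 := h _ _ huw
    have h2 := norm_sub_le_norm_sub_add_norm_sub (R u) (R w) (R v)
    linarith

lemma SimpleGraph.Preconnected.norm_sub_le {V E : Type*} [Fintype V] [SeminormedAddCommGroup E]
    {G : SimpleGraph V} (hG : G.Preconnected) {R : V → E} {a : V → ℝ} (ha : ∀ v, 0 ≤ a v) {K : ℝ}
    (hK : 0 ≤ K) (h : ∀ u v, G.Adj u v → ‖R u - R v‖ ≤ K * (a u + a v)) (u v : V) :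
    ‖R u - R v‖ ≤ 2 * K * ∑ w, a w := by
  classical
  obtain ⟨p, hp⟩ := (hG u v).exists_isPath
  have h1 := p.norm_sub_le ha hK h
  have h2 : (p.support.map a).sum ≤ ∑ w, a w := by
    rw [← List.sum_toFinset a hp.support_nodup]
    exact Finset.sum_le_sum_of_subset_of_nonneg (Finset.subset_univ _) fun w _ _ => ha w
  nlinarith [mul_nonneg hK (ha u), mul_le_mul_of_nonneg_left h2 hK]

lemma gridPoint_add_single {d : ℕ} (r : ℝ) (z : Fin d → ℤ) (i : Fin d) :
    gridPoint r (z + Pi.single i 1) = gridPoint r z + EuclideanSpace.single i r := by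
  ext j
  by_cases hj : j = i
  · subst hj
    simp [gridPoint, mul_add]
  · simp [gridPoint, hj]

/-- The cube centered on a common face of two adjacent cubes is contained in their union. -/
lemma openCube_subset_union {d : ℕ} {r : ℝ} (p : EuclideanSpace ℝ (Fin d)) (i : Fin d) :
    openCube (p + EuclideanSpace.single i (r / 2)) (r / 2)
      ⊆ closedCube p (r / 2) ∪ closedCube (p + EuclideanSpace.single i r) (r / 2) := by
  have hq : ∀ s : ℝ, ∀ j, (p + EuclideanSpace.single i s) j = p j + if j = i then s else 0 := by
    intro s j; simp
  intro x hx
  have hxi := hx i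
  rw [hq, if_pos rfl, abs_lt] at hxi
  rcases le_total (x i - p i) (r / 2) with h | h
  · left
    intro j
    have hxj := hx j
    rw [hq, abs_lt] at hxj
    rw [abs_le]
    split_ifs at hxj with hj
    · subst hj; constructor <;> linarith
    · constructor <;> linarith
  · right
    intro j
    have hxj := hx j
    rw [hq, abs_lt] at hxj
    rw [hq, abs_le]
    split_ifs at hxj ⊢ with hj
    · subst hj; constructor <;> linarith
    · constructor <;> linarith

lemma sum_lintegral_openCube_le {d : ℕ} {r : ℝ} (hr : 0 < r) (Z : Set (Fin d → ℤ)) [Fintype Z]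
    (f : EuclideanSpace ℝ (Fin d) → ENNReal) :
    ∑ z : Z, ∫⁻ x in openCube (gridPoint r z.1) (r / 2), f x ≤ ∫⁻ x in cubeUnion r Z, f x := by
  rw [← tsum_fintype (L := .unconditional _), ← lintegral_iUnion (fun z => (isOpen_openCube _
      _).measurableSet)]
  · exact lintegral_mono_set (iUnion_subset fun z => openCube_subset_cubeUnion z.2)
  · intro z z' hzz'
    refine Set.disjoint_left.2 fun x hx hx' => hzz' (Subtype.ext ?_)
    exact eq_of_mem_cubes hr hx (openCube_subset_closedCube _ _ hx')

lemma lintegral_cubeUnion_le_sum {d : ℕ} {r : ℝ} (hr : 0 < r) (Z : Set (Fin d → ℤ)) [Fintype Z]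
    (f : EuclideanSpace ℝ (Fin d) → ENNReal) :
    ∫⁻ x in cubeUnion r Z, f x ≤ ∑ z : Z, ∫⁻ x in openCube (gridPoint r z.1) (r / 2), f x := by
  have h : cubeUnion r Z ⊆ ⋃ z : Z, closedCube (gridPoint r z.1) (r / 2) := by
    rw [iUnion_subtype]
    exact interior_subset
  refine (lintegral_mono_set h).trans ((lintegral_iUnion_le _ _).trans ?_)
  rw [tsum_fintype]
  exact Finset.sum_le_sum fun z _ =>
    (setLIntegral_congr (closedCube_ae_eq (gridPoint r z.1) (half_pos hr))).symm.le

lemma norm_sub_le_of_gridAdj {d : ℕ} {r : ℝ} (hr : 0 < r) {C : NNReal} {Z : Set (Fin d → ℤ)}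
    {e : EuclideanSpace ℝ (Fin d) → ENNReal}
    {F : EuclideanSpace ℝ (Fin d) → EuclideanSpace ℝ (Fin d) →L[ℝ] EuclideanSpace ℝ (Fin d)}
    (hF : Measurable F)
    (hC : ∀ p, openCube p (r / 2) ⊆ cubeUnion r Z →
      ∃ R, ∫⁻ x in openCube p (r / 2), ‖F x - R‖ₑ ^ 2 ≤ C * ∫⁻ x in openCube p (r / 2), e x)
    (he : ∫⁻ x in cubeUnion r Z, e x ≠ ⊤)
    {R : Z → EuclideanSpace ℝ (Fin d) →L[ℝ] EuclideanSpace ℝ (Fin d)}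
    (hR : ∀ z : Z, ∫⁻ x in openCube (gridPoint r z.1) (r / 2), ‖F x - R z‖ₑ ^ 2
      ≤ C * ∫⁻ x in openCube (gridPoint r z.1) (r / 2), e x) {z z' : Z} (h : GridAdj z.1 z'.1) :
    ‖R z - R z'‖ ≤ Real.sqrt (12 * C / (r / 2) ^ d) *
      (Real.sqrt (∫⁻ x in openCube (gridPoint r z.1) (r / 2), e x).toReal
        + Real.sqrt (∫⁻ x in openCube (gridPoint r z'.1) (r / 2), e x).toReal) := by
  wlog h' : ∃ i, z'.1 = z.1 + Pi.single i 1 generalizing z z'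
  · have := this h.symm (by
      obtain ⟨i, hi | hi⟩ := h
      · exact absurd ⟨i, hi⟩ h'
      · exact ⟨i, hi⟩)
    rwa [norm_sub_rev, add_comm]
  obtain ⟨i, hi⟩ := h'
  have hp' : gridPoint r z'.1 = gridPoint r z.1 + EuclideanSpace.single i r := by
    rw [hi, gridPoint_add_single]
  have hsub : openCube (gridPoint r z.1 + EuclideanSpace.single i (r / 2)) (r / 2)
      ⊆ cubeUnion r Z := by
    refine interior_maximal ((openCube_subset_union _ i).trans (union_subset ?_ ?_))
      (isOpen_openCube _ _)
    · exact subset_biUnion_of_mem (u := fun z => closedCube (gridPoint r z) (r / 2)) z.2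
    · rw [← hp']
      exact subset_biUnion_of_mem (u := fun z => closedCube (gridPoint r z) (r / 2)) z'.2
  obtain ⟨S, hS⟩ := hC _ hsub
  have hfin : ∀ w : Z, ∫⁻ x in openCube (gridPoint r w.1) (r / 2), e x ≠ ⊤ := fun w =>
    ne_top_of_le_ne_top he (lintegral_mono_set (openCube_subset_cubeUnion w.2))
  have key := rotation_sub_le_of_adjacent hF hr rfl hp' (hR z) hS (hR z')
  set A := ∫⁻ x in openCube (gridPoint r z.1) (r / 2), e x
  set B := ∫⁻ x in openCube (gridPoint r z'.1) (r / 2), e x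
  have hA : A ≠ ⊤ := hfin z
  have hB : B ≠ ⊤ := hfin z'
  have hρ : 0 < (r / 2) ^ d := by positivity
  have key' : ‖R z - R z'‖ ^ 2 * (r / 2) ^ d ≤ 12 * C * (A.toReal + B.toReal) := by
    have := ENNReal.toReal_mono (by finiteness) key
    rwa [ENNReal.toReal_mul, ENNReal.toReal_pow, ENNReal.toReal_ofReal hρ.le, toReal_enorm,
      ENNReal.toReal_mul, ENNReal.toReal_mul, ENNReal.toReal_add hA hB, ENNReal.coe_toReal,
      ENNReal.toReal_ofNat] at this
  refine (pow_le_pow_iff_left₀ (norm_nonneg _) (by positivity) two_ne_zero).1 ?_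
  rw [mul_pow, Real.sq_sqrt (by positivity), div_mul_eq_mul_div, le_div_iff₀ hρ]
  refine key'.trans (mul_le_mul_of_nonneg_left ?_ (by positivity))
  nlinarith [Real.sq_sqrt (ENNReal.toReal_nonneg (a := A)),
    Real.sq_sqrt (ENNReal.toReal_nonneg (a := B)),
    mul_nonneg (Real.sqrt_nonneg A.toReal) (Real.sqrt_nonneg B.toReal)]

set_option maxHeartbeats 800000 in
/-- Rigidity on connected unions of grid cubes, in terms of lower Lebesgue integrals. -/
lemma exists_rigidity_cubeUnion {d : ℕ} (hd : 0 < d) : ∃ C : ℝ, 0 < C ∧ ∀ r : ℝ, 0 < r →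
    ∀ Z : Set (Fin d → ℤ), Z.Finite → IsConnected (cubeUnion r Z) →
    ∀ y : EuclideanSpace ℝ (Fin d) → EuclideanSpace ℝ (Fin d),
        DifferentiableOn ℝ y (cubeUnion r Z) →
    ∫⁻ x in cubeUnion r Z, ENNReal.ofReal (Metric.infDist (fderiv ℝ y x) (SOcl d) ^ 2) ≠ ⊤ →
      ∃ R ∈ SOcl d, ∫⁻ x in cubeUnion r Z, ‖fderiv ℝ y x - R‖ₑ ^ 2
        ≤ ENNReal.ofReal (C * (Nat.card Z : ℝ) ^ 2) *
          ∫⁻ x in cubeUnion r Z, ENNReal.ofReal (Metric.infDist (fderiv ℝ y x) (SOcl d) ^ 2) := by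
  obtain ⟨C, hC⟩ := exists_rigidity_openCube hd
  refine ⟨2 * C + 96 * C * 2 ^ d + 1, by positivity, fun r hr Z hZ hc y hy he => ?_⟩
  have := hZ.fintype
  choose R hRmem hR using fun z : Z => hC (gridPoint r z.1) (r / 2) (half_pos hr) y
    (hy.mono (openCube_subset_cubeUnion z.2))
  have hF : Measurable (fderiv ℝ y) := measurable_fderiv ℝ y
  set e : EuclideanSpace ℝ (Fin d) → ENNReal := fun x =>
    ENNReal.ofReal (Metric.infDist (fderiv ℝ y x) (SOcl d) ^ 2) with he_def
  set E : Z → ENNReal := fun z => ∫⁻ x in openCube (gridPoint r z.1) (r / 2), e x with hE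
  have hsum : ∑ z, E z ≤ ∫⁻ x in cubeUnion r Z, e x := sum_lintegral_openCube_le hr Z e
  have hsumfin : ∑ z, E z ≠ ⊤ := ne_top_of_le_ne_top he hsum
  have hEfin : ∀ z, E z ≠ ⊤ := fun z => ENNReal.sum_ne_top.1 hsumfin z (Finset.mem_univ z)
  obtain ⟨x, hx⟩ := hc.nonempty
  obtain ⟨w, hw, -⟩ := mem_iUnion₂.1 (interior_subset hx)
  set z₀ : Z := ⟨w, hw⟩
  set N : ℝ := (Nat.card Z : ℝ) with hN
  have hNcard : (Fintype.card Z : ℝ) = N := by rw [hN, Nat.card_eq_fintype_card]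
  have hN1 : 1 ≤ N := by
    rw [← hNcard]
    exact_mod_cast Fintype.card_pos_iff.2 ⟨z₀⟩
  set ρ : ℝ := (r / 2) ^ d with hρ_def
  have hρ : 0 < ρ := by positivity
  set S : ℝ := (∑ z, E z).toReal with hS
  have hSsum : S = ∑ z, (E z).toReal := ENNReal.toReal_sum fun z _ => hEfin z
  have hS0 : 0 ≤ S := ENNReal.toReal_nonneg
  have hdist : ∀ z, ‖R z - R z₀‖ ^ 2 ≤ 48 * C / ρ * N * S := by
    intro z
    have h1 := (cubeGraph_preconnected hr hZ hc.isPreconnected).norm_sub_le (R := R)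
      (a := fun z => Real.sqrt (E z).toReal) (fun _ => Real.sqrt_nonneg _) (Real.sqrt_nonneg _)
      (fun u v huv => norm_sub_le_of_gridAdj hr hF (fun p hp => by
        obtain ⟨Q, -, hQ⟩ := hC p (r / 2) (half_pos hr) y (hy.mono hp)
        exact ⟨Q, hQ⟩) he hR huv) z z₀
    have h2 : (∑ z, Real.sqrt (E z).toReal) ^ 2 ≤ N * S := by
      have := sq_sum_le_card_mul_sum_sq (s := Finset.univ) (f := fun z => Real.sqrt (E z).toReal)
      rw [Finset.card_univ, hNcard] at this
      refine this.trans (mul_le_mul_of_nonneg_left (le_of_eq ?_) (by positivity))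
      rw [hSsum]
      exact Finset.sum_congr rfl fun z _ => Real.sq_sqrt ENNReal.toReal_nonneg
    calc ‖R z - R z₀‖ ^ 2
        ≤ (2 * Real.sqrt (12 * C / ρ) * ∑ z, Real.sqrt (E z).toReal) ^ 2 :=
          pow_le_pow_left₀ (norm_nonneg _) h1 2
      _ = 4 * (12 * C / ρ) * (∑ z, Real.sqrt (E z).toReal) ^ 2 := by
          rw [mul_pow, mul_pow, Real.sq_sqrt (by positivity)]
          norm_num
      _ ≤ 4 * (12 * C / ρ) * (N * S) := mul_le_mul_of_nonneg_left h2 (by positivity)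
      _ = _ := by ring
  have hcube : ∀ z, ∫⁻ x in openCube (gridPoint r z.1) (r / 2), ‖fderiv ℝ y x - R z₀‖ₑ ^ 2
      ≤ 2 * C * E z + ENNReal.ofReal (96 * C * 2 ^ d * N * S) := by
    intro z
    calc ∫⁻ x in openCube (gridPoint r z.1) (r / 2), ‖fderiv ℝ y x - R z₀‖ₑ ^ 2
        ≤ ∫⁻ x in openCube (gridPoint r z.1) (r / 2),
            (2 * ‖fderiv ℝ y x - R z‖ₑ ^ 2 + 2 * ‖R z - R z₀‖ₑ ^ 2) :=
          lintegral_mono fun x => sq_enorm_sub_le _ _ _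
      _ = 2 * (∫⁻ x in openCube (gridPoint r z.1) (r / 2), ‖fderiv ℝ y x - R z‖ₑ ^ 2)
            + 2 * ‖R z - R z₀‖ₑ ^ 2 * ENNReal.ofReal ((2 * (r / 2)) ^ d) := by
          rw [lintegral_add_right _ measurable_const, lintegral_const_mul' _ _ (by norm_num),
            setLIntegral_const, volume_openCube _ (half_pos hr)]
      _ ≤ 2 * (C * E z) + 2 * ENNReal.ofReal (48 * C / ρ * N * S)
            * ENNReal.ofReal ((2 * (r / 2)) ^ d) := by
          refine add_le_add (mul_le_mul' le_rfl (hR z)) (mul_le_mul' (mul_le_mul' le_rfl ?_) le_rfl)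
          rw [sq_enorm_eq_ofReal]
          exact ENNReal.ofReal_le_ofReal (hdist z)
      _ = _ := by
          rw [← ENNReal.ofReal_ofNat 2, ← ENNReal.ofReal_mul (by norm_num),
            ← ENNReal.ofReal_mul (by positivity), mul_pow, ← hρ_def]
          refine congrArg₂ _ (mul_assoc _ _ _).symm (congrArg _ ?_)
          field_simp
          ring
  refine ⟨R z₀, hRmem z₀, (lintegral_cubeUnion_le_sum hr Z _).trans ?_⟩
  calc ∑ z : Z, ∫⁻ x in openCube (gridPoint r z.1) (r / 2), ‖fderiv ℝ y x - R z₀‖ₑ ^ 2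
      ≤ ∑ z : Z, (2 * C * E z + ENNReal.ofReal (96 * C * 2 ^ d * N * S)) :=
        Finset.sum_le_sum fun z _ => hcube z
    _ = ENNReal.ofReal (2 * C * S + N * (96 * C * 2 ^ d * N * S)) := by
        rw [Finset.sum_add_distrib, ← Finset.mul_sum, Finset.sum_const, Finset.card_univ,
          nsmul_eq_mul, ENNReal.ofReal_add (by positivity) (by positivity),
          ENNReal.ofReal_mul (p := 2 * (C : ℝ)) (by positivity),
          ENNReal.ofReal_mul (p := 2) (by positivity),
          ENNReal.ofReal_toReal hsumfin, ENNReal.ofReal_mul (p := N) (by positivity), ← hNcard,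
          ENNReal.ofReal_natCast, ENNReal.ofReal_ofNat, ENNReal.ofReal_coe_nnreal]
    _ ≤ ENNReal.ofReal ((2 * C + 96 * C * 2 ^ d + 1) * N ^ 2 * S) := by
        refine ENNReal.ofReal_le_ofReal ?_
        have hN2 : 1 ≤ N ^ 2 := one_le_pow₀ hN1
        have h1 : 2 * C * S * 1 ≤ 2 * C * S * N ^ 2 :=
          mul_le_mul_of_nonneg_left hN2 (by positivity)
        have h2 : 0 ≤ N ^ 2 * S := by positivity
        nlinarith
    _ = ENNReal.ofReal ((2 * C + 96 * C * 2 ^ d + 1) * N ^ 2) * ∑ z, E z := by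
        rw [ENNReal.ofReal_mul (by positivity), ENNReal.ofReal_toReal hsumfin]
    _ ≤ _ := mul_le_mul' le_rfl hsum

/-- Rigidity on cubic sets: there is an absolute constant `C > 0` such
that for every `y ∈ H¹((U)^r; ℝ^d)` there is `R ∈ SO(d)` with
`∫ |∇y − R|² ≤ C (#𝒬_r(U))² ∫ dist²(∇y, SO(d))`. -/
theorem rigidity_on_cubic_sets (d : ℕ) (hd : 2 ≤ d) :
    ∃ C > (0:ℝ), ∀ (U : Set (EuclideanSpace ℝ (Fin d))), IsOpen U → Bornology.IsBounded U →
      ∀ r : ℝ, 0 < r → IsConnected (cubicSet d r U) →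
      ∀ y : EuclideanSpace ℝ (Fin d) → EuclideanSpace ℝ (Fin d),
        DifferentiableOn ℝ y (cubicSet d r U) →
        IntegrableOn (fun x => ‖fderiv ℝ y x‖^2) (cubicSet d r U) →
        IntegrableOn (fun x => (Metric.infDist (fderiv ℝ y x) (SOcl d))^2) (cubicSet d r U) →
        ∃ R ∈ SOcl d,
          ∫ x in cubicSet d r U, ‖fderiv ℝ y x - R‖^2
            ≤ C * (numCubes d r U : ℝ)^2
              * ∫ x in cubicSet d r U, (Metric.infDist (fderiv ℝ y x) (SOcl d))^2 := by
  obtain ⟨C, hC0, hC⟩ := exists_rigidity_cubeUnion (d := d) (by lia)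
  refine ⟨C, hC0, fun U _ hUb r hr hc y hy _ he => ?_⟩
  have hZ := finite_setOf_smallCube_meets hr hUb
  have hlint := ofReal_integral_eq_lintegral_ofReal he
    (Filter.Eventually.of_forall fun x => sq_nonneg _)
  rw [cubicSet_eq_cubeUnion hr] at hc hy hlint ⊢
  obtain ⟨R, hRmem, hR⟩ := hC r hr _ hZ hc y hy (by rw [← hlint]; exact ENNReal.ofReal_ne_top)
  refine ⟨R, hRmem, ?_⟩
  have hnonneg : 0 ≤ ∫ x in cubeUnion r {z | (smallCube d r z ∩ U).Nonempty},
      Metric.infDist (fderiv ℝ y x) (SOcl d) ^ 2 := integral_nonneg fun x => sq_nonneg _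
  rw [← hlint, ← ENNReal.ofReal_mul (by positivity)] at hR
  rw [integral_eq_lintegral_of_nonneg_ae (Filter.Eventually.of_forall fun x => sq_nonneg _)
    (((measurable_fderiv ℝ y).sub_const R).norm.pow_const 2).aestronglyMeasurable]
  simp only [← sq_enorm_eq_ofReal]
  exact ENNReal.toReal_le_of_le_ofReal (by positivity) hR
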